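/- Let f ∈ L_p^0(T²), 1<p<∞, θ=min(2,p), τ=max(2,p), r₁,r₂>0, 0<α₁<β₁, 0<α₂<β₂, δ₁,δ₂ ∈ (0,1/2). For 1<s<∞ define D(s) = {∫_{δ₁}¹∫_{δ₂}¹ (δ₁/t₁)^{(β₁−α₁)s} (δ₂/t₂)^{(β₂−α₂)s} ω_{β₁,β₂}(f^{(r₁+α₁,r₂+α₂)},t₁,t₂)_p^s (dt₁/t₁)(dt₂/t₂)}^{1/s} and E(s) = {∫₀^{δ₁}∫₀^{δ₂} t₁^{−(r₁+α₁)s−1} t₂^{−(r₂+α₂)s−1} ω_{r₁+β₁,r₂+β₂}(f,t₁,t₂)_p^s dt₁ dt₂}^{1/s}. (A) If ∫₀¹∫₀¹ t₁^{−(r₁+α₁)θ−1} t₂^{−(r₂+α₂)θ−1} ω_{r₁+β₁,r₂+β₂}(f,t₁,t₂)_p^θ dt₁ dt₂ < ∞, then f has a mixed Weyl derivative f^{(r₁+α₁,r₂+α₂)} ∈ L_p^0(T²) and D(τ) ≲ E(θ). (B) If f has a mixed Weyl derivative f^{(r₁+α₁,r₂+α₂)} ∈ L_p^0(T²), then E(τ)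 ≲ D(θ). -/

import Mathlib

open MeasureTheory Real
open scoped ENNReal

noncomputable section

/-- The `L_p` norm of a function of two variables over the period square `(0,2π]²`. -/
def Lp2Norm (p : ℝ) (f : ℝ → ℝ → ℝ) : ℝ≥0∞ :=
  (∫⁻ x in Set.Ioc (0:ℝ) (2*π), ∫⁻ y in Set.Ioc (0:ℝ) (2*π),
      ENNReal.ofReal (|f x y| ^ p)) ^ (1/p)

/-- `f ∈ L_p^0(T²)`: measurable, `2π`-periodic in each variable, finite `L_p` norm,
and zero mean in each variable separately. -/
structure MemLp0 (p : ℝ) (f : ℝ → ℝ → ℝ) : Prop where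
  meas : Measurable (Function.uncurry f)
  periodic_x : ∀ y, Function.Periodic (fun x => f x y) (2*π)
  periodic_y : ∀ x, Function.Periodic (f x) (2*π)
  norm_ne_top : Lp2Norm p f ≠ ⊤
  mean_x : ∀ᵐ (y : ℝ) ∂volume, (∫ x in (0:ℝ)..(2*π), f x y) = 0
  mean_y : ∀ᵐ (x : ℝ) ∂volume, (∫ y in (0:ℝ)..(2*π), f x y) = 0

/-- Generalized (fractional) binomial coefficient `C(α,ν) = α(α-1)⋯(α-ν+1)/ν!`. -/
def fracBinom (α : ℝ) : ℕ → ℝ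
  | 0 => 1
  | n+1 => fracBinom α n * (α - (n : ℝ)) / ((n : ℝ) + 1)

/-- Fractional difference of order `α` with step `h` in the first variable. -/
def diffX (α h : ℝ) (f : ℝ → ℝ → ℝ) : ℝ → ℝ → ℝ :=
  fun x y => ∑' ν : ℕ, (-1 : ℝ) ^ ν * fracBinom α ν * f (x + (α - (ν : ℝ)) * h) y

/-- Fractional difference of order `α` with step `h` in the second variable. -/
def diffY (α h : ℝ) (f : ℝ → ℝ → ℝ) : ℝ → ℝ → ℝ :=
  fun x y => ∑' ν : ℕ, (-1 : ℝ) ^ ν * fracBinom α ν * f x (y + (α - (ν : ℝ)) * h)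

/-- The mixed (fractional) modulus of smoothness `ω_{α₁,α₂}(f, δ₁, δ₂)_p`. -/
def mixedMod (p α₁ α₂ δ₁ δ₂ : ℝ) (f : ℝ → ℝ → ℝ) : ℝ≥0∞ :=
  ⨆ (h₁ : ℝ) (_ : |h₁| ≤ δ₁) (h₂ : ℝ) (_ : |h₂| ≤ δ₂),
    Lp2Norm p (diffX α₁ h₁ (diffY α₂ h₂ f))

/-- Complex Fourier coefficient of a (real-valued) function on `T²`. -/
def fourierCoefZ (f : ℝ → ℝ → ℝ) (m₁ m₂ : ℤ) : ℂ :=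
  (((2*π)^2)⁻¹ : ℝ) * ∫ x in (0:ℝ)..(2*π), ∫ y in (0:ℝ)..(2*π),
    (f x y : ℂ) * Complex.exp (-Complex.I * ((m₁ : ℂ) * (x : ℂ) + (m₂ : ℂ) * (y : ℂ)))

/-- `g` is the mixed Weyl derivative `f^{(ρ₁,ρ₂)}` of `f` (and `g ∈ L_p^0(T²)`):
the Fourier coefficients of `g` arise from those of `f` by multiplication
with `(i m₁)^{ρ₁} (i m₂)^{ρ₂}`. -/
def HasWeylDeriv (p ρ₁ ρ₂ : ℝ) (f g : ℝ → ℝ → ℝ) : Prop :=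
  MemLp0 p g ∧ ∀ m₁ m₂ : ℤ,
    fourierCoefZ g m₁ m₂ =
      (Complex.I * (m₁ : ℂ)) ^ (ρ₁ : ℂ) * (Complex.I * (m₂ : ℂ)) ^ (ρ₂ : ℂ) * fourierCoefZ f m₁ m₂

/-- The quantity `D(s)` of Theorem 8.4 (ii), evaluated at the derivative `g`. -/
def Dfun (p β₁ β₂ α₁ α₂ δ₁ δ₂ s : ℝ) (g : ℝ → ℝ → ℝ) : ℝ≥0∞ :=
  (∫⁻ t₁ in Set.Ioo δ₁ 1, ∫⁻ t₂ in Set.Ioo δ₂ 1,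
      ENNReal.ofReal ((δ₁/t₁) ^ ((β₁-α₁)*s) / t₁ * ((δ₂/t₂) ^ ((β₂-α₂)*s) / t₂)) *
        mixedMod p β₁ β₂ t₁ t₂ g ^ s) ^ (1/s)

/-- The quantity `E(s)` of Theorem 8.4 (ii). -/
def Efun (p β₁ β₂ r₁ r₂ α₁ α₂ δ₁ δ₂ s : ℝ) (f : ℝ → ℝ → ℝ) : ℝ≥0∞ :=
  (∫⁻ t₁ in Set.Ioo (0:ℝ) δ₁, ∫⁻ t₂ in Set.Ioo (0:ℝ) δ₂,
      ENNReal.ofReal (t₁ ^ (-(r₁+α₁)*s-1) * t₂ ^ (-(r₂+α₂)*s-1)) *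
        mixedMod p (r₁+β₁) (r₂+β₂) t₁ t₂ f ^ s) ^ (1/s)

namespace MixedModulus

/-! ### Two-point inequalities for scalars -/

lemma avg_rpow_le {s a b : ℝ} (hs0 : 0 ≤ s) (hs : s ≤ 1) (ha : 0 ≤ a) (hb : 0 ≤ b) :
    (a ^ s + b ^ s) / 2 ≤ ((a + b) / 2) ^ s := by
  have h := (Real.concaveOn_rpow hs0 hs).2 (Set.mem_Ici.2 ha) (Set.mem_Ici.2 hb)
    (by norm_num : (0:ℝ) ≤ 1/2) (by norm_num : (0:ℝ) ≤ 1/2) (by norm_num)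
  simp only [smul_eq_mul] at h
  calc (a ^ s + b ^ s) / 2 = 1/2 * a ^ s + 1/2 * b ^ s := by ring
    _ ≤ _ := h
    _ = _ := by ring_nf

lemma rpow_avg_le {s a b : ℝ} (hs : 1 ≤ s) (ha : 0 ≤ a) (hb : 0 ≤ b) :
    ((a + b) / 2) ^ s ≤ (a ^ s + b ^ s) / 2 := by
  have h := (convexOn_rpow hs).2 (Set.mem_Ici.2 ha) (Set.mem_Ici.2 hb)
    (by norm_num : (0:ℝ) ≤ 1/2) (by norm_num : (0:ℝ) ≤ 1/2) (by norm_num)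
  simp only [smul_eq_mul] at h
  calc ((a + b) / 2) ^ s = (1/2 * a + 1/2 * b) ^ s := by ring_nf
    _ ≤ _ := h
    _ = _ := by ring

lemma sq_rpow_half {p a : ℝ} (ha : 0 ≤ a) : (a ^ 2) ^ (p / 2) = a ^ p := by
  rw [← Real.rpow_natCast, ← Real.rpow_mul ha]; congr 1; push_cast; ring

lemma norm_sq_add_sub (b d : ℂ) : (‖b + d‖ ^ 2 + ‖b - d‖ ^ 2) / 2 = ‖b‖ ^ 2 + ‖d‖ ^ 2 := by
  have := parallelogram_law_with_norm ℂ b d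
  linarith

lemma clarkson_scalar_lower {p : ℝ} (hp : 2 ≤ p) (b d : ℂ) :
    ‖b‖ ^ p + ‖d‖ ^ p ≤ (‖b + d‖ ^ p + ‖b - d‖ ^ p) / 2 := by
  have h1 := rpow_avg_le (s := p / 2) (by linarith) (sq_nonneg ‖b + d‖) (sq_nonneg ‖b - d‖)
  have h2 := add_rpow_le_rpow_add (p := p / 2) (sq_nonneg ‖b‖) (sq_nonneg ‖d‖) (by linarith)
  rw [norm_sq_add_sub] at h1
  simp only [sq_rpow_half (norm_nonneg _)] at h1 h2
  linarith

lemma clarkson_scalar_upper {p : ℝ} (hp0 : 0 ≤ p) (hp : p ≤ 2) (b d : ℂ) :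
    (‖b + d‖ ^ p + ‖b - d‖ ^ p) / 2 ≤ ‖b‖ ^ p + ‖d‖ ^ p := by
  have h1 := avg_rpow_le (s := p / 2) (by linarith) (by linarith)
    (sq_nonneg ‖b + d‖) (sq_nonneg ‖b - d‖)
  have h2 := rpow_add_le_add_rpow (p := p / 2) (sq_nonneg ‖b‖) (sq_nonneg ‖d‖)
    (by linarith) (by linarith)
  rw [norm_sq_add_sub] at h1
  simp only [sq_rpow_half (norm_nonneg _)] at h1 h2
  linarith

lemma one_add_pow_le_quadratic (n : ℕ) {x : ℝ} (hx : |x| ≤ 1) :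
    (1 + x) ^ n ≤ 1 + n * x + 3 ^ n * x ^ 2 := by
  obtain ⟨h1, h2⟩ := abs_le.1 hx
  induction n with
  | zero => simp; positivity
  | succ n ih =>
    have hn : (n : ℝ) ≤ 3 ^ n := by
      exact_mod_cast (Nat.lt_pow_self (by norm_num : 1 < 3) (n := n)).le
    calc (1 + x) ^ (n + 1) = (1 + x) ^ n * (1 + x) := pow_succ _ _
      _ ≤ (1 + n * x + 3 ^ n * x ^ 2) * (1 + x) := by gcongr; linarith
      _ = 1 + (n + 1) * x + x ^ 2 * (n + 3 ^ n + 3 ^ n * x) := by ring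
      _ ≤ 1 + (n + 1) * x + x ^ 2 * (3 ^ n + 3 ^ n + 3 ^ n * 1) := by gcongr
      _ = _ := by push_cast; ring

lemma abs_norm_sq_add_sub_le (b d : ℂ) :
    |‖b + d‖ ^ 2 - (‖b‖ ^ 2 + ‖d‖ ^ 2)| ≤ 2 * (‖b‖ * ‖d‖) := by
  have h := norm_sq_add_sub b d
  have h1 := norm_add_le b d
  have h2 := norm_sub_le b d
  rw [abs_le]
  constructor
  · nlinarith [norm_nonneg (b - d), norm_nonneg b, norm_nonneg d]
  · nlinarith [norm_nonneg (b + d), norm_nonneg b, norm_nonneg d]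

lemma pow_two_point_upper (n : ℕ) (hn : 1 ≤ n) (b d : ℂ) :
    ((‖b + d‖ ^ 2) ^ n + (‖b - d‖ ^ 2) ^ n) / 2 ≤ (‖b‖ ^ 2 + (1 + 4 * 3 ^ n) * ‖d‖ ^ 2) ^ n := by
  set S := ‖b‖ ^ 2 + ‖d‖ ^ 2 with hS
  rcases eq_or_lt_of_le (show 0 ≤ S by positivity) with h0 | hpos
  · have hb : ‖b‖ = 0 := by nlinarith [sq_nonneg ‖b‖, sq_nonneg ‖d‖]
    have hd : ‖d‖ = 0 := by nlinarith [sq_nonneg ‖b‖, sq_nonneg ‖d‖]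
    rw [norm_eq_zero] at hb hd
    subst hb; subst hd
    simp [show n ≠ 0 by omega]
  · set x := (‖b + d‖ ^ 2 - S) / S with hx
    have e1 : ‖b + d‖ ^ 2 = S * (1 + x) := by rw [hx]; field_simp; ring
    have e2 : ‖b - d‖ ^ 2 = S * (1 + -x) := by
      have := norm_sq_add_sub b d
      have h3 : S * x = ‖b + d‖ ^ 2 - S := by rw [hx]; field_simp
      linarith
    have hSx : (S * x) ^ 2 ≤ 4 * (‖b‖ ^ 2 * ‖d‖ ^ 2) := by
      have h3 : S * x = ‖b + d‖ ^ 2 - S := by rw [hx]; field_simp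
      rw [h3, ← sq_abs]
      calc |‖b + d‖ ^ 2 - S| ^ 2 ≤ (2 * (‖b‖ * ‖d‖)) ^ 2 := by
            gcongr; exact abs_norm_sq_add_sub_le b d
        _ = _ := by ring
    have hx1 : |x| ≤ 1 := by
      have : (S * x) ^ 2 ≤ S ^ 2 := hSx.trans (by rw [hS]; nlinarith [sq_nonneg (‖b‖ ^ 2 - ‖d‖ ^ 2)])
      rw [mul_pow] at this
      have h4 : x ^ 2 ≤ 1 := by
        have : 0 < S ^ 2 := by positivity
        nlinarith
      exact abs_le_one_iff_mul_self_le_one.2 (by nlinarith)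
    have h5 := one_add_pow_le_quadratic n hx1
    have h6 := one_add_pow_le_quadratic n (x := -x) (by rwa [abs_neg])
    have hSx2 : S * x ^ 2 ≤ 4 * ‖d‖ ^ 2 := by
      have : S * (S * x ^ 2) ≤ S * (4 * ‖d‖ ^ 2) := by
        calc S * (S * x ^ 2) = (S * x) ^ 2 := by ring
          _ ≤ _ := hSx
          _ ≤ _ := by rw [hS]; nlinarith [sq_nonneg (‖d‖ ^ 2)]
      exact le_of_mul_le_mul_left this hpos
    rw [e1, e2, mul_pow, mul_pow]
    calc (S ^ n * (1 + x) ^ n + S ^ n * (1 + -x) ^ n) / 2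
        = S ^ n * (((1 + x) ^ n + (1 + -x) ^ n) / 2) := by ring
      _ ≤ S ^ n * (1 + 3 ^ n * x ^ 2) := by gcongr; nlinarith
      _ ≤ S ^ n * (1 + 3 ^ n * x ^ 2) ^ n := by
          gcongr
          exact le_self_pow₀ (by nlinarith [sq_nonneg x, show (0:ℝ) < 3 ^ n by positivity]) (by omega)
      _ = (S + 3 ^ n * (S * x ^ 2)) ^ n := by rw [← mul_pow]; ring
      _ ≤ _ := by
          refine pow_le_pow_left₀ (by positivity) ?_ n
          have := mul_le_mul_of_nonneg_left hSx2 (show (0:ℝ) ≤ 3 ^ n by positivity)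
          rw [hS] at this ⊢
          linarith

lemma two_point_upper_scalar {p : ℝ} (hp : 2 ≤ p) : ∃ C : ℝ, 1 ≤ C ∧ ∀ b d : ℂ,
    (‖b + d‖ ^ p + ‖b - d‖ ^ p) / 2 ≤ (‖b‖ ^ 2 + C * ‖d‖ ^ 2) ^ (p / 2) := by
  obtain ⟨n, hn⟩ := exists_nat_ge (p / 2)
  have hn1 : (1:ℝ) ≤ n := by linarith
  have hn1' : 1 ≤ n := by exact_mod_cast hn1
  refine ⟨1 + 4 * 3 ^ n, by linarith [show (0:ℝ) < 3 ^ n by positivity], fun b d => ?_⟩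
  have hs0 : 0 ≤ p / 2 / n := by positivity
  have hs1 : p / 2 / n ≤ 1 := by rw [div_le_one (by linarith)]; exact hn
  have key : ∀ a : ℝ, 0 ≤ a → (a ^ n) ^ (p / 2 / n) = a ^ (p / 2) := by
    intro a ha
    rw [← Real.rpow_natCast, ← Real.rpow_mul ha]
    congr 1; field_simp
  have h := avg_rpow_le hs0 hs1 (pow_nonneg (sq_nonneg ‖b + d‖) n) (pow_nonneg (sq_nonneg ‖b - d‖) n)
  rw [key _ (sq_nonneg _), key _ (sq_nonneg _), sq_rpow_half (norm_nonneg _),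
    sq_rpow_half (norm_nonneg _)] at h
  refine h.trans ?_
  rw [← key (‖b‖ ^ 2 + (1 + 4 * 3 ^ n) * ‖d‖ ^ 2) (by positivity)]
  exact Real.rpow_le_rpow (by positivity) (pow_two_point_upper n hn1' b d) hs0

lemma inv_add_inv_ge {a b : ℝ} (ha : 0 < a) (hb : 0 < b) (hab : a * b ≤ 1) : 2 ≤ a⁻¹ + b⁻¹ := by
  rw [← one_div, ← one_div, div_add_div _ _ ha.ne' hb.ne', le_div_iff₀ (by positivity)]
  nlinarith [sq_nonneg (a - b), mul_pos ha hb]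

lemma one_add_rpow_add_one_sub_rpow_ge {p : ℝ} (hp1 : 1 < p) (hp : p ≤ 2) {t : ℝ} (ht0 : 0 ≤ t)
    (ht : t ≤ 1) : 2 + p * (p - 1) * t ^ 2 ≤ (1 + t) ^ p + (1 - t) ^ p := by
  set G : ℝ → ℝ := fun t => (1 + t) ^ p + (1 - t) ^ p - p * (p - 1) * t ^ 2 with hG
  have hd : ∀ x, HasDerivAt G
      (p * (1 + x) ^ (p - 1) - p * (1 - x) ^ (p - 1) - p * (p - 1) * (2 * x)) x := by
    intro x
    have h1 := ((hasDerivAt_id x).const_add 1).rpow_const (p := p) (Or.inr hp1.le)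
    have h2 := ((hasDerivAt_id x).const_sub 1).rpow_const (p := p) (Or.inr hp1.le)
    have h3 := ((hasDerivAt_pow 2 x).const_mul (p * (p - 1)))
    refine ((h1.add h2).sub h3).congr_deriv ?_
    simp only [id_eq]; push_cast; ring_nf
  have hconv : ConvexOn ℝ (Set.Icc (-1) 1) G := by
    refine convexOn_of_deriv2_nonneg (convex_Icc _ _)
      (fun x _ => (hd x).continuousAt.continuousWithinAt)
      (fun x _ => (hd x).differentiableAt.differentiableWithinAt) ?_ ?_
    all_goals
      have hdd : ∀ x ∈ interior (Set.Icc (-1:ℝ) 1), HasDerivAt (deriv G)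
        (p * ((p - 1) * (1 + x) ^ (p - 1 - 1)) + p * ((p - 1) * (1 - x) ^ (p - 1 - 1))
          - p * (p - 1) * 2) x := by
        intro x hx
        rw [interior_Icc] at hx
        have : deriv G = fun x => p * (1 + x) ^ (p - 1) - p * (1 - x) ^ (p - 1) -
          p * (p - 1) * (2 * x) := funext fun x => (hd x).deriv
        rw [this]
        have h1 := ((hasDerivAt_id x).const_add 1).rpow_const (p := p - 1)
          (Or.inl (by simp; linarith [hx.1]))
        have h2 := ((hasDerivAt_id x).const_sub 1).rpow_const (p := p - 1)
          (Or.inl (by simp; linarith [hx.2]))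
        have h3 := ((hasDerivAt_id x).const_mul 2).const_mul (p * (p - 1))
        refine (((h1.const_mul p).sub (h2.const_mul p)).sub h3).congr_deriv ?_
        simp only [id_eq]; ring_nf
    · exact fun x hx => (hdd x hx).differentiableAt.differentiableWithinAt
    · intro x hx
      have e : deriv^[2] G x = deriv (deriv G) x := rfl
      rw [e, (hdd x hx).deriv]
      rw [interior_Icc] at hx
      have ha : 0 < 1 + x := by linarith [hx.1]
      have hb : 0 < 1 - x := by linarith [hx.2]
      have h := inv_add_inv_ge (Real.rpow_pos_of_pos ha (2 - p)) (Real.rpow_pos_of_pos hb (2 - p))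
        (by rw [← Real.mul_rpow ha.le hb.le]
            exact Real.rpow_le_one (by positivity) (by nlinarith [sq_nonneg x]) (by linarith))
      rw [← Real.rpow_neg ha.le, ← Real.rpow_neg hb.le] at h
      have e2 : -(2 - p) = p - 1 - 1 := by ring
      rw [e2] at h
      have : 0 ≤ p * (p - 1) := mul_nonneg (by linarith) (by linarith)
      nlinarith
  have h := hconv.2 (x := t) ⟨by linarith, ht⟩ (y := -t) ⟨by linarith, by linarith⟩
    (by norm_num : (0:ℝ) ≤ 1/2) (by norm_num : (0:ℝ) ≤ 1/2) (by norm_num)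
  simp only [smul_eq_mul, hG] at h
  have e0 : 1/2 * t + 1/2 * -t = 0 := by ring
  rw [e0] at h
  simp only [add_zero, sub_zero, Real.one_rpow, sub_neg_eq_add, ← sub_eq_add_neg] at h
  nlinarith

lemma two_point_lower_real {p : ℝ} (hp1 : 1 < p) (hp : p ≤ 2) {m d : ℝ} (hd : 0 ≤ d)
    (hdm : d ≤ m) : (m ^ 2 + (p - 1) * d ^ 2) ^ (p / 2) ≤ ((m + d) ^ p + (m - d) ^ p) / 2 := by
  rcases eq_or_lt_of_le (hd.trans hdm) with h0 | hm
  · have : d = 0 := by linarith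
    subst this; subst h0
    simp [show p ≠ 0 by linarith, show p / 2 ≠ 0 by linarith]
  · set t := d / m
    have et : d = m * t := by simp only [t]; field_simp
    have ht0 : 0 ≤ t := by positivity
    have ht1 : t ≤ 1 := (div_le_one hm).2 hdm
    have h1 := one_add_rpow_add_one_sub_rpow_ge hp1 hp ht0 ht1
    have h2 := rpow_one_add_le_one_add_mul_self (s := (p - 1) * t ^ 2)
      (by nlinarith [mul_nonneg (show 0 ≤ p - 1 by linarith) (sq_nonneg t)]) (p := p / 2)
      (by linarith) (by linarith)
    rw [et]
    have e1 : m ^ 2 + (p - 1) * (m * t) ^ 2 = m ^ 2 * (1 + (p - 1) * t ^ 2) := by ring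
    have e2 : m + m * t = m * (1 + t) := by ring
    have e3 : m - m * t = m * (1 - t) := by ring
    have e4 : 0 ≤ 1 + (p - 1) * t ^ 2 := by
      nlinarith [mul_nonneg (show 0 ≤ p - 1 by linarith) (sq_nonneg t)]
    rw [e1, e2, e3, Real.mul_rpow (by positivity) e4,
      Real.mul_rpow hm.le (by linarith), Real.mul_rpow hm.le (by linarith), sq_rpow_half hm.le]
    have : 0 < m ^ p := Real.rpow_pos_of_pos hm p
    nlinarith

lemma two_point_lower_scalar_of_le {p : ℝ} (hp1 : 1 < p) (hp : p ≤ 2) {b d : ℂ}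
    (h : ‖d‖ ≤ ‖b‖) :
    (‖b‖ ^ 2 + (p - 1) * ‖d‖ ^ 2) ^ (p / 2) ≤ (‖b + d‖ ^ p + ‖b - d‖ ^ p) / 2 := by
  refine (two_point_lower_real hp1 hp (norm_nonneg d) h).trans ?_
  rcases eq_or_lt_of_le (norm_nonneg d) with h0 | hdpos
  · have : d = 0 := norm_eq_zero.1 h0.symm
    subst this; simp
  have hbpos : 0 < ‖b‖ := hdpos.trans_le h
  set Q := 2 * (‖b‖ * ‖d‖) with hQ
  have hQpos : 0 < Q := by positivity
  set R := ‖b + d‖ ^ 2 - (‖b‖ ^ 2 + ‖d‖ ^ 2) with hR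
  have hRQ := abs_le.1 (abs_norm_sq_add_sub_le b d)
  rw [← hR, ← hQ] at hRQ
  set a := (1 + R / Q) / 2 with ha
  have hRa : R = (2 * a - 1) * Q := by rw [ha]; field_simp; ring
  have ha0 : 0 ≤ a := by
    by_contra hcon
    nlinarith
  have ha1 : a ≤ 1 := by
    by_contra hcon
    nlinarith
  have hc := (Real.concaveOn_rpow (p := p / 2) (by linarith) (by linarith)).2
  have hX : (0:ℝ) ≤ (‖b‖ + ‖d‖) ^ 2 := sq_nonneg _
  have hY : (0:ℝ) ≤ (‖b‖ - ‖d‖) ^ 2 := sq_nonneg _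
  have h1 := hc (Set.mem_Ici.2 hX) (Set.mem_Ici.2 hY) ha0 (sub_nonneg.2 ha1) (by ring)
  have h2 := hc (Set.mem_Ici.2 hY) (Set.mem_Ici.2 hX) ha0 (sub_nonneg.2 ha1) (by ring)
  simp only [smul_eq_mul] at h1 h2
  have e1 : a * (‖b‖ + ‖d‖) ^ 2 + (1 - a) * (‖b‖ - ‖d‖) ^ 2 = ‖b + d‖ ^ 2 := by
    have : ‖b + d‖ ^ 2 = ‖b‖ ^ 2 + ‖d‖ ^ 2 + R := by rw [hR]; ring
    rw [this, hRa, hQ]; ring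
  have e2 : a * (‖b‖ - ‖d‖) ^ 2 + (1 - a) * (‖b‖ + ‖d‖) ^ 2 = ‖b - d‖ ^ 2 := by
    have h3 := norm_sq_add_sub b d
    have : ‖b - d‖ ^ 2 = ‖b‖ ^ 2 + ‖d‖ ^ 2 - R := by rw [hR]; linarith
    rw [this, hRa, hQ]; ring
  rw [e1] at h1
  rw [e2] at h2
  rw [sq_rpow_half (by linarith), sq_rpow_half (by linarith), sq_rpow_half (norm_nonneg _)] at h1
  rw [sq_rpow_half (by linarith), sq_rpow_half (by linarith), sq_rpow_half (norm_nonneg _)] at h2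
  linarith

lemma two_point_lower_scalar {p : ℝ} (hp1 : 1 < p) (hp : p ≤ 2) (b d : ℂ) :
    (‖b‖ ^ 2 + (p - 1) * ‖d‖ ^ 2) ^ (p / 2) ≤ (‖b + d‖ ^ p + ‖b - d‖ ^ p) / 2 := by
  rcases le_total ‖d‖ ‖b‖ with h | h
  · exact two_point_lower_scalar_of_le hp1 hp h
  · have h1 := two_point_lower_scalar_of_le hp1 hp h
    rw [add_comm d b, norm_sub_rev d b] at h1
    refine le_trans (Real.rpow_le_rpow ?_ ?_ (by linarith)) h1
    · nlinarith [sq_nonneg ‖b‖, sq_nonneg ‖d‖]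
    · nlinarith [pow_le_pow_left₀ (norm_nonneg b) h 2]

/-! ### Two-point inequalities in `L_p` -/

/-- A normed space is `τ`-uniformly convex in the two-point (martingale) sense. -/
def TwoPointConvex (E : Type*) [NormedAddCommGroup E] (τ : ℝ) : Prop :=
  ∃ c : ℝ, 0 < c ∧ ∀ b d : E, ‖b‖ ^ τ + c * ‖d‖ ^ τ ≤ (‖b + d‖ ^ τ + ‖b - d‖ ^ τ) / 2

/-- A normed space is `θ`-uniformly smooth in the two-point (martingale) sense. -/
def TwoPointSmooth (E : Type*) [NormedAddCommGroup E] (θ : ℝ) : Prop :=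
  ∃ C : ℝ, 0 < C ∧ ∀ b d : E, (‖b + d‖ ^ θ + ‖b - d‖ ^ θ) / 2 ≤ ‖b‖ ^ θ + C * ‖d‖ ^ θ

section LpSpace

variable {X : Type*} [MeasurableSpace X] {μ : Measure X} {p : ℝ}

lemma Lp_norm_rpow_eq_integral (hp : 0 < p) (f : Lp ℂ (ENNReal.ofReal p) μ) :
    ‖f‖ ^ p = ∫ x, ‖f x‖ ^ p ∂μ := by
  have h := MemLp.eLpNorm_eq_integral_rpow_norm (by simpa using hp) ENNReal.ofReal_ne_top
    (Lp.memLp f)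
  rw [ENNReal.toReal_ofReal hp.le] at h
  rw [Lp.norm_def, h, ENNReal.toReal_ofReal (by positivity), ← Real.rpow_mul (by positivity),
    inv_mul_cancel₀ hp.ne', Real.rpow_one]

lemma Lp_integrable_norm_rpow (hp : 0 < p) (f : Lp ℂ (ENNReal.ofReal p) μ) :
    Integrable (fun x => ‖f x‖ ^ p) μ := by
  have h := MemLp.integrable_norm_rpow (Lp.memLp f) (by simpa using hp) ENNReal.ofReal_ne_top
  rwa [ENNReal.toReal_ofReal hp.le] at h

variable (b d : Lp ℂ (ENNReal.ofReal p) μ)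

lemma integral_two_point (hp : 0 < p) :
    (‖b + d‖ ^ p + ‖b - d‖ ^ p) / 2 = ∫ x, (‖b x + d x‖ ^ p + ‖b x - d x‖ ^ p) / 2 ∂μ := by
  have e1 : ‖b + d‖ ^ p = ∫ x, ‖b x + d x‖ ^ p ∂μ := by
    rw [Lp_norm_rpow_eq_integral hp]
    refine integral_congr_ae ?_
    filter_upwards [Lp.coeFn_add b d] with x hx
    simp only [hx, Pi.add_apply]
  have e2 : ‖b - d‖ ^ p = ∫ x, ‖b x - d x‖ ^ p ∂μ := by
    rw [Lp_norm_rpow_eq_integral hp]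
    refine integral_congr_ae ?_
    filter_upwards [Lp.coeFn_sub b d] with x hx
    simp only [hx, Pi.sub_apply]
  rw [e1, e2, integral_div, integral_add]
  · refine (Lp_integrable_norm_rpow hp (b + d)).congr ?_
    filter_upwards [Lp.coeFn_add b d] with x hx
    simp only [hx, Pi.add_apply]
  · refine (Lp_integrable_norm_rpow hp (b - d)).congr ?_
    filter_upwards [Lp.coeFn_sub b d] with x hx
    simp only [hx, Pi.sub_apply]

lemma integrable_two_point (hp : 0 < p) :
    Integrable (fun x => (‖b x + d x‖ ^ p + ‖b x - d x‖ ^ p) / 2) μ := by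
  refine ((Integrable.congr (Lp_integrable_norm_rpow hp (b + d)) ?_).add
    (Integrable.congr (Lp_integrable_norm_rpow hp (b - d)) ?_)).div_const 2
  · filter_upwards [Lp.coeFn_add b d] with x hx
    simp only [hx, Pi.add_apply]
  · filter_upwards [Lp.coeFn_sub b d] with x hx
    simp only [hx, Pi.sub_apply]

lemma integral_combination (hp : 0 < p) (k l : ℝ) :
    k * ‖b‖ ^ p + l * ‖d‖ ^ p = ∫ x, (k * ‖b x‖ ^ p + l * ‖d x‖ ^ p) ∂μ := by
  rw [integral_add, integral_const_mul, integral_const_mul, Lp_norm_rpow_eq_integral hp,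
    Lp_norm_rpow_eq_integral hp]
  · exact (Lp_integrable_norm_rpow hp b).const_mul _
  · exact (Lp_integrable_norm_rpow hp d).const_mul _

lemma integrable_combination (hp : 0 < p) (k l : ℝ) :
    Integrable (fun x => k * ‖b x‖ ^ p + l * ‖d x‖ ^ p) μ :=
  ((Lp_integrable_norm_rpow hp b).const_mul _).add ((Lp_integrable_norm_rpow hp d).const_mul _)

/-- The weight making Minkowski's inequality for `‖·‖^2` sharp. -/
lemma weighted_sum_rpow {s B D : ℝ} (hB : 0 < B) (hD : 0 < D) :
    (B / (B + D)) ^ (1 - s) * B ^ s + (D / (B + D)) ^ (1 - s) * D ^ s = (B + D) ^ s := by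
  have h : 0 < B + D := by positivity
  have e : ∀ A : ℝ, 0 < A → (A / (B + D)) ^ (1 - s) * A ^ s = A * (B + D) ^ (s - 1) := by
    intro A hA
    rw [Real.div_rpow hA.le h.le, div_mul_eq_mul_div, ← Real.rpow_add hA,
      show s - 1 = -(1 - s) by ring, Real.rpow_neg h.le]
    simp [div_eq_mul_inv]
  rw [e B hB, e D hD, ← add_mul]
  nth_rewrite 1 [← Real.rpow_one (B + D)]
  rw [← Real.rpow_add h]
  congr 1; ring

lemma weighted_rpow_eq {s B D u : ℝ} (hB : 0 < B) (hD : 0 < D) (hu : 0 ≤ u) :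
    B / (B + D) * (u / (B / (B + D))) ^ s = (B / (B + D)) ^ (1 - s) * u ^ s := by
  have h : 0 < B / (B + D) := by positivity
  rw [Real.div_rpow hu h.le, Real.rpow_sub h, Real.rpow_one]
  ring

lemma weighted_le_rpow_add {s B D u v : ℝ} (hs0 : 0 ≤ s) (hs : s ≤ 1) (hB : 0 < B) (hD : 0 < D)
    (hu : 0 ≤ u) (hv : 0 ≤ v) :
    (B / (B + D)) ^ (1 - s) * u ^ s + (D / (B + D)) ^ (1 - s) * v ^ s ≤ (u + v) ^ s := by
  have h1 : 0 < B / (B + D) := by positivity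
  have h2 : 0 < D / (B + D) := by positivity
  have h := (Real.concaveOn_rpow hs0 hs).2 (Set.mem_Ici.2 (div_nonneg hu h1.le))
    (Set.mem_Ici.2 (div_nonneg hv h2.le)) h1.le h2.le (by field_simp)
  simp only [smul_eq_mul] at h
  rw [weighted_rpow_eq hB hD hu, mul_div_cancel₀ _ h1.ne', mul_div_cancel₀ _ h2.ne'] at h
  have h3 := weighted_rpow_eq (s := s) hD hB hv
  rw [add_comm D B] at h3
  rwa [h3] at h

lemma rpow_add_le_weighted {s B D u v : ℝ} (hs : 1 ≤ s) (hB : 0 < B) (hD : 0 < D)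
    (hu : 0 ≤ u) (hv : 0 ≤ v) :
    (u + v) ^ s ≤ (B / (B + D)) ^ (1 - s) * u ^ s + (D / (B + D)) ^ (1 - s) * v ^ s := by
  have h1 : 0 < B / (B + D) := by positivity
  have h2 : 0 < D / (B + D) := by positivity
  have h := (convexOn_rpow hs).2 (Set.mem_Ici.2 (div_nonneg hu h1.le))
    (Set.mem_Ici.2 (div_nonneg hv h2.le)) h1.le h2.le (by field_simp)
  simp only [smul_eq_mul] at h
  rw [weighted_rpow_eq hB hD hu, mul_div_cancel₀ _ h1.ne', mul_div_cancel₀ _ h2.ne'] at h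
  have h3 := weighted_rpow_eq (s := s) hD hB hv
  rw [add_comm D B] at h3
  rwa [h3] at h

lemma mul_sq_rpow_half {c a : ℝ} (hc : 0 ≤ c) (ha : 0 ≤ a) :
    (c * a ^ 2) ^ (p / 2) = c ^ (p / 2) * a ^ p := by
  rw [Real.mul_rpow hc (sq_nonneg a), sq_rpow_half ha]

lemma twoPointConvex_two (hp1 : 1 < p) (hp : p ≤ 2) [Fact (1 ≤ ENNReal.ofReal p)] :
    TwoPointConvex (Lp ℂ (ENNReal.ofReal p) μ) 2 := by
  refine ⟨p - 1, by linarith, fun b d => ?_⟩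
  have hp0 : 0 < p := by linarith
  have hc : 0 < p - 1 := by linarith
  have hpm : ((‖b + d‖ ^ p + ‖b - d‖ ^ p) / 2) ^ (2 / p) ≤ (‖b + d‖ ^ (2:ℝ) + ‖b - d‖ ^ (2:ℝ)) / 2 := by
    have h := rpow_avg_le (s := 2 / p) (by rw [le_div_iff₀ hp0]; linarith)
      (Real.rpow_nonneg (norm_nonneg (b + d)) p) (Real.rpow_nonneg (norm_nonneg (b - d)) p)
    rwa [← Real.rpow_mul (norm_nonneg _), ← Real.rpow_mul (norm_nonneg _),
      mul_div_cancel₀ _ hp0.ne'] at h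
  rcases eq_or_lt_of_le (norm_nonneg b) with hb | hb
  · have : b = 0 := norm_eq_zero.1 hb.symm
    subst this
    have : 0 ≤ ‖d‖ ^ (2:ℝ) := by positivity
    simp only [norm_zero, zero_add, zero_sub, norm_neg]
    rw [Real.zero_rpow two_ne_zero]
    generalize ‖d‖ ^ (2:ℝ) = y at *
    nlinarith
  rcases eq_or_lt_of_le (norm_nonneg d) with hd | hd
  · have : d = 0 := norm_eq_zero.1 hd.symm
    subst this
    simp
  refine le_trans ?_ hpm
  set B := ‖b‖ ^ 2
  set D := (p - 1) * ‖d‖ ^ 2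
  have hB : 0 < B := by positivity
  have hD : 0 < D := by positivity
  have key : (B + D) ^ (p / 2) ≤ (‖b + d‖ ^ p + ‖b - d‖ ^ p) / 2 := by
    rw [← weighted_sum_rpow hB hD]
    simp only [B, D]
    rw [mul_sq_rpow_half hc.le (norm_nonneg _), sq_rpow_half (norm_nonneg _), ← mul_assoc]
    rw [integral_combination b d hp0, integral_two_point b d hp0]
    refine integral_mono (integrable_combination b d hp0 _ _) (integrable_two_point b d hp0) ?_
    intro x
    refine le_trans ?_ (two_point_lower_scalar hp1 hp (b x) (d x))
    refine le_trans (le_of_eq ?_) (weighted_le_rpow_add (by linarith) (by linarith) hB hD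
      (sq_nonneg ‖b x‖) (by positivity : 0 ≤ (p - 1) * ‖d x‖ ^ 2))
    rw [mul_sq_rpow_half hc.le (norm_nonneg _), sq_rpow_half (norm_nonneg _)]
    simp only [B, D]; ring
  calc ‖b‖ ^ (2:ℝ) + (p - 1) * ‖d‖ ^ (2:ℝ) = ((B + D) ^ (p / 2)) ^ (2 / p) := by
        rw [← Real.rpow_mul (by positivity), div_mul_div_comm, mul_comm p 2,
          div_self (by positivity), Real.rpow_one]
        simp [B, D]
    _ ≤ _ := Real.rpow_le_rpow (by positivity) key (by positivity)

lemma twoPointSmooth_two (hp : 2 ≤ p) [Fact (1 ≤ ENNReal.ofReal p)] :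
    TwoPointSmooth (Lp ℂ (ENNReal.ofReal p) μ) 2 := by
  obtain ⟨C, hC1, hC⟩ := two_point_upper_scalar hp
  refine ⟨C, by linarith, fun b d => ?_⟩
  have hp0 : 0 < p := by linarith
  have hc : 0 < C := by linarith
  have hpm : (‖b + d‖ ^ (2:ℝ) + ‖b - d‖ ^ (2:ℝ)) / 2 ≤ ((‖b + d‖ ^ p + ‖b - d‖ ^ p) / 2) ^ (2 / p) := by
    have h := avg_rpow_le (s := 2 / p) (by positivity) (by rw [div_le_iff₀ hp0]; linarith)
      (Real.rpow_nonneg (norm_nonneg (b + d)) p) (Real.rpow_nonneg (norm_nonneg (b - d)) p)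
    rwa [← Real.rpow_mul (norm_nonneg _), ← Real.rpow_mul (norm_nonneg _),
      mul_div_cancel₀ _ hp0.ne'] at h
  rcases eq_or_lt_of_le (norm_nonneg b) with hb | hb
  · have : b = 0 := norm_eq_zero.1 hb.symm
    subst this
    have : 0 ≤ ‖d‖ ^ (2:ℝ) := by positivity
    simp only [norm_zero, zero_add, zero_sub, norm_neg]
    rw [Real.zero_rpow two_ne_zero]
    generalize ‖d‖ ^ (2:ℝ) = y at *
    nlinarith
  rcases eq_or_lt_of_le (norm_nonneg d) with hd | hd
  · have : d = 0 := norm_eq_zero.1 hd.symm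
    subst this
    simp
  refine hpm.trans ?_
  set B := ‖b‖ ^ 2
  set D := C * ‖d‖ ^ 2
  have hB : 0 < B := by positivity
  have hD : 0 < D := by positivity
  have key : (‖b + d‖ ^ p + ‖b - d‖ ^ p) / 2 ≤ (B + D) ^ (p / 2) := by
    rw [← weighted_sum_rpow hB hD]
    simp only [B, D]
    rw [mul_sq_rpow_half hc.le (norm_nonneg _), sq_rpow_half (norm_nonneg _), ← mul_assoc]
    rw [integral_combination b d hp0, integral_two_point b d hp0]
    refine integral_mono (integrable_two_point b d hp0) (integrable_combination b d hp0 _ _) ?_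
    intro x
    refine (hC (b x) (d x)).trans ?_
    refine le_trans (rpow_add_le_weighted (by linarith) hB hD
      (sq_nonneg ‖b x‖) (by positivity : 0 ≤ C * ‖d x‖ ^ 2)) (le_of_eq ?_)
    rw [mul_sq_rpow_half hc.le (norm_nonneg _), sq_rpow_half (norm_nonneg _)]
    simp only [B, D]; ring
  calc _ ≤ ((B + D) ^ (p / 2)) ^ (2 / p) := Real.rpow_le_rpow (by positivity) key (by positivity)
    _ = ‖b‖ ^ (2:ℝ) + C * ‖d‖ ^ (2:ℝ) := by
        rw [← Real.rpow_mul (by positivity), div_mul_div_comm, mul_comm p 2,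
          div_self (by positivity), Real.rpow_one]
        simp [B, D]

lemma twoPointConvex_Lp (hp : 1 < p) [Fact (1 ≤ ENNReal.ofReal p)] :
    TwoPointConvex (Lp ℂ (ENNReal.ofReal p) μ) (max 2 p) := by
  rcases le_total p 2 with h | h
  · rw [max_eq_left h]; exact twoPointConvex_two hp h
  · rw [max_eq_right h]
    refine ⟨1, one_pos, fun b d => ?_⟩
    have hp0 : 0 < p := by linarith
    nth_rewrite 1 [← one_mul (‖b‖ ^ p)]
    rw [integral_combination b d hp0, integral_two_point b d hp0]
    refine integral_mono (integrable_combination b d hp0 _ _) (integrable_two_point b d hp0) ?_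
    intro x
    simpa using clarkson_scalar_lower h (b x) (d x)

lemma twoPointSmooth_Lp (hp : 1 < p) [Fact (1 ≤ ENNReal.ofReal p)] :
    TwoPointSmooth (Lp ℂ (ENNReal.ofReal p) μ) (min 2 p) := by
  rcases le_total p 2 with h | h
  · rw [min_eq_right h]
    refine ⟨1, one_pos, fun b d => ?_⟩
    have hp0 : 0 < p := by linarith
    nth_rewrite 1 [← one_mul (‖b‖ ^ p)]
    rw [integral_combination b d hp0, integral_two_point b d hp0]
    refine integral_mono (integrable_two_point b d hp0) (integrable_combination b d hp0 _ _) ?_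
    intro x
    simpa using clarkson_scalar_upper hp0.le h (b x) (d x)
  · rw [min_eq_left h]; exact twoPointSmooth_two h

end LpSpace

/-! ### Fourier multipliers on finitely supported coefficient sequences -/

section Multipliers

variable {ι E : Type*} [NormedAddCommGroup E] [NormedSpace ℂ E]

/-- The multiplication operator with symbol `σ` is bounded by `A` with respect to `‖Φ ·‖`. -/
def MultBound (Φ : (ι →₀ ℂ) →ₗ[ℂ] E) (σ : ι → ℂ) (A : ℝ) : Prop :=
  0 ≤ A ∧ ∀ c : ι →₀ ℂ, ‖Φ (σ • c)‖ ≤ A * ‖Φ c‖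

/-- `‖Φ ·‖` is invariant under the modulations `e^{isκ}`. -/
def ModulationInvariant (Φ : (ι →₀ ℂ) →ₗ[ℂ] E) (κ : ι → ℝ) : Prop :=
  ∀ (s : ℝ) (c : ι →₀ ℂ), ‖Φ ((fun m => Complex.exp ((s * κ m : ℝ) * Complex.I)) • c)‖ = ‖Φ c‖

lemma map_symbol_smul (Φ : (ι →₀ ℂ) →ₗ[ℂ] E) (σ : ι → ℂ) (c : ι →₀ ℂ) :
    Φ (σ • c) = ∑ m ∈ c.support, σ m • Φ (Finsupp.single m (c m)) := by
  have h : σ • c = ∑ m ∈ c.support, σ m • Finsupp.single m (c m) := by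
    ext m
    simp only [Finsupp.coe_pointwise_smul, Pi.smul_apply', smul_eq_mul, Finsupp.coe_finsetSum,
      Finset.sum_apply, Finsupp.smul_apply]
    by_cases hm : c m = 0
    · simp only [hm, mul_zero]
      refine (Finset.sum_eq_zero fun x hx => ?_).symm
      by_cases hxm : x = m <;> simp [hxm, hm]
    · rw [Finset.sum_eq_single m]
      · simp
      · intro b _ hb
        simp [hb]
      · intro h
        simp [Finsupp.notMem_support_iff.1 h]
  rw [h, map_sum]
  simp only [map_smul]

variable {Φ : (ι →₀ ℂ) →ₗ[ℂ] E} {κ : ι → ℝ}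

namespace MultBound

lemma comp {σ σ' : ι → ℂ} {A B : ℝ} (h : MultBound Φ σ A) (h' : MultBound Φ σ' B) :
    MultBound Φ (fun m => σ m * σ' m) (A * B) := by
  refine ⟨mul_nonneg h.1 h'.1, fun c => ?_⟩
  have e : (fun m => σ m * σ' m) • c = σ • (σ' • c) := by
    ext m; simp [mul_assoc]
  rw [e]
  calc _ ≤ A * ‖Φ (σ' • c)‖ := h.2 _
    _ ≤ A * (B * ‖Φ c‖) := mul_le_mul_of_nonneg_left (h'.2 c) h.1
    _ = _ := by ring

lemma const_mul {σ : ι → ℂ} {A : ℝ} (h : MultBound Φ σ A) (z : ℂ) :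
    MultBound Φ (fun m => z * σ m) (‖z‖ * A) := by
  refine ⟨mul_nonneg (norm_nonneg _) h.1, fun c => ?_⟩
  have e : (fun m => z * σ m) • c = z • (σ • c) := by
    ext m; simp [mul_assoc]
  rw [e, map_smul, norm_smul, mul_assoc]
  exact mul_le_mul_of_nonneg_left (h.2 c) (norm_nonneg _)

lemma add {σ σ' : ι → ℂ} {A B : ℝ} (h : MultBound Φ σ A) (h' : MultBound Φ σ' B) :
    MultBound Φ (fun m => σ m + σ' m) (A + B) := by
  refine ⟨add_nonneg h.1 h'.1, fun c => ?_⟩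
  have e : (fun m => σ m + σ' m) • c = σ • c + σ' • c := by
    ext m; simp [add_mul]
  rw [e, map_add, add_mul]
  exact (norm_add_le _ _).trans (add_le_add (h.2 c) (h'.2 c))

lemma one : MultBound Φ (fun _ => 1) 1 := by
  refine ⟨zero_le_one, fun c => ?_⟩
  have e : (fun _ : ι => (1:ℂ)) • c = c := by ext m; simp
  rw [e, one_mul]

lemma mono {σ : ι → ℂ} {A B : ℝ} (h : MultBound Φ σ A) (hAB : A ≤ B) : MultBound Φ σ B :=
  ⟨h.1.trans hAB, fun c => (h.2 c).trans (mul_le_mul_of_nonneg_right hAB (norm_nonneg _))⟩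

lemma congr {σ σ' : ι → ℂ} {A : ℝ} (h : MultBound Φ σ A) (e : ∀ m, σ' m = σ m) :
    MultBound Φ σ' A := by
  rwa [funext e]

lemma hasSum {J : Type*} {σ : J → ι → ℂ} {τ : ι → ℂ} {A : J → ℝ}
    (hσ : ∀ m, HasSum (fun j => σ j m) (τ m)) (h : ∀ j, MultBound Φ (σ j) (A j))
    (hA : Summable A) : MultBound Φ τ (∑' j, A j) := by
  refine ⟨tsum_nonneg fun j => (h j).1, fun c => ?_⟩
  have hs : HasSum (fun j => Φ (σ j • c)) (Φ (τ • c)) := by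
    simp only [map_symbol_smul]
    exact hasSum_sum fun m _ => (hσ m).smul_const _
  rw [← hs.tsum_eq, ← tsum_mul_right]
  exact tsum_of_norm_bounded (hA.mul_right _).hasSum fun j => (h j).2 c

end MultBound

lemma ModulationInvariant.multBound (hκ : ModulationInvariant Φ κ) (s : ℝ) :
    MultBound Φ (fun m => Complex.exp ((s * κ m : ℝ) * Complex.I)) 1 :=
  ⟨zero_le_one, fun c => by rw [hκ s c, one_mul]⟩

lemma map_integral_symbol [CompleteSpace E] {Y : Type*} [MeasurableSpace Y] {μ : Measure Y}
    {σ : Y → ι → ℂ} (hσ : ∀ m, Integrable (fun y => σ y m) μ) (c : ι →₀ ℂ) :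
    Φ ((fun m => ∫ y, σ y m ∂μ) • c) = ∫ y, Φ (σ y • c) ∂μ := by
  simp only [map_symbol_smul]
  rw [integral_finsetSum]
  · exact Finset.sum_congr rfl fun m _ => (integral_smul_const _ _).symm
  · exact fun m _ => (hσ m).smul_const _

lemma ModulationInvariant.multBound_integral [CompleteSpace E] (hκ : ModulationInvariant Φ κ)
    {k : ℝ → ℂ} (hk : Integrable k) (t : ℝ) :
    MultBound Φ (fun m => ∫ y, k y * Complex.exp ((y * t * κ m : ℝ) * Complex.I)) (∫ y, ‖k y‖) := by
  refine ⟨by positivity, fun c => ?_⟩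
  rw [map_integral_symbol (σ := fun y m => k y * Complex.exp ((y * t * κ m : ℝ) * Complex.I))]
  · rw [← integral_mul_const]
    refine norm_integral_le_of_norm_le (hk.norm.mul_const _) (Filter.Eventually.of_forall ?_)
    intro y
    have := ((hκ.multBound (y * t)).const_mul (k y)).2 c
    rwa [mul_one] at this
  · intro m
    refine hk.mul_bdd (c := 1) (by fun_prop) (Filter.Eventually.of_forall fun y => ?_)
    rw [Complex.norm_exp_ofReal_mul_I]

/-- Smooth functions vanishing outside a bounded set. -/
def IsTest (φ : ℝ → ℂ) : Prop :=
  (∃ R : ℝ, ∀ x, R < |x| → φ x = 0) ∧ ∀ x, ContDiffAt ℝ (⊤ : ℕ∞) φ x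

lemma IsTest.multBound [CompleteSpace E] (hκ : ModulationInvariant Φ κ) {φ : ℝ → ℂ}
    (hφ : IsTest φ) : ∃ A : ℝ, 0 < A ∧ ∀ t : ℝ, MultBound Φ (fun m => φ (t * κ m)) A := by
  obtain ⟨⟨R, hR⟩, hs⟩ := hφ
  have hsm : ContDiff ℝ (⊤ : ℕ∞) φ := contDiff_iff_contDiffAt.2 hs
  have hcs : HasCompactSupport φ := by
    refine HasCompactSupport.of_support_subset_isCompact (K := Set.Icc (-R) R) isCompact_Icc ?_
    intro x hx
    rw [Function.mem_support] at hx
    by_contra hcon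
    exact hx (hR x (not_le.1 fun h => hcon (abs_le.1 h)))
  set S : SchwartzMap ℝ ℂ := hcs.toSchwartzMap hsm
  have hFint : Integrable (fun y => FourierTransform.fourier S y) := (FourierTransform.fourier S).integrable
  have hk : Integrable (fun y => FourierTransform.fourier φ y) := by
    rw [SchwartzMap.fourier_coe] at hFint
    exact hFint
  refine ⟨(∫ y, ‖FourierTransform.fourier φ y‖) + 1, by positivity, fun t => ?_⟩
  have hm := hκ.multBound_integral hk (2 * π * t)
  refine (hm.congr fun m => ?_).mono (by linarith)
  have hinv := congrFun (hsm.continuous.fourierInv_fourier_eq (hsm.continuous.integrable_of_hasCompactSupport hcs) hk) (t * κ m)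
  rw [← hinv, Real.fourierInv_eq']
  refine integral_congr_ae (Filter.Eventually.of_forall fun y => ?_)
  simp only [smul_eq_mul]
  rw [mul_comm]
  congr 3
  simp only [RCLike.inner_apply, conj_trivial]
  push_cast; ring_nf

end Multipliers

/-! ### Symbols of fractional differences -/

/-- The coefficients `(-1)^ν C(γ,ν)` of the fractional difference of order `γ`. -/
def dcoef (γ : ℝ) (ν : ℕ) : ℝ := (-1) ^ ν * fracBinom γ ν

lemma dcoef_zero (γ : ℝ) : dcoef γ 0 = 1 := by simp [dcoef, fracBinom]

lemma dcoef_succ (γ : ℝ) (ν : ℕ) : ((ν : ℝ) + 1) * dcoef γ (ν + 1) = (ν - γ) * dcoef γ ν := by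
  have : (ν : ℝ) + 1 ≠ 0 := by positivity
  simp only [dcoef, fracBinom, pow_succ]
  field_simp
  ring

lemma summable_abs_dcoef {γ : ℝ} (hγ : 0 < γ) : Summable fun ν => |dcoef γ ν| := by
  obtain ⟨N, hN⟩ := exists_nat_ge γ
  rw [← summable_nat_add_iff N]
  have key : ∀ n, (∑ i ∈ Finset.range n, |dcoef γ (i + N)|) * γ
      = N * |dcoef γ N| - (n + N : ℝ) * |dcoef γ (n + N)| := by
    intro n
    induction n with
    | zero => simp
    | succ n ih =>
      have h1 := congrArg abs (dcoef_succ γ (n + N))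
      have h2 : γ ≤ ((n + N : ℕ) : ℝ) := by push_cast; linarith [(Nat.cast_nonneg n : (0:ℝ) ≤ n)]
      rw [abs_mul, abs_mul, abs_of_nonneg (sub_nonneg.2 h2),
        abs_of_nonneg (by positivity : (0:ℝ) ≤ ((n + N : ℕ) : ℝ) + 1)] at h1
      rw [Finset.sum_range_succ, add_mul, ih, add_right_comm n 1 N]
      push_cast at h1 ⊢
      linarith
  refine summable_of_sum_range_le (c := N * |dcoef γ N| / γ) (fun _ => abs_nonneg _) fun n => ?_
  rw [le_div_iff₀ hγ, key]
  have : (0:ℝ) ≤ (n + N : ℝ) * |dcoef γ (n + N)| := by positivity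
  linarith

lemma choose_eq_fracBinom (γ : ℝ) (ν : ℕ) : Ring.choose (γ : ℂ) ν = fracBinom γ ν := by
  induction ν with
  | zero => simp [fracBinom]
  | succ n ih =>
    rw [Ring.choose_eq_smul] at ih ⊢
    rw [fracBinom, descPochhammer_succ_right, Polynomial.smeval_mul]
    simp only [Complex.ofReal_mul, Complex.ofReal_div]
    rw [← ih]
    have h1 : ((n:ℂ) + 1) ≠ 0 := by exact_mod_cast n.succ_ne_zero
    have h2 : ((n.factorial : ℕ) : ℂ) ≠ 0 := by exact_mod_cast n.factorial_ne_zero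
    simp only [smul_eq_mul, Nat.factorial_succ, Polynomial.smeval_sub, Polynomial.smeval_X,
      Polynomial.smeval_natCast, npow_one, npow_zero]
    push_cast
    simp
    field_simp

lemma hasSum_dcoef_mul_pow (γ : ℝ) {z : ℂ} (hz : ‖z‖ < 1) :
    HasSum (fun ν => (dcoef γ ν : ℂ) * z ^ ν) ((1 - z) ^ (γ : ℂ)) := by
  have h := (Complex.one_add_cpow_hasFPowerSeriesOnBall_zero (a := (γ : ℂ))).hasSum
    (y := -z) (by simpa [Metric.mem_eball, edist_zero_right, enorm_eq_nnnorm, ← NNReal.coe_lt_coe] using hz)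
  simp only [binomialSeries_apply, List.ofFn_const, List.prod_replicate, smul_eq_mul,
    choose_eq_fracBinom, zero_add] at h
  rw [← sub_eq_add_neg] at h
  refine h.congr_fun fun ν => ?_
  rw [dcoef, neg_pow]
  push_cast
  ring

lemma tsum_dcoef_mul_pow {γ : ℝ} (hγ : 0 < γ) {z : ℂ} (hz : ‖z‖ = 1)
    (hz1 : 1 - z ∈ Complex.slitPlane ∨ z = 1) :
    ∑' ν, (dcoef γ ν : ℂ) * z ^ ν = (1 - z) ^ (γ : ℂ) := by
  have hs : Summable fun ν => (dcoef γ ν : ℂ) * z ^ ν := by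
    refine .of_norm ?_
    simpa [hz] using summable_abs_dcoef hγ
  have h1 := Complex.tendsto_tsum_powerSeries_nhdsWithin_lt hs.hasSum.tendsto_sum_nat
  rw [Filter.tendsto_map'_iff] at h1
  have h2 : Filter.Tendsto (fun r : ℝ => (1 - (r:ℂ) * z) ^ (γ : ℂ)) (nhdsWithin 1 (Set.Iio 1))
      (nhds ((1 - z) ^ (γ : ℂ))) := by
    have : ContinuousAt (fun r : ℝ => (1 - (r:ℂ) * z) ^ (γ : ℂ)) 1 := by
      rcases hz1 with hz1 | rfl
      · exact ContinuousAt.cpow (by fun_prop) (by fun_prop) (by simpa using hz1)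
      · have h0 : ContinuousAt (fun x : ℂ => x ^ (γ : ℂ)) (1 - ((1 : ℝ) : ℂ) * 1) := by
          simpa using Complex.continuousAt_cpow_const_of_re_pos (z := 0) (w := γ) (by simp)
            (by simpa using hγ)
        exact ContinuousAt.comp (f := fun r : ℝ => (1 - (r:ℂ) * 1)) h0 (by fun_prop)
    have h3 := this.tendsto
    simp only [Complex.ofReal_one, one_mul] at h3
    exact h3.mono_left nhdsWithin_le_nhds
  refine tendsto_nhds_unique h1 (h2.congr' ?_)
  filter_upwards [Ioo_mem_nhdsLT (show (-1:ℝ) < 1 by norm_num)] with r hr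
  have := hasSum_dcoef_mul_pow γ (z := r * z) (by
    rw [norm_mul, hz, mul_one, Complex.norm_real, Real.norm_eq_abs, abs_lt]; exact hr)
  rw [← this.tsum_eq]
  refine tsum_congr fun ν => ?_
  rw [mul_pow]; ring

/-- The symbol of the fractional difference of order `γ` and step `1`. -/
def dsym (γ x : ℝ) : ℂ := ∑' ν : ℕ, (dcoef γ ν : ℂ) * Complex.exp (((γ - ν) * x : ℝ) * Complex.I)

/-- The power `(ix)^a`. -/
def ipow (a x : ℝ) : ℂ := (Complex.I * x) ^ (a : ℂ)

/-- The quotient of the symbols of a fractional difference and of the derivative of the same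
order. -/
def dquot (γ x : ℝ) : ℂ := ((sinc (x / 2)) ^ γ : ℝ) * Complex.exp ((γ * x / 2 : ℝ) * Complex.I)

lemma summable_dsym {γ : ℝ} (hγ : 0 < γ) (x : ℝ) :
    Summable fun ν : ℕ => (dcoef γ ν : ℂ) * Complex.exp (((γ - ν) * x : ℝ) * Complex.I) := by
  refine .of_norm ?_
  simpa [Complex.norm_exp_ofReal_mul_I, -Complex.ofReal_mul] using summable_abs_dcoef hγ

lemma sinc_pos {x : ℝ} (hx : |x| < π) : 0 < sinc x := by
  rcases lt_trichotomy x 0 with h | h | h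
  · rw [← sinc_neg, sinc_of_ne_zero (by linarith)]
    exact div_pos (sin_pos_of_pos_of_lt_pi (by linarith) (by linarith [neg_abs_le x])) (by linarith)
  · simp [h]
  · rw [sinc_of_ne_zero h.ne']
    exact div_pos (sin_pos_of_pos_of_lt_pi h (by linarith [le_abs_self x])) h

lemma contDiff_sinc : ContDiff ℝ (⊤ : ℕ∞) sinc := by
  refine contDiff_iff_contDiffAt.2 fun x => AnalyticAt.contDiffAt ?_
  by_cases hx : x = 0
  · rw [sinc_eq_dslope, hx]
    obtain ⟨P, hP⟩ := (Real.analyticAt_sin (x := (0:ℝ)))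
    exact ⟨_, hP.has_fpower_series_dslope_fslope⟩
  · refine ((Real.analyticAt_sin (x := x)).div analyticAt_id hx).congr ?_
    filter_upwards [isOpen_ne.mem_nhds hx] with y hy
    rw [sinc_of_ne_zero hy]; rfl

lemma ipow_ne_zero (a : ℝ) {x : ℝ} (hx : x ≠ 0) : ipow a x ≠ 0 := by
  rw [ipow, Complex.cpow_ne_zero_iff]
  left
  simp [hx]

lemma ipow_add (a b : ℝ) {x : ℝ} (hx : x ≠ 0) : ipow (a + b) x = ipow a x * ipow b x := by
  rw [ipow, Complex.ofReal_add, Complex.cpow_add _ _ (by simp [hx])]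
  rfl

lemma real_mul_cpow (a : ℝ) {u : ℝ} (hu : 0 < u) {z : ℂ} (hz : z ≠ 0) :
    ((u : ℂ) * z) ^ (a : ℂ) = (u ^ a : ℝ) * z ^ (a : ℂ) := by
  have hu' : (u : ℂ) ≠ 0 := by exact_mod_cast hu.ne'
  rw [Complex.cpow_def_of_ne_zero (mul_ne_zero hu' hz), Complex.log_ofReal_mul hu hz,
    Complex.cpow_def_of_ne_zero hz, add_mul, Complex.exp_add, Real.rpow_def_of_pos hu]
  push_cast
  rfl

lemma ipow_mul (a : ℝ) {u : ℝ} (hu : 0 < u) (x : ℝ) : ipow a (u * x) = (u ^ a : ℝ) * ipow a x := by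
  by_cases hx : x = 0
  · by_cases ha : a = 0 <;> simp [ipow, hx, ha]
  rw [ipow, ipow, Complex.ofReal_mul, mul_left_comm, real_mul_cpow a hu (by simp [hx])]

lemma I_mul_mem_slitPlane {x : ℝ} (hx : x ≠ 0) : Complex.I * x ∈ Complex.slitPlane := by
  right
  simp [hx]

lemma contDiffAt_ipow (a : ℝ) {x : ℝ} (hx : x ≠ 0) : ContDiffAt ℝ (⊤ : ℕ∞) (ipow a) x := by
  have h1 : AnalyticAt ℝ (fun y : ℝ => Complex.I * (y : ℂ)) x :=
    analyticAt_const.mul (Complex.ofRealCLM.analyticAt x)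
  have h2 : AnalyticAt ℂ (fun z : ℂ => z ^ (a : ℂ)) (Complex.I * (x : ℂ)) :=
    analyticAt_id.cpow analyticAt_const (I_mul_mem_slitPlane hx)
  exact ((h2.restrictScalars (𝕜 := ℝ)).fun_comp_of_eq h1 rfl).contDiffAt

lemma dsym_eq {γ : ℝ} (hγ : 0 < γ) {x : ℝ} (hx0 : x ≠ 0) (hx : |x| < 2 * π) :
    dsym γ x = ipow γ x * dquot γ x := by
  have hs := sinc_pos (x := x / 2) (by rw [abs_div, abs_two]; linarith)
  have e1 : (1 - Complex.exp ((-x : ℝ) * Complex.I))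
      = (sinc (x / 2) : ℝ) * ((Complex.I * x) * Complex.exp ((-(x / 2) : ℝ) * Complex.I)) := by
    have h2 : Complex.exp ((-x : ℝ) * Complex.I) = Complex.exp ((-(x / 2) : ℝ) * Complex.I)
        * Complex.exp ((-(x / 2) : ℝ) * Complex.I) := by
      rw [← Complex.exp_add]; congr 1; push_cast; ring
    have h3 : (1:ℂ) = Complex.exp ((-(x / 2) : ℝ) * Complex.I)
        * Complex.exp (((x / 2) : ℝ) * Complex.I) := by
      rw [← Complex.exp_add]; simp
    have h4 : Complex.exp (((x / 2) : ℝ) * Complex.I) - Complex.exp ((-(x / 2) : ℝ) * Complex.I)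
        = 2 * Complex.I * (sin (x / 2) : ℝ) := by
      rw [Complex.exp_mul_I, Complex.exp_mul_I]
      push_cast
      rw [Complex.cos_neg, Complex.sin_neg]; ring
    rw [sinc_of_ne_zero (by simpa using hx0), h2]
    conv_lhs => rw [h3]
    rw [← mul_sub, h4]
    have : (x : ℂ) ≠ 0 := by exact_mod_cast hx0
    push_cast
    field_simp
  have harg : Complex.arg (Complex.exp ((-(x / 2) : ℝ) * Complex.I)) = -(x / 2) := by
    rw [Complex.arg_exp_mul_I, toIocMod_eq_self]
    constructor <;> linarith [abs_lt.1 hx |>.1, abs_lt.1 hx |>.2]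
  have harg3 : Complex.arg (Complex.I * x) + -(x / 2) ∈ Set.Ioo (-π) π := by
    rcases lt_or_gt_of_ne hx0 with h | h
    · have : Complex.I * x = ((-x : ℝ) : ℂ) * (-Complex.I) := by push_cast; ring
      rw [this, Complex.arg_real_mul _ (by linarith), Complex.arg_neg_I]
      constructor <;> linarith [abs_lt.1 hx |>.1]
    · rw [mul_comm, Complex.arg_real_mul _ h, Complex.arg_I]
      constructor <;> linarith [abs_lt.1 hx |>.2]
  have hne : Complex.I * (x : ℂ) ≠ 0 := by simp [hx0]
  have e2 : (1 - Complex.exp ((-x : ℝ) * Complex.I)) ^ (γ : ℂ) = (sinc (x / 2) ^ γ : ℝ) *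
      (ipow γ x * Complex.exp ((-(γ * x / 2) : ℝ) * Complex.I)) := by
    have hexp : Complex.exp ((-(x / 2) : ℝ) * Complex.I) ^ (γ : ℂ)
        = Complex.exp ((-(γ * x / 2) : ℝ) * Complex.I) := by
      rw [Complex.cpow_def_of_ne_zero (Complex.exp_ne_zero _), Complex.log_exp]
      · congr 1; push_cast; ring
      · simp only [Complex.im_ofReal_mul, Complex.I_im]
        linarith [abs_lt.1 hx |>.2]
      · simp only [Complex.im_ofReal_mul, Complex.I_im]
        linarith [abs_lt.1 hx |>.1]
    rw [e1, real_mul_cpow γ hs (mul_ne_zero hne (Complex.exp_ne_zero _)),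
      Complex.cpow_def_of_ne_zero (mul_ne_zero hne (Complex.exp_ne_zero _)),
      Complex.log_mul hne (Complex.exp_ne_zero _)
        (by rw [harg]; exact Set.Ioo_subset_Ioc_self harg3), add_mul, Complex.exp_add,
      ← Complex.cpow_def_of_ne_zero hne, ← Complex.cpow_def_of_ne_zero (Complex.exp_ne_zero _), hexp]
    rfl
  have hslit : (1 - Complex.exp ((-x : ℝ) * Complex.I)) ∈ Complex.slitPlane := by
    left
    rw [Complex.sub_re, Complex.one_re, Complex.exp_ofReal_mul_I_re, Real.cos_neg, sub_pos]
    refine lt_of_le_of_ne (Real.cos_le_one x) fun h => hx0 ?_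
    exact (Real.cos_eq_one_iff_of_lt_of_lt (abs_lt.1 hx).1 (abs_lt.1 hx).2).1 h
  have e3 : dsym γ x = Complex.exp ((γ * x : ℝ) * Complex.I) *
      ∑' ν, (dcoef γ ν : ℂ) * Complex.exp ((-x : ℝ) * Complex.I) ^ ν := by
    rw [dsym, ← tsum_mul_left]
    refine tsum_congr fun ν => ?_
    rw [← Complex.exp_nat_mul, mul_left_comm, ← Complex.exp_add]
    congr 2
    push_cast; ring
  rw [e3, tsum_dcoef_mul_pow hγ (Complex.norm_exp_ofReal_mul_I _) (Or.inl hslit), e2, dquot]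
  have h5 : Complex.exp ((γ * x : ℝ) * Complex.I) * Complex.exp ((-(γ * x / 2) : ℝ) * Complex.I)
      = Complex.exp ((γ * x / 2 : ℝ) * Complex.I) := by
    rw [← Complex.exp_add]; congr 1; push_cast; ring
  rw [← h5]; ring

lemma dsym_zero {γ : ℝ} (hγ : 0 < γ) : dsym γ 0 = 0 := by
  have h := tsum_dcoef_mul_pow hγ (z := 1) (by simp) (Or.inr rfl)
  rw [sub_self, Complex.zero_cpow (by exact_mod_cast hγ.ne')] at h
  simpa [dsym] using h

lemma contDiffAt_dquot (γ : ℝ) {x : ℝ} (hx : |x| < 2 * π) :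
    ContDiffAt ℝ (⊤ : ℕ∞) (dquot γ) x := by
  have hs := sinc_pos (x := x / 2) (by rw [abs_div, abs_two]; linarith)
  have h1 : ContDiffAt ℝ (⊤ : ℕ∞) (fun y : ℝ => sinc (y / 2) ^ γ) x := by
    refine ContDiffAt.rpow_const_of_ne ?_ hs.ne'
    exact (contDiff_sinc.contDiffAt).comp x (by fun_prop)
  have h2 : ContDiffAt ℝ (⊤ : ℕ∞) (fun y : ℝ => ((sinc (y / 2) ^ γ : ℝ) : ℂ)) x :=
    Complex.ofRealCLM.contDiff.contDiffAt.comp x h1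
  refine h2.mul ?_
  have h3 : ContDiffAt ℝ (⊤ : ℕ∞) (fun y : ℝ => ((γ * y / 2 : ℝ) : ℂ) * Complex.I) x :=
    (Complex.ofRealCLM.contDiff.contDiffAt.comp x
      ((contDiffAt_const.mul contDiffAt_id).div_const 2)).mul contDiffAt_const
  exact h3.cexp

lemma dquot_ne_zero (γ : ℝ) {x : ℝ} (hx : |x| < 2 * π) : dquot γ x ≠ 0 := by
  have hs := sinc_pos (x := x / 2) (by rw [abs_div, abs_two]; linarith)
  refine mul_ne_zero ?_ (Complex.exp_ne_zero _)
  exact_mod_cast (rpow_pos_of_pos hs γ).ne'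

section

variable {ι E : Type*} [NormedAddCommGroup E] [NormedSpace ℂ E]
  {Φ : (ι →₀ ℂ) →ₗ[ℂ] E} {κ : ι → ℝ}

lemma multBound_dsym (hκ : ModulationInvariant Φ κ) {γ : ℝ} (hγ : 0 < γ) (h : ℝ) :
    MultBound Φ (fun m => dsym γ (h * κ m)) (∑' ν, |dcoef γ ν|) := by
  refine MultBound.hasSum (fun m => (summable_dsym hγ _).hasSum) (fun ν => ?_) (summable_abs_dcoef hγ)
  have := (hκ.multBound ((γ - ν) * h)).const_mul (dcoef γ ν)
  rw [mul_one, Complex.norm_real, Real.norm_eq_abs] at this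
  simpa only [mul_assoc] using this

end

/-! ### Smooth cut-off functions -/

lemma IsTest.mul_of_ball {φ g : ℝ → ℂ} (hφ : IsTest φ) {b : ℝ} (hb : ∀ x, b < |x| → φ x = 0)
    (hg : ∀ x, |x| ≤ b → ContDiffAt ℝ (⊤ : ℕ∞) g x) : IsTest (fun x => φ x * g x) := by
  refine ⟨⟨b, fun x hx => by simp only [hb x hx, zero_mul]⟩, fun x => ?_⟩
  rcases le_or_gt (|x|) b with h | h
  · exact (hφ.2 x).mul (hg x h)
  · refine (contDiffAt_const (c := (0:ℂ))).congr_of_eventuallyEq ?_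
    filter_upwards [(isOpen_lt continuous_const continuous_abs).mem_nhds h] with y hy
    rw [hb y hy, zero_mul]

lemma IsTest.comp_mul {φ : ℝ → ℂ} (hφ : IsTest φ) {a : ℝ} (ha : a ≠ 0) :
    IsTest (fun x => φ (a * x)) := by
  obtain ⟨⟨R, hR⟩, hs⟩ := hφ
  refine ⟨⟨R / |a|, fun x hx => hR _ ?_⟩, fun x => ?_⟩
  · rw [abs_mul, mul_comm]
    exact (div_lt_iff₀ (abs_pos.2 ha)).1 hx
  · exact (hs (a * x)).comp x (contDiffAt_const.mul contDiffAt_id)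

lemma IsTest.sub {φ φ' : ℝ → ℂ} (hφ : IsTest φ) (hφ' : IsTest φ') :
    IsTest (fun x => φ x - φ' x) := by
  obtain ⟨⟨R, hR⟩, hs⟩ := hφ
  obtain ⟨⟨R', hR'⟩, hs'⟩ := hφ'
  refine ⟨⟨max R R', fun x hx => ?_⟩, fun x => (hs x).sub (hs' x)⟩
  simp only [hR x ((le_max_left _ _).trans_lt hx), hR' x ((le_max_right _ _).trans_lt hx), sub_zero]

/-- Smooth functions supported in an annulus `a ≤ |x| ≤ b`, `0 < a`. -/
structure IsBand (b : ℝ) (φ : ℝ → ℂ) : Prop where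
  isTest : IsTest φ
  low : ∃ a : ℝ, 0 < a ∧ ∀ x, |x| < a → φ x = 0
  high : ∀ x, b < |x| → φ x = 0

lemma IsBand.mul {φ g : ℝ → ℂ} {b : ℝ} (hφ : IsBand b φ)
    (hg : ∀ x, x ≠ 0 → |x| ≤ b → ContDiffAt ℝ (⊤ : ℕ∞) g x) : IsBand b (fun x => φ x * g x) := by
  obtain ⟨a, ha, hl⟩ := hφ.low
  refine ⟨⟨⟨b, fun x hx => by simp only [hφ.high x hx, zero_mul]⟩, fun x => ?_⟩,
    ⟨a, ha, fun x hx => by simp only [hl x hx, zero_mul]⟩,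
    fun x hx => by simp only [hφ.high x hx, zero_mul]⟩
  by_cases hx : x = 0
  · refine (contDiffAt_const (c := (0:ℂ))).congr_of_eventuallyEq ?_
    have h0 : |x| < a := by simpa [hx] using ha
    filter_upwards [(isOpen_lt continuous_abs continuous_const).mem_nhds h0] with y hy
    rw [hl y hy, zero_mul]
  rcases le_or_gt (|x|) b with h | h
  · exact (hφ.isTest.2 x).mul (hg x hx h)
  · refine (contDiffAt_const (c := (0:ℂ))).congr_of_eventuallyEq ?_
    filter_upwards [(isOpen_lt continuous_const continuous_abs).mem_nhds h] with y hy
    rw [hφ.high y hy, zero_mul]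

/-- A smooth cut-off function, equal to `1` on `[-1/4,1/4]` and to `0` off `[-1/2,1/2]`. -/
def chi (x : ℝ) : ℂ :=
  ((⟨1 / 4, 1 / 2, by norm_num, by norm_num⟩ : ContDiffBump (0 : ℝ)) x : ℝ)

/-- The dyadic partition function generated by `chi`. -/
def psi (x : ℝ) : ℂ := chi x - chi (2 * x)

lemma chi_eq_one {x : ℝ} (hx : |x| ≤ 1 / 4) : chi x = 1 := by
  rw [chi, ContDiffBump.one_of_mem_closedBall, Complex.ofReal_one]
  simpa [Real.dist_eq] using hx

lemma chi_eq_zero {x : ℝ} (hx : 1 / 2 ≤ |x|) : chi x = 0 := by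
  rw [chi, ContDiffBump.zero_of_le_dist, Complex.ofReal_zero]
  simpa [Real.dist_eq] using hx

lemma isTest_chi : IsTest chi :=
  ⟨⟨1 / 2, fun _ hx => chi_eq_zero hx.le⟩, fun x =>
    Complex.ofRealCLM.contDiff.contDiffAt.comp x (ContDiffBump.contDiff _).contDiffAt⟩

lemma psi_eq_zero_of_le {x : ℝ} (hx : |x| ≤ 1 / 8) : psi x = 0 := by
  rw [psi, chi_eq_one (by linarith), chi_eq_one (by rw [abs_mul, abs_two]; linarith), sub_self]

lemma psi_eq_zero_of_ge {x : ℝ} (hx : 1 / 2 ≤ |x|) : psi x = 0 := by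
  rw [psi, chi_eq_zero hx, chi_eq_zero (by rw [abs_mul, abs_two]; linarith), sub_self]

lemma isBand_psi : IsBand (1 / 2) psi :=
  ⟨isTest_chi.sub (isTest_chi.comp_mul two_ne_zero),
    ⟨1 / 8, by norm_num, fun _ hx => psi_eq_zero_of_le hx.le⟩, fun _ hx => psi_eq_zero_of_ge hx.le⟩

/-- A band function equal to `1` on the support of `psi`. -/
def psiFat (x : ℝ) : ℂ := chi (x / 2) - chi (4 * x)

lemma isBand_psiFat : IsBand 1 psiFat := by
  refine ⟨?_, ⟨1 / 16, by norm_num, fun x hx => ?_⟩, fun x hx => ?_⟩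
  · have := (isTest_chi.comp_mul (a := (1 / 2 : ℝ)) (by norm_num)).sub
      (isTest_chi.comp_mul (a := (4 : ℝ)) (by norm_num))
    refine (funext fun x => ?_ : psiFat = _) ▸ this
    rw [psiFat, one_div, inv_mul_eq_div]
  · rw [psiFat, chi_eq_one (by rw [abs_div, abs_two]; linarith),
      chi_eq_one (by rw [abs_mul, abs_of_pos (by norm_num : (0:ℝ) < 4)]; linarith), sub_self]
  · rw [psiFat, chi_eq_zero (by rw [abs_div, abs_two]; linarith),
      chi_eq_zero (by rw [abs_mul, abs_of_pos (by norm_num : (0:ℝ) < 4)]; linarith), sub_self]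

lemma psiFat_eq_one {x : ℝ} (h1 : 1 / 8 ≤ |x|) (h2 : |x| ≤ 1 / 2) : psiFat x = 1 := by
  rw [psiFat, chi_eq_one (by rw [abs_div, abs_two]; linarith),
    chi_eq_zero (by rw [abs_mul, abs_of_pos (by norm_num : (0:ℝ) < 4)]; linarith), sub_zero]

lemma psiFat_mul_psi (x : ℝ) : psiFat x * psi x = psi x := by
  rcases le_or_gt (|x|) (1 / 8) with h | h
  · rw [psi_eq_zero_of_le h, mul_zero]
  rcases le_or_gt (1 / 2) (|x|) with h' | h'
  · rw [psi_eq_zero_of_ge h', mul_zero]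
  rw [psiFat_eq_one h.le h'.le, one_mul]

/-! ### One-sided Littlewood–Paley inequalities -/

section

variable {ι E : Type*} [NormedAddCommGroup E] [NormedSpace ℂ E]
  {Φ : (ι →₀ ℂ) →ₗ[ℂ] E} {κ : ι → ℝ}

lemma symbol_smul_apply (σ : ι → ℂ) (c : ι →₀ ℂ) (m : ι) : (σ • c) m = σ m * c m := rfl

lemma exp_ofReal_mul_I (x : ℝ) : Complex.exp (x * Complex.I) = cos x + Complex.I * sin x := by
  rw [Complex.exp_mul_I]; push_cast; ring

lemma integral_exp_mul_I_Icc (x : ℝ) :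
    ∫ y in (-1 : ℝ)..1, Complex.exp ((y * x : ℝ) * Complex.I) = 2 * sinc x := by
  by_cases hx : x = 0
  · simp [hx]; norm_num
  · rw [intervalIntegral.integral_comp_mul_right (fun y : ℝ => Complex.exp (y * Complex.I)) hx,
      neg_one_mul, one_mul, integral_exp_mul_I_eq_sinc, Complex.real_smul]
    have : (x : ℂ) ≠ 0 := by exact_mod_cast hx
    push_cast
    field_simp

lemma multBound_sinc [CompleteSpace E] (hκ : ModulationInvariant Φ κ) (t : ℝ) :
    MultBound Φ (fun m => (sinc (t * κ m) : ℂ)) 1 := by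
  have hk : Integrable (fun y : ℝ => (Set.Ioc (-1 : ℝ) 1).indicator (fun _ => (1 / 2 : ℂ)) y) :=
    (integrable_indicator_iff measurableSet_Ioc).2 (by simp)
  have h := hκ.multBound_integral hk t
  refine (h.congr fun m => ?_).mono (le_of_eq ?_)
  · have e := integral_exp_mul_I_Icc (t * κ m)
    rw [intervalIntegral.integral_of_le (by norm_num)] at e
    have e2 : ∀ y : ℝ, (Set.Ioc (-1 : ℝ) 1).indicator (fun _ => (1 / 2 : ℂ)) y *
        Complex.exp ((y * t * κ m : ℝ) * Complex.I) = (Set.Ioc (-1 : ℝ) 1).indicator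
          (fun y => (1 / 2 : ℂ) * Complex.exp ((y * t * κ m : ℝ) * Complex.I)) y := by
      intro y
      by_cases hy : y ∈ Set.Ioc (-1 : ℝ) 1 <;> simp [hy]
    simp only [e2]
    rw [integral_indicator measurableSet_Ioc, integral_const_mul]
    have e3 : ∀ y : ℝ, Complex.exp ((y * t * κ m : ℝ) * Complex.I)
        = Complex.exp ((y * (t * κ m) : ℝ) * Complex.I) := fun y => by rw [mul_assoc]
    simp only [e3]
    rw [e]; ring
  · have e2 : ∀ y : ℝ, ‖(Set.Ioc (-1 : ℝ) 1).indicator (fun _ => (1 / 2 : ℂ)) y‖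
        = (Set.Ioc (-1 : ℝ) 1).indicator (fun _ => (1 / 2 : ℝ)) y := by
      intro y
      by_cases hy : y ∈ Set.Ioc (-1 : ℝ) 1 <;> simp [hy]
    simp only [e2]
    rw [integral_indicator measurableSet_Ioc]
    simp
    norm_num

lemma sinc_two_mul (x : ℝ) : sinc (2 * x) = cos x * sinc x := by
  by_cases hx : x = 0
  · simp [hx]
  · rw [sinc_of_ne_zero hx, sinc_of_ne_zero (by simpa using hx), sin_two_mul]
    field_simp

lemma contDiffAt_sin_mul_sinc_inv {x : ℝ} (hx0 : x ≠ 0) (hx : |x| < π) :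
    (Complex.I * sin x * sinc x : ℂ) ≠ 0 ∧
      ContDiffAt ℝ (⊤ : ℕ∞) (fun y : ℝ => (Complex.I * sin y * sinc y : ℂ)⁻¹) x := by
  have h1 : sinc x ≠ 0 := (sinc_pos hx).ne'
  have h2 : sin x ≠ 0 := by
    intro h
    rw [sinc_of_ne_zero hx0, h, zero_div] at h1
    exact h1 rfl
  have h3 : (Complex.I * sin x * sinc x : ℂ) ≠ 0 :=
    mul_ne_zero (mul_ne_zero Complex.I_ne_zero (Complex.ofReal_ne_zero.2 h2))
      (Complex.ofReal_ne_zero.2 h1)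
  refine ⟨h3, ContDiffAt.inv ?_ h3⟩
  exact (contDiffAt_const.mul (Complex.ofRealCLM.contDiff.contDiffAt.comp x
    Real.contDiff_sin.contDiffAt)).mul
    (Complex.ofRealCLM.contDiff.contDiffAt.comp x contDiff_sinc.contDiffAt)

lemma enorm_rpow_le_of_norm {E' F : Type*} [SeminormedAddCommGroup E'] [SeminormedAddCommGroup F]
    {x : E'} {y : F} {A a : ℝ} (ha : 0 ≤ a) (h : ‖x‖ ≤ A * ‖y‖) :
    ‖x‖ₑ ^ a ≤ ENNReal.ofReal A ^ a * ‖y‖ₑ ^ a := by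
  rw [← ENNReal.mul_rpow_of_nonneg _ _ ha]
  refine ENNReal.rpow_le_rpow ?_ ha
  rw [← ofReal_norm, ← ofReal_norm, ← ENNReal.ofReal_mul' (norm_nonneg _)]
  exact ENNReal.ofReal_le_ofReal h

lemma MultBound.enorm_rpow_le {σ : ι → ℂ} {A a : ℝ} (h : MultBound Φ σ A) (ha : 0 ≤ a)
    (c : ι →₀ ℂ) : ‖Φ (σ • c)‖ₑ ^ a ≤ ENNReal.ofReal A ^ a * ‖Φ c‖ₑ ^ a :=
  enorm_rpow_le_of_norm ha (h.2 c)

lemma exists_sum_norm_sin_sinc_le [CompleteSpace E] (hκ : ModulationInvariant Φ κ) {τ : ℝ}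
    (hE : TwoPointConvex E τ) (hτ : 0 ≤ τ) : ∃ C : ℝ≥0∞, C ≠ ⊤ ∧ ∀ (δ : ℝ) (N : ℕ) (c : ι →₀ ℂ),
      ∑ j ∈ Finset.range N, ‖Φ ((fun m => (Complex.I * sin (δ * 2 ^ j * κ m) *
        sinc (δ * 2 ^ j * κ m) : ℂ)) • c)‖ₑ ^ τ ≤ C * ‖Φ c‖ₑ ^ τ := by
  obtain ⟨k, hk, hE⟩ := hE
  have step : ∀ (a : ℝ) (c : ι →₀ ℂ), ‖Φ ((fun m => (cos (a * κ m) : ℂ)) • c)‖ ^ τ +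
      k * ‖Φ ((fun m => (Complex.I * sin (a * κ m) : ℂ)) • c)‖ ^ τ ≤ ‖Φ c‖ ^ τ := by
    intro a c
    refine (hE _ _).trans (le_of_eq ?_)
    rw [← map_add, ← map_sub]
    have e1 : (fun m => (cos (a * κ m) : ℂ)) • c + (fun m => (Complex.I * sin (a * κ m) : ℂ)) • c
        = (fun m => Complex.exp ((a * κ m : ℝ) * Complex.I)) • c := by
      ext m
      simp only [Finsupp.add_apply, symbol_smul_apply,
        exp_ofReal_mul_I]
      ring
    have e2 : (fun m => (cos (a * κ m) : ℂ)) • c - (fun m => (Complex.I * sin (a * κ m) : ℂ)) • c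
        = (fun m => Complex.exp ((-a * κ m : ℝ) * Complex.I)) • c := by
      ext m
      simp only [Finsupp.sub_apply, symbol_smul_apply,
        exp_ofReal_mul_I]
      simp only [neg_mul, cos_neg, sin_neg, Complex.ofReal_neg]
      ring
    rw [e1, e2, hκ, hκ]
    ring
  have key : ∀ (δ : ℝ) (N : ℕ) (c : ι →₀ ℂ), ∑ j ∈ Finset.range N, k * ‖Φ ((fun m => (Complex.I *
      sin (δ * 2 ^ j * κ m) * sinc (δ * 2 ^ j * κ m) : ℂ)) • c)‖ ^ τ +
        ‖Φ ((fun m => (sinc (δ * 2 ^ N * κ m) : ℂ)) • c)‖ ^ τ ≤ ‖Φ c‖ ^ τ := by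
    intro δ N c
    induction N with
    | zero =>
      simp only [Finset.range_zero, Finset.sum_empty, zero_add, pow_zero, mul_one]
      refine rpow_le_rpow (norm_nonneg _) ?_ hτ
      simpa using (multBound_sinc hκ δ).2 c
    | succ N ih =>
      have h := step (δ * 2 ^ N) ((fun m => (sinc (δ * 2 ^ N * κ m) : ℂ)) • c)
      have e1 : (fun m => (cos (δ * 2 ^ N * κ m) : ℂ)) • (fun m => (sinc (δ * 2 ^ N * κ m) : ℂ)) • c
          = (fun m => (sinc (δ * 2 ^ (N + 1) * κ m) : ℂ)) • c := by
        ext m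
        have : δ * 2 ^ (N + 1) * κ m = 2 * (δ * 2 ^ N * κ m) := by ring
        simp only [symbol_smul_apply, this, sinc_two_mul]
        push_cast; ring
      have e2 : (fun m => (Complex.I * sin (δ * 2 ^ N * κ m) : ℂ)) •
          (fun m => (sinc (δ * 2 ^ N * κ m) : ℂ)) • c = (fun m => (Complex.I *
            sin (δ * 2 ^ N * κ m) * sinc (δ * 2 ^ N * κ m) : ℂ)) • c := by
        ext m
        simp only [symbol_smul_apply, mul_assoc]
      rw [e1, e2] at h
      rw [Finset.sum_range_succ]
      linarith
  refine ⟨ENNReal.ofReal k⁻¹, ENNReal.ofReal_ne_top, fun δ N c => ?_⟩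
  have h := key δ N c
  rw [← Finset.mul_sum] at h
  have h2 := le_of_add_le_of_nonneg_left h (by positivity)
  rw [← le_inv_mul_iff₀ hk] at h2
  simp only [← ofReal_norm, ENNReal.ofReal_rpow_of_nonneg (norm_nonneg _) hτ]
  rw [← ENNReal.ofReal_sum_of_nonneg (fun _ _ => by positivity), ← ENNReal.ofReal_mul (by positivity)]
  exact ENNReal.ofReal_le_ofReal h2

/-- The lower-type Littlewood–Paley inequality for a space of power-type convexity. -/
lemma IsBand.sum_norm_le [CompleteSpace E] (hκ : ModulationInvariant Φ κ) {τ : ℝ}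
    (hE : TwoPointConvex E τ) (hτ : 0 ≤ τ) {b : ℝ} (hb : b < π) {ζ : ℝ → ℂ} (hζ : IsBand b ζ) :
    ∃ C : ℝ≥0∞, C ≠ ⊤ ∧ ∀ (δ : ℝ) (N : ℕ) (c : ι →₀ ℂ),
      ∑ j ∈ Finset.range N, ‖Φ ((fun m => ζ (δ * 2 ^ j * κ m)) • c)‖ₑ ^ τ ≤ C * ‖Φ c‖ₑ ^ τ := by
  obtain ⟨C, hC, h⟩ := exists_sum_norm_sin_sinc_le hκ hE hτ
  have hq := hζ.mul (g := fun y : ℝ => (Complex.I * sin y * sinc y : ℂ)⁻¹)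
    fun x h0 hx => (contDiffAt_sin_mul_sinc_inv h0 (hx.trans_lt hb)).2
  obtain ⟨A, hA, hm⟩ := hq.isTest.multBound hκ
  refine ⟨ENNReal.ofReal A ^ τ * C, by finiteness, fun δ N c => ?_⟩
  rw [mul_assoc]
  refine le_trans ?_ (mul_le_mul_right (h δ N c) _)
  rw [Finset.mul_sum]
  refine Finset.sum_le_sum fun j _ => ?_
  refine le_trans (le_of_eq ?_) ((hm (δ * 2 ^ j)).enorm_rpow_le hτ _)
  congr 3
  ext m
  simp only [symbol_smul_apply]
  rw [← mul_assoc]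
  congr 1
  set x := δ * 2 ^ j * κ m
  by_cases hx0 : x = 0
  · obtain ⟨a, ha, hl⟩ := hζ.low
    rw [hl x (by simpa [hx0] using ha)]; simp
  · rcases le_or_gt (|x|) b with h | h
    · rw [mul_assoc, inv_mul_cancel₀ (contDiffAt_sin_mul_sinc_inv hx0 (h.trans_lt hb)).1, mul_one]
    · rw [hζ.high x h]; simp

/-- The upper-type Littlewood–Paley inequality for a space of power-type smoothness. -/
lemma IsBand.norm_sum_le [CompleteSpace E] (hκ : ModulationInvariant Φ κ) {θ : ℝ}
    (hE : TwoPointSmooth E θ) (hθ : 1 ≤ θ) {b : ℝ} (hb : b < π) {ζ : ℝ → ℂ} (hζ : IsBand b ζ) :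
    ∃ C : ℝ≥0∞, C ≠ ⊤ ∧ ∀ (δ : ℝ) (N : ℕ) (v : ℕ → ι →₀ ℂ),
      ‖Φ (∑ j ∈ Finset.range N, (fun m => ζ (δ * 2 ^ j * κ m)) • v j)‖ₑ ^ θ ≤
        C * ∑ j ∈ Finset.range N, ‖Φ (v j)‖ₑ ^ θ := by
  obtain ⟨k, hk, hE⟩ := hE
  have hθ0 : 0 ≤ θ := by linarith
  have step : ∀ (a : ℝ) (c w : ι →₀ ℂ), ‖Φ ((fun m => (cos (a * κ m) : ℂ)) • c +
      (fun m => (Complex.I * sin (a * κ m) : ℂ)) • w)‖ ^ θ ≤ ‖Φ c‖ ^ θ + k * ‖Φ w‖ ^ θ := by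
    intro a c w
    refine le_trans ?_ (hE _ _)
    rw [← map_add, ← map_sub, ← hκ a (c + w), ← hκ (-a) (c - w)]
    have e : (fun m => (cos (a * κ m) : ℂ)) • c + (fun m => (Complex.I * sin (a * κ m) : ℂ)) • w
        = (1 / 2 : ℂ) • ((fun m => Complex.exp ((a * κ m : ℝ) * Complex.I)) • (c + w))
         + (1 / 2 : ℂ) • ((fun m => Complex.exp ((-a * κ m : ℝ) * Complex.I)) • (c - w)) := by
      ext m
      simp only [Finsupp.add_apply, Finsupp.sub_apply, Finsupp.smul_apply,
        smul_eq_mul, symbol_smul_apply,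
        exp_ofReal_mul_I]
      simp only [neg_mul, cos_neg, sin_neg, Complex.ofReal_neg]
      ring
    rw [e, Φ.map_add, Φ.map_smul, Φ.map_smul]
    set P := Φ ((fun m => Complex.exp ((a * κ m : ℝ) * Complex.I)) • (c + w))
    set Q := Φ ((fun m => Complex.exp ((-a * κ m : ℝ) * Complex.I)) • (c - w))
    refine (rpow_le_rpow (norm_nonneg _) (?_ : _ ≤ (‖P‖ + ‖Q‖) / 2) hθ0).trans ?_
    · refine (norm_add_le _ _).trans (le_of_eq ?_)
      rw [norm_smul, norm_smul]; norm_num; ring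
    · exact rpow_avg_le hθ (norm_nonneg _) (norm_nonneg _)
  have key : ∀ (N : ℕ) (δ : ℝ) (w : ℕ → ι →₀ ℂ), ∃ S : ι →₀ ℂ,
      ∑ j ∈ Finset.range N, (fun m => (Complex.I * sin (δ * 2 ^ j * κ m) *
        sinc (δ * 2 ^ j * κ m) : ℂ)) • w j = (fun m => (sinc (δ * κ m) : ℂ)) • S ∧
      ‖Φ S‖ ^ θ ≤ k * ∑ j ∈ Finset.range N, ‖Φ (w j)‖ ^ θ := by
    intro N
    induction N with
    | zero => exact fun δ w => ⟨0, by ext; simp [symbol_smul_apply], by simp [zero_rpow (by linarith : θ ≠ 0)]⟩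
    | succ N ih =>
      intro δ w
      obtain ⟨S, h1, h2⟩ := ih (2 * δ) (fun j => w (j + 1))
      refine ⟨(fun m => (cos (δ * κ m) : ℂ)) • S +
        (fun m => (Complex.I * sin (δ * κ m) : ℂ)) • w 0, ?_, ?_⟩
      · have e : ∀ j, δ * 2 ^ (j + 1) = 2 * δ * 2 ^ j := fun j => by ring
        rw [Finset.sum_range_succ']
        simp only [e, h1]
        ext m
        simp only [Finsupp.add_apply, symbol_smul_apply,
          mul_assoc 2 δ, sinc_two_mul, pow_zero, mul_one]
        push_cast; ring
      · refine (step _ _ _).trans ?_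
        rw [Finset.sum_range_succ', mul_add]
        linarith
  have hq := hζ.mul (g := fun y : ℝ => (Complex.I * sin y * sinc y : ℂ)⁻¹)
    fun x h0 hx => (contDiffAt_sin_mul_sinc_inv h0 (hx.trans_lt hb)).2
  obtain ⟨A, hA, hm⟩ := hq.isTest.multBound hκ
  refine ⟨ENNReal.ofReal k * ENNReal.ofReal A ^ θ, by finiteness, fun δ N v => ?_⟩
  obtain ⟨S, h1, h2⟩ := key N δ (fun j => (fun m => ζ (δ * 2 ^ j * κ m) *
    (Complex.I * sin (δ * 2 ^ j * κ m) * sinc (δ * 2 ^ j * κ m) : ℂ)⁻¹) • v j)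
  have e : ∑ j ∈ Finset.range N, (fun m => ζ (δ * 2 ^ j * κ m)) • v j
      = (fun m => (sinc (δ * κ m) : ℂ)) • S := by
    rw [← h1]
    refine Finset.sum_congr rfl fun j _ => ?_
    ext m
    simp only [symbol_smul_apply]
    rw [← mul_assoc]
    congr 1
    set x := δ * 2 ^ j * κ m
    by_cases hx0 : x = 0
    · obtain ⟨a, ha, hl⟩ := hζ.low
      rw [hl x (by simpa [hx0] using ha)]; simp
    · rcases le_or_gt (|x|) b with h | h
      · rw [mul_left_comm, mul_inv_cancel₀ (contDiffAt_sin_mul_sinc_inv hx0 (h.trans_lt hb)).1,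
          mul_one]
      · rw [hζ.high x h]; simp
  rw [e]
  refine ((multBound_sinc hκ δ).enorm_rpow_le hθ0 S).trans ?_
  rw [ENNReal.ofReal_one, ENNReal.one_rpow, one_mul, mul_assoc, Finset.mul_sum]
  refine le_trans ?_ (mul_le_mul_right (Finset.sum_le_sum fun j _ =>
    (hm (δ * 2 ^ j)).enorm_rpow_le hθ0 (v j)) _)
  simp only [← ofReal_norm, ENNReal.ofReal_rpow_of_nonneg (norm_nonneg _) hθ0]
  rw [← ENNReal.ofReal_sum_of_nonneg (fun _ _ => by positivity), ← ENNReal.ofReal_mul (by positivity)]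
  exact ENNReal.ofReal_le_ofReal h2

end

/-! ### Frequency-localized estimates for fractional differences -/

lemma sum_psi_up (x : ℝ) (N : ℕ) :
    ∑ j ∈ Finset.range N, psi (2 ^ j * x) = chi x - chi (2 ^ N * x) := by
  induction N with
  | zero => simp
  | succ N ih => rw [Finset.sum_range_succ, ih, psi, ← mul_assoc 2, ← pow_succ']; ring

lemma sum_psi_down (x : ℝ) (N : ℕ) :
    ∑ j ∈ Finset.range N, psi (x / 2 ^ j) = chi (2 * (x / 2 ^ N)) - chi (2 * x) := by
  induction N with
  | zero => simp
  | succ N ih =>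
    have : 2 * (x / 2 ^ (N + 1)) = x / 2 ^ N := by field_simp; ring
    rw [Finset.sum_range_succ, ih, psi, this]; ring

/-- A test function agreeing with `dquot γ` on `[-1,1]`. -/
def dquotCut (γ x : ℝ) : ℂ := chi (1 / 4 * x) * dquot γ x

lemma isTest_dquotCut (γ : ℝ) : IsTest (dquotCut γ) := by
  refine (isTest_chi.comp_mul (a := 1 / 4) (by norm_num)).mul_of_ball (b := 2) (fun x hx => ?_)
    fun x hx => contDiffAt_dquot γ (by linarith [Real.pi_gt_three])
  refine chi_eq_zero ?_
  rw [abs_mul, abs_of_pos (by norm_num : (0:ℝ) < 1 / 4)]; linarith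

lemma dquotCut_eq (γ : ℝ) {x : ℝ} (hx : |x| ≤ 1) : dquotCut γ x = dquot γ x := by
  rw [dquotCut, chi_eq_one, one_mul]
  rw [abs_mul, abs_of_pos (by norm_num : (0:ℝ) < 1 / 4)]; linarith

/-- The homogeneous symbol `(±ix)^γ (ix)^{-s}`, of degree `γ - s`. -/
def qsym (e γ s x : ℝ) : ℂ := ipow γ (e * x) * ipow (-s) x

lemma qsym_mul (e γ s : ℝ) {u : ℝ} (hu : 0 < u) (x : ℝ) :
    qsym e γ s (u * x) = (u ^ (γ - s) : ℝ) * qsym e γ s x := by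
  rw [qsym, qsym, mul_left_comm, ipow_mul _ hu, ipow_mul _ hu, sub_eq_add_neg, rpow_add hu]
  push_cast; ring

lemma contDiffAt_qsym {e : ℝ} (he : e ≠ 0) (γ s : ℝ) {x : ℝ} (hx : x ≠ 0) :
    ContDiffAt ℝ (⊤ : ℕ∞) (qsym e γ s) x :=
  ((contDiffAt_ipow γ (mul_ne_zero he hx)).comp x (contDiffAt_const.mul contDiffAt_id)).mul
    (contDiffAt_ipow (-s) hx)

lemma exists_sign (h : ℝ) : ∃ e : ℝ, (e = 1 ∨ e = -1) ∧ h = |h| * e := by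
  rcases le_total 0 h with h0 | h0
  · exact ⟨1, Or.inl rfl, by rw [abs_of_nonneg h0, mul_one]⟩
  · exact ⟨-1, Or.inr rfl, by rw [abs_of_nonpos h0]; ring⟩

lemma dsym_mul_ipow {γ s : ℝ} (hγ : 0 < γ) {h e u x : ℝ} (h0 : h ≠ 0)
    (hhe : h = |h| * e) (hu : 0 < u) (hx : x ≠ 0) (hhx : |h * x| ≤ 1) :
    dsym γ (h * x) * ipow (-s) x =
      (|h| ^ γ * u ^ (s - γ) : ℝ) * (dquotCut γ (h * x) * qsym e γ s (u * x)) := by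
  have e1 : h * x = |h| * (e * x) := by rw [← mul_assoc, ← hhe]
  rw [dsym_eq hγ (mul_ne_zero h0 hx) (by linarith [Real.pi_gt_three]), dquotCut_eq γ hhx,
    qsym_mul _ _ _ hu, qsym]
  conv_lhs => rw [show ipow γ (h * x) = (|h| ^ γ : ℝ) * ipow γ (e * x) by
    rw [e1, ipow_mul _ (abs_pos.2 h0)]]
  have : (u ^ (s - γ) : ℝ) * (u ^ (γ - s) : ℝ) = 1 := by
    rw [← rpow_add hu]; simp
  have h2 : ((u ^ (s - γ) : ℝ) : ℂ) * ((u ^ (γ - s) : ℝ) : ℂ) = 1 := by exact_mod_cast this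
  push_cast at h2 ⊢
  linear_combination (-1 : ℂ) * ((|h| ^ γ : ℝ) : ℂ) * dquot γ (h * x) * ipow γ (e * x) * ipow (-s) x * h2

/-- The symbol of the normalized fractional difference of a fractional integral. -/
def dnorm (γ s t h x : ℝ) : ℂ := (t ^ (-s) : ℝ) * (dsym γ (h * x) * ipow (-s) x)

section

variable {ι E : Type*} [NormedAddCommGroup E] [NormedSpace ℂ E] [CompleteSpace E]
  {Φ : (ι →₀ ℂ) →ₗ[ℂ] E} {κ : ι → ℝ}

omit [CompleteSpace E] in
lemma MultBound.zero : MultBound Φ (fun _ => 0) 0 :=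
  ⟨le_rfl, fun c => by
    have : (fun _ : ι => (0:ℂ)) • c = 0 := by ext; simp [symbol_smul_apply]
    simp [this]⟩

lemma multBound_dnorm_psiFat (hκ : ModulationInvariant Φ κ) (hκ0 : ∀ m, κ m ≠ 0) {γ s : ℝ}
    (hs : 0 < s) (hsγ : s < γ) : ∃ C : ℝ, 0 < C ∧ ∀ t u h : ℝ, 0 < t → 0 < u → |h| ≤ t →
      MultBound Φ (fun m => dnorm γ s t h (κ m) * psiFat (u * κ m))
        (C * min ((u / t) ^ s) ((t / u) ^ (γ - s))) := by
  have hγ : 0 < γ := hs.trans hsγ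
  obtain ⟨C₁, hC₁, h₁⟩ := (isBand_psiFat.mul (g := ipow (-s))
    fun x hx _ => contDiffAt_ipow _ hx).isTest.multBound hκ
  obtain ⟨C₂, hC₂, h₂⟩ := (isTest_dquotCut γ).multBound hκ
  obtain ⟨C₃, hC₃, h₃⟩ := (isBand_psiFat.mul (g := qsym 1 γ s)
    fun x hx _ => contDiffAt_qsym one_ne_zero _ _ hx).isTest.multBound hκ
  obtain ⟨C₄, hC₄, h₄⟩ := (isBand_psiFat.mul (g := qsym (-1) γ s)
    fun x hx _ => contDiffAt_qsym (by norm_num) _ _ hx).isTest.multBound hκ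
  set D := ∑' ν, |dcoef γ ν|
  have hD : 0 ≤ D := tsum_nonneg fun _ => abs_nonneg _
  refine ⟨D * C₁ + C₂ * (C₃ + C₄), by positivity, fun t u h ht hu hht => ?_⟩
  have b1 : MultBound Φ (fun m => dnorm γ s t h (κ m) * psiFat (u * κ m))
      ((D * C₁ + C₂ * (C₃ + C₄)) * (u / t) ^ s) := by
    have := ((multBound_dsym hκ hγ h).comp (h₁ u)).const_mul ((t ^ (-s) * u ^ s : ℝ) : ℂ)
    refine (this.congr fun m => ?_).mono ?_
    · have e : (u ^ s : ℝ) * ipow (-s) (u * κ m) = ipow (-s) (κ m) := by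
        rw [ipow_mul _ hu, ← mul_assoc, ← Complex.ofReal_mul, ← rpow_add hu]; simp
      rw [dnorm, ← e]; push_cast; ring
    · rw [Complex.norm_real, Real.norm_of_nonneg (by positivity), div_rpow hu.le ht.le,
        rpow_neg ht.le, mul_comm, inv_mul_eq_div]
      refine mul_le_mul_of_nonneg_right ?_ (by positivity)
      have : 0 ≤ C₂ * (C₃ + C₄) := by positivity
      linarith
  rcases le_total u t with hut | hut
  · refine b1.mono (mul_le_mul_of_nonneg_left (le_min le_rfl ?_) (by positivity))
    exact (rpow_le_one (by positivity) ((div_le_one ht).2 hut) hs.le).trans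
      (one_le_rpow ((one_le_div hu).2 hut) (by linarith))
  refine MultBound.mono (A := (D * C₁ + C₂ * (C₃ + C₄)) * (t / u) ^ (γ - s)) ?_
    (mul_le_mul_of_nonneg_left (le_min ?_ le_rfl) (by positivity))
  swap
  · exact (rpow_le_one (by positivity) ((div_le_one hu).2 hut) (by linarith)).trans
      (one_le_rpow ((one_le_div ht).2 hut) hs.le)
  by_cases h0 : h = 0
  · refine (MultBound.zero.congr fun m => ?_).mono (by positivity)
    simp [dnorm, h0, dsym_zero hγ]
  obtain ⟨e, he, hhe⟩ := exists_sign h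
  have h₅ : MultBound Φ (fun m => psiFat (u * κ m) * qsym e γ s (u * κ m)) (C₃ + C₄) := by
    rcases he with rfl | rfl
    · exact (h₃ u).mono (by linarith)
    · exact (h₄ u).mono (by linarith)
  have := ((h₂ h).comp h₅).const_mul ((t ^ (-s) * (|h| ^ γ * u ^ (s - γ)) : ℝ) : ℂ)
  refine (this.congr fun m => ?_).mono ?_
  · by_cases hp : psiFat (u * κ m) = 0
    · simp [hp]
    · have hux : |u * κ m| ≤ 1 := by
        by_contra hcon
        exact hp (isBand_psiFat.high _ (not_le.1 hcon))
      have hhx : |h * κ m| ≤ 1 := by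
        refine le_trans ?_ hux
        rw [abs_mul, abs_mul, abs_of_pos hu]
        exact mul_le_mul_of_nonneg_right (hht.trans hut) (abs_nonneg _)
      rw [dnorm, dsym_mul_ipow hγ h0 hhe hu (hκ0 m) hhx]
      push_cast; ring
  · rw [Complex.norm_real, Real.norm_of_nonneg (by positivity)]
    have e1 : t ^ (-s) * (t ^ γ * u ^ (s - γ)) = (t / u) ^ (γ - s) := by
      rw [div_rpow ht.le hu.le, ← mul_assoc, ← rpow_add ht, div_eq_mul_inv, ← rpow_neg hu.le]
      congr 2 <;> ring
    rw [mul_comm (D * C₁ + _), ← e1]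
    refine mul_le_mul ?_ ?_ (by positivity) (by positivity)
    · exact mul_le_mul_of_nonneg_left (mul_le_mul_of_nonneg_right
        (rpow_le_rpow (abs_nonneg _) hht hγ.le) (by positivity)) (by positivity)
    · have : 0 ≤ D * C₁ := by positivity
      linarith

/-- The difference of order `γ` of the low-frequency part. -/
lemma norm_dnorm_chi_le (hκ : ModulationInvariant Φ κ) (hκ0 : ∀ m, κ m ≠ 0) {γ s : ℝ}
    (hs : 0 < s) (hsγ : s < γ) : ∃ C : ℝ, 0 < C ∧ ∀ t δ h : ℝ, 0 < t → t ≤ δ → |h| ≤ t →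
      ∃ e : ℝ, (e = 1 ∨ e = -1) ∧ ∀ c : ι →₀ ℂ,
        ‖Φ ((fun m => dnorm γ s t h (κ m) * chi (δ * κ m)) • c)‖ ≤
        C * (t / δ) ^ (γ - s) * ‖Φ ((fun m => chi (δ * κ m) * qsym e γ s (δ * κ m)) • c)‖ := by
  have hγ : 0 < γ := hs.trans hsγ
  obtain ⟨C, hC, h₂⟩ := (isTest_dquotCut γ).multBound hκ
  refine ⟨C, hC, fun t δ h ht htδ hht => ?_⟩
  have hδ : 0 < δ := ht.trans_le htδ
  obtain ⟨e, he, hhe⟩ := exists_sign h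
  refine ⟨e, he, fun c => ?_⟩
  by_cases h0 : h = 0
  · have : (fun m => dnorm γ s t h (κ m) * chi (δ * κ m)) • c = 0 := by
      ext m; simp [symbol_smul_apply, dnorm, h0, dsym_zero hγ]
    rw [this, map_zero, norm_zero]; positivity
  have hm := ((h₂ h).const_mul ((t ^ (-s) * (|h| ^ γ * δ ^ (s - γ)) : ℝ) : ℂ)).2
    ((fun m => chi (δ * κ m) * qsym e γ s (δ * κ m)) • c)
  refine le_trans (le_of_eq ?_) (hm.trans (mul_le_mul_of_nonneg_right ?_ (norm_nonneg _)))
  · congr 2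
    ext m
    simp only [symbol_smul_apply]
    rw [← mul_assoc]
    congr 1
    by_cases hp : chi (δ * κ m) = 0
    · simp [hp]
    · have hux : |δ * κ m| ≤ 1 := by
        by_contra hcon
        exact hp (chi_eq_zero (by linarith))
      have hhx : |h * κ m| ≤ 1 := by
        refine le_trans ?_ hux
        rw [abs_mul, abs_mul, abs_of_pos hδ]
        exact mul_le_mul_of_nonneg_right (hht.trans htδ) (abs_nonneg _)
      rw [dnorm, dsym_mul_ipow hγ h0 hhe hδ (hκ0 m) hhx]
      push_cast; ring
  · rw [Complex.norm_real, Real.norm_of_nonneg (by positivity)]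
    have e1 : t ^ (-s) * (t ^ γ * δ ^ (s - γ)) = (t / δ) ^ (γ - s) := by
      rw [div_rpow ht.le hδ.le, ← mul_assoc, ← rpow_add ht, div_eq_mul_inv, ← rpow_neg hδ.le]
      congr 2 <;> ring
    rw [mul_comm C, ← e1]
    refine mul_le_mul_of_nonneg_right ?_ hC.le
    exact mul_le_mul_of_nonneg_left (mul_le_mul_of_nonneg_right
        (rpow_le_rpow (abs_nonneg _) hht hγ.le) (by positivity)) (by positivity)

end

/-! ### Abstract upper and lower estimates in one variable -/

section Estimates

variable {ι E : Type*} [NormedAddCommGroup E] [NormedSpace ℂ E]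

/-- The symbols of the families `𝒯 k` are controlled, in an `ℓ^τ` sense, by the symbols `A i`,
through an almost diagonal matrix `w` and a sequence `B` of intermediate symbols. -/
def UpperEst (Φ : (ι →₀ ℂ) →ₗ[ℂ] E) (τ : ℝ) (C : ℝ≥0∞) (𝒯 : ℕ → Set (ι → ℂ)) {a : Type*}
    [Fintype a] (A : a → ι → ℂ) : Prop :=
  ∃ (B : ℕ → ι → ℂ) (w : ℕ → ℕ → ℝ≥0∞),
    (∀ k, ∀ σ ∈ 𝒯 k, ∀ c, ‖Φ (σ • c)‖ₑ ^ τ ≤ ∑' j, w k j * ‖Φ (B j • c)‖ₑ ^ τ) ∧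
    (∀ j, ∑' k, w k j ≤ C) ∧
    ∀ c, ∑' j, ‖Φ (B j • c)‖ₑ ^ τ ≤ C * ∑ i, ‖Φ (A i • c)‖ₑ ^ τ

/-- The symbols `A i` are controlled, in an `ℓ^θ` sense, by the symbols of the families `𝒮 j`. -/
def LowerEst (Φ : (ι →₀ ℂ) →ₗ[ℂ] E) (θ : ℝ) (C : ℝ≥0∞) (𝒮 : ℕ → Set (ι → ℂ)) {a : Type*}
    (A : a → ι → ℂ) : Prop :=
  ∀ i c, ‖Φ (A i • c)‖ₑ ^ θ ≤ C * ∑' j, ⨆ σ ∈ 𝒮 j, ‖Φ (σ • c)‖ₑ ^ θ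

lemma tsum_mul_rpow_le {τ : ℝ} (hτ : 1 ≤ τ) {w b : ℕ → ℝ≥0∞} {W : ℝ≥0∞} (hw : ∑' j, w j ≤ W) :
    (∑' j, w j * b j) ^ τ ≤ ∑' j, (W ^ (τ - 1) * w j) * b j ^ τ := by
  have hτ0 : 0 < τ := by linarith
  have h1 : ∑' j, w j * b j ≤ W ^ (1 - τ⁻¹) * (∑' j, w j * b j ^ τ) ^ τ⁻¹ := by
    rw [ENNReal.tsum_eq_iSup_sum]
    refine iSup_le fun F => (ENNReal.inner_le_weight_mul_Lp_of_nonneg F hτ w b).trans ?_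
    gcongr
    · rw [sub_nonneg]; exact inv_le_one_of_one_le₀ hτ
    · exact (ENNReal.sum_le_tsum F).trans hw
    · exact ENNReal.sum_le_tsum F
  calc _ ≤ (W ^ (1 - τ⁻¹) * (∑' j, w j * b j ^ τ) ^ τ⁻¹) ^ τ := by gcongr
    _ = W ^ (τ - 1) * ∑' j, w j * b j ^ τ := by
        rw [ENNReal.mul_rpow_of_nonneg _ _ hτ0.le, ← ENNReal.rpow_mul, ← ENNReal.rpow_mul,
          inv_mul_cancel₀ hτ0.ne', ENNReal.rpow_one, sub_mul, inv_mul_cancel₀ hτ0.ne', one_mul]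
    _ = _ := by
        rw [← ENNReal.tsum_mul_left]
        exact tsum_congr fun j => (mul_assoc _ _ _).symm

/-- The geometric matrix `2^{-ρ|k-j|}`. -/
def geomWeight (ρ : ℝ) (k j : ℕ) : ℝ≥0∞ := ENNReal.ofReal (2 ^ (-(ρ * |(k : ℝ) - j|)))

lemma exists_tsum_geomWeight_le {ρ : ℝ} (hρ : 0 < ρ) :
    ∃ W : ℝ≥0∞, W ≠ ⊤ ∧ (∀ k, ∑' j, geomWeight ρ k j ≤ W) ∧ ∀ j, ∑' k, geomWeight ρ k j ≤ W := by
  set f : ℤ → ℝ := fun n => 2 ^ (-(ρ * |(n : ℝ)|))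
  have hf : Summable f := by
    have hg : Summable fun n : ℕ => ((2:ℝ) ^ (-ρ)) ^ n :=
      summable_geometric_of_lt_one (by positivity)
        (rpow_lt_one_of_one_lt_of_neg one_lt_two (by linarith))
    refine Summable.of_nat_of_neg ?_ ?_
    all_goals
      refine hg.congr fun n => ?_
      simp [f, ← rpow_natCast, ← rpow_mul]
  refine ⟨∑' n, ENNReal.ofReal (f n), ?_, fun k => ?_, fun j => ?_⟩
  · rw [← ENNReal.ofReal_tsum_of_nonneg (fun n => by positivity) hf]
    exact ENNReal.ofReal_ne_top
  · refine le_trans (le_of_eq (tsum_congr fun j => ?_))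
      (ENNReal.tsum_comp_le_tsum_of_injective (f := fun j : ℕ => (k : ℤ) - j)
        (fun a b h => by simpa using h) fun n => ENNReal.ofReal (f n))
    simp [f, geomWeight]
  · refine le_trans (le_of_eq (tsum_congr fun k => ?_))
      (ENNReal.tsum_comp_le_tsum_of_injective (f := fun k : ℕ => (k : ℤ) - j)
        (fun a b h => by simpa using h) fun n => ENNReal.ofReal (f n))
    simp [f, geomWeight]

lemma min_rpow_le {a b x : ℝ} : 
    min ((2:ℝ) ^ (x * a)) ((2:ℝ) ^ (-x * b)) ≤ 2 ^ (-(min a b * |x|)) := by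
  rcases le_total 0 x with hx | hx
  · refine (min_le_right _ _).trans (rpow_le_rpow_of_exponent_le one_le_two ?_)
    rw [abs_of_nonneg hx]
    nlinarith [min_le_right a b]
  · refine (min_le_left _ _).trans (rpow_le_rpow_of_exponent_le one_le_two ?_)
    rw [abs_of_nonpos hx]
    nlinarith [min_le_left a b]

lemma exists_upperEst {τ ρ : ℝ} (hτ : 1 ≤ τ) (hρ : 0 < ρ) (C D : ℝ≥0∞) (hC : C ≠ ⊤) (hD : D ≠ ⊤) :
    ∃ K : ℝ≥0∞, K ≠ ⊤ ∧ ∀ (Φ : (ι →₀ ℂ) →ₗ[ℂ] E) (𝒯 : ℕ → Set (ι → ℂ)) (n : ℕ)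
      (A : Fin n → ι → ℂ) (B : ℕ → ι → ℂ),
      (∀ k, ∀ σ ∈ 𝒯 k, ∀ c, ‖Φ (σ • c)‖ₑ ≤ ∑' j, (C * geomWeight ρ k j) * ‖Φ (B j • c)‖ₑ) →
      (∀ c, ∑' j, ‖Φ (B j • c)‖ₑ ^ τ ≤ D * ∑ i, ‖Φ (A i • c)‖ₑ ^ τ) → UpperEst Φ τ K 𝒯 A := by
  obtain ⟨W, hW, h1, h2⟩ := exists_tsum_geomWeight_le hρ
  have hτ1 : 0 ≤ τ - 1 := by linarith
  refine ⟨max ((C * W) ^ (τ - 1) * (C * W)) D, by finiteness, fun Φ 𝒯 n A B h hB => 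
    ⟨B, fun k j => (C * W) ^ (τ - 1) * (C * geomWeight ρ k j), fun k σ hσ c => ?_, fun j => ?_,
      fun c => (hB c).trans (by gcongr; exact le_max_right _ _)⟩⟩
  · refine (ENNReal.rpow_le_rpow (h k σ hσ c) (by linarith)).trans (tsum_mul_rpow_le hτ ?_)
    rw [ENNReal.tsum_mul_left]
    exact mul_le_mul_right (h1 k) _
  · rw [ENNReal.tsum_mul_left, ENNReal.tsum_mul_left]
    refine le_trans ?_ (le_max_left _ _)
    gcongr
    exact h2 j

/-! ### Two variables -/

lemma UpperEst.tsum_tsum_le {Φ : (ι →₀ ℂ) →ₗ[ℂ] E} {τ : ℝ} {C C' : ℝ≥0∞}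
    {𝒯 𝒯' : ℕ → Set (ι → ℂ)} {a a' : Type*} [Fintype a] [Fintype a'] {A : a → ι → ℂ}
    {A' : a' → ι → ℂ} (h : UpperEst Φ τ C 𝒯 A) (h' : UpperEst Φ τ C' 𝒯' A') (c : ι →₀ ℂ) :
    ∑' k, ∑' k', ⨆ σ ∈ 𝒯 k, ⨆ σ' ∈ 𝒯' k', ‖Φ (σ • σ' • c)‖ₑ ^ τ ≤
      C * C * (C' * C') * ∑ i, ∑ i', ‖Φ (A i • A' i' • c)‖ₑ ^ τ := by
  obtain ⟨B, w, h1, h2, h3⟩ := h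
  obtain ⟨B', w', h1', h2', h3'⟩ := h'
  have hcomm (σ σ' : ι → ℂ) (c : ι →₀ ℂ) : σ • σ' • c = σ' • σ • c := by
    ext m; simp only [symbol_smul_apply]; ring
  have e1 (k k') : ⨆ σ ∈ 𝒯 k, ⨆ σ' ∈ 𝒯' k', ‖Φ (σ • σ' • c)‖ₑ ^ τ ≤
      ∑' j, ∑' j', w k j * (w' k' j' * ‖Φ (B j • B' j' • c)‖ₑ ^ τ) := by
    refine iSup₂_le fun σ hσ => iSup₂_le fun σ' hσ' => (h1 k σ hσ _).trans ?_
    refine ENNReal.tsum_le_tsum fun j => ?_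
    rw [ENNReal.tsum_mul_left, hcomm]
    refine mul_le_mul_right ((h1' k' σ' hσ' _).trans (le_of_eq (tsum_congr fun j' => ?_))) _
    rw [hcomm]
  calc _ ≤ ∑' k, ∑' k', ∑' j, ∑' j', w k j * (w' k' j' * ‖Φ (B j • B' j' • c)‖ₑ ^ τ) := by
        gcongr with k k'; exact e1 k k'
    _ = ∑' j, ∑' j', (∑' k, w k j) * ((∑' k', w' k' j') * ‖Φ (B j • B' j' • c)‖ₑ ^ τ) := by
        calc _ = ∑' k, ∑' j, ∑' k', ∑' j', w k j * (w' k' j' * ‖Φ (B j • B' j' • c)‖ₑ ^ τ) :=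
              tsum_congr fun k => ENNReal.tsum_comm
          _ = ∑' j, ∑' k, ∑' j', ∑' k', w k j * (w' k' j' * ‖Φ (B j • B' j' • c)‖ₑ ^ τ) := by
              rw [ENNReal.tsum_comm]
              exact tsum_congr fun j => tsum_congr fun k => ENNReal.tsum_comm
          _ = ∑' j, ∑' j', ∑' k, ∑' k', w k j * (w' k' j' * ‖Φ (B j • B' j' • c)‖ₑ ^ τ) := 
              tsum_congr fun j => ENNReal.tsum_comm
          _ = _ := by simp only [ENNReal.tsum_mul_left, ENNReal.tsum_mul_right]
    _ ≤ ∑' j, ∑' j', C * (C' * ‖Φ (B j • B' j' • c)‖ₑ ^ τ) := by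
        gcongr with j j'
        · exact h2 j
        · exact h2' j'
    _ = C * (C' * ∑' j, ∑' j', ‖Φ (B' j' • B j • c)‖ₑ ^ τ) := by
        simp only [ENNReal.tsum_mul_left, hcomm]
    _ ≤ C * (C' * ∑' j, C' * ∑ i', ‖Φ (A' i' • B j • c)‖ₑ ^ τ) := by
        gcongr with j; exact h3' _
    _ = C * (C' * (C' * ∑ i', ∑' j, ‖Φ (B j • A' i' • c)‖ₑ ^ τ)) := by
        rw [ENNReal.tsum_mul_left, Summable.tsum_finsetSum fun _ _ => ENNReal.summable]
        simp only [fun j i' => hcomm (A' i') (B j) c]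
    _ ≤ C * (C' * (C' * ∑ i', C * ∑ i, ‖Φ (A i • A' i' • c)‖ₑ ^ τ)) := by
        gcongr with i'; exact h3 _
    _ = _ := by
        rw [← Finset.mul_sum, Finset.sum_comm]; ring

lemma LowerEst.le_tsum_tsum {Φ : (ι →₀ ℂ) →ₗ[ℂ] E} {θ : ℝ} {C C' : ℝ≥0∞}
    {𝒮 𝒮' : ℕ → Set (ι → ℂ)} {a a' : Type*} {A : a → ι → ℂ} {A' : a' → ι → ℂ}
    (h : LowerEst Φ θ C 𝒮 A) (h' : LowerEst Φ θ C' 𝒮' A') (i : a) (i' : a') (c : ι →₀ ℂ) :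
    ‖Φ (A i • A' i' • c)‖ₑ ^ θ ≤
      C * C' * ∑' j, ∑' j', ⨆ σ ∈ 𝒮 j, ⨆ σ' ∈ 𝒮' j', ‖Φ (σ • σ' • c)‖ₑ ^ θ := by
  have hcomm (σ σ' : ι → ℂ) (c : ι →₀ ℂ) : σ • σ' • c = σ' • σ • c := by
    ext m; simp only [symbol_smul_apply]; ring
  calc _ ≤ C * ∑' j, ⨆ σ ∈ 𝒮 j, ‖Φ (σ • A' i' • c)‖ₑ ^ θ := h i _
    _ ≤ C * ∑' j, C' * ∑' j', ⨆ σ ∈ 𝒮 j, ⨆ σ' ∈ 𝒮' j', ‖Φ (σ • σ' • c)‖ₑ ^ θ := by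
        refine mul_le_mul_right (ENNReal.tsum_le_tsum fun j => ?_) _
        refine iSup₂_le fun σ hσ => ?_
        rw [hcomm]
        refine (h' i' _).trans ?_
        refine mul_le_mul_right (ENNReal.tsum_le_tsum fun j' => ?_) _
        refine le_trans ?_ (le_iSup₂ (f := fun σ (_ : σ ∈ 𝒮 j) =>
          ⨆ σ' ∈ 𝒮' j', ‖Φ (σ • σ' • c)‖ₑ ^ θ) σ hσ)
        exact iSup₂_mono fun σ' _ => by rw [hcomm]
    _ = _ := by rw [ENNReal.tsum_mul_left, mul_assoc]

/-- Combination of the upper and lower estimates. -/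
lemma UpperEst.le_of_lowerEst {Φ : (ι →₀ ℂ) →ₗ[ℂ] E} {τ θ : ℝ} (hτ : 0 < τ) (hθ : 0 < θ)
    {C C' D D' : ℝ≥0∞} {𝒯 𝒯' 𝒮 𝒮' : ℕ → Set (ι → ℂ)} {n n' : ℕ}
    {A : Fin n → ι → ℂ} {A' : Fin n' → ι → ℂ} (h : UpperEst Φ τ C 𝒯 A) (h' : UpperEst Φ τ C' 𝒯' A')
    (g : LowerEst Φ θ D 𝒮 A) (g' : LowerEst Φ θ D' 𝒮' A') (c : ι →₀ ℂ) :
    (∑' k, ∑' k', ⨆ σ ∈ 𝒯 k, ⨆ σ' ∈ 𝒯' k', ‖Φ (σ • σ' • c)‖ₑ ^ τ) ^ (1 / τ) ≤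
      (C * C * (C' * C') * (n * n')) ^ (1 / τ) * (D * D') ^ (1 / θ) *
        (∑' j, ∑' j', ⨆ σ ∈ 𝒮 j, ⨆ σ' ∈ 𝒮' j', ‖Φ (σ • σ' • c)‖ₑ ^ θ) ^ (1 / θ) := by
  set S := ∑' j, ∑' j', ⨆ σ ∈ 𝒮 j, ⨆ σ' ∈ 𝒮' j', ‖Φ (σ • σ' • c)‖ₑ ^ θ
  have e (i i') : ‖Φ (A i • A' i' • c)‖ₑ ^ τ ≤ ((D * D' * S) ^ (1 / θ)) ^ τ := by
    refine ENNReal.rpow_le_rpow ?_ hτ.le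
    rw [one_div, ENNReal.le_rpow_inv_iff hθ]
    exact g.le_tsum_tsum g' i i' c
  calc _ ≤ (C * C * (C' * C') * ∑ i : Fin n, ∑ i' : Fin n', ((D * D' * S) ^ (1 / θ)) ^ τ) ^ (1 / τ) := by
        gcongr
        refine (h.tsum_tsum_le h' c).trans ?_
        exact mul_le_mul_right (Finset.sum_le_sum fun i _ => Finset.sum_le_sum fun i' _ => e i i') _
    _ = (C * C * (C' * C') * (n * n')) ^ (1 / τ) * (((D * D' * S) ^ (1 / θ)) ^ τ) ^ (1 / τ) := by
        rw [← ENNReal.mul_rpow_of_nonneg _ _ (one_div_nonneg.2 hτ.le)]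
        simp only [Finset.sum_const, Finset.card_univ, Fintype.card_fin, nsmul_eq_mul]
        congr 1
        ring
    _ = _ := by
        rw [← ENNReal.rpow_mul, mul_one_div_cancel hτ.ne', ENNReal.rpow_one,
          ENNReal.mul_rpow_of_nonneg (D * D') S (by positivity), ← mul_assoc]

end Estimates

/-! ### Upper estimates for the two families of differences -/

section Upper

variable {ι E : Type*} [NormedAddCommGroup E] [NormedSpace ℂ E] [CompleteSpace E]
  {Φ : (ι →₀ ℂ) →ₗ[ℂ] E} {κ : ι → ℝ}

/-- Symbols of normalized differences of order `γ` of fractional integrals, with steps at most `t`. -/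
def normFam (γ s : ℝ) (κ : ι → ℝ) (t : ℝ) : Set (ι → ℂ) :=
  {σ | ∃ h, |h| ≤ t ∧ σ = fun m => dnorm γ s t h (κ m)}

/-- Symbols of weighted differences of order `β`, with steps at most `2^k δ`. -/
def diffFam (β ε : ℝ) (κ : ι → ℝ) (δ : ℝ) (k : ℕ) : Set (ι → ℂ) :=
  {σ | ∃ h, |h| ≤ 2 ^ k * δ ∧ σ = fun m => ((2 : ℝ) ^ (-(k * ε)) : ℝ) * dsym β (h * κ m)}

/-- High and low frequency symbols adapted to `normFam`. -/
def normSym (γ s : ℝ) (κ : ι → ℝ) (δ : ℝ) : Fin 3 → ι → ℂ :=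
  ![fun m => 1 - chi (2 * (δ * κ m)), fun m => chi (δ * κ m) * qsym 1 γ s (δ * κ m),
    fun m => chi (δ * κ m) * qsym (-1) γ s (δ * κ m)]

/-- High and low frequency symbols adapted to `diffFam`. -/
def diffSym (ε : ℝ) (κ : ι → ℝ) (δ : ℝ) : Fin 2 → ι → ℂ :=
  ![fun m => 1 - chi (2 * (δ * κ m)), fun m => chi (δ * κ m / 2) * ipow ε (δ * κ m)]

lemma exists_nat_forall_support (c : ι →₀ ℂ) {P : ι → ℕ → Prop}
    (h : ∀ m, ∀ᶠ N in Filter.atTop, P m N) : ∃ N, ∀ m ∈ c.support, P m N :=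
  ((Filter.eventually_all_finset c.support).2 fun m _ => h m).exists

lemma eventually_abs_div_le (x : ℝ) {b : ℝ} (hb : 0 < b) :
    ∀ᶠ N : ℕ in Filter.atTop, |x / 2 ^ N| ≤ b := by
  have h : Filter.Tendsto (fun N : ℕ => |x / 2 ^ N|) Filter.atTop (nhds 0) := by
    have h1 := (tendsto_pow_atTop_nhds_zero_of_lt_one (r := (1/2 : ℝ)) (by norm_num)
      (by norm_num)).const_mul x
    rw [mul_zero] at h1
    have := h1.abs
    rw [abs_zero] at this
    refine this.congr fun N => ?_
    rw [one_div, inv_pow, div_eq_mul_inv]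
  exact h.eventually_le_const hb

lemma eventually_le_abs_mul {x : ℝ} (hx : x ≠ 0) (b : ℝ) :
    ∀ᶠ N : ℕ in Filter.atTop, b ≤ |2 ^ N * x| := by
  have h : Filter.Tendsto (fun N : ℕ => |2 ^ N * x|) Filter.atTop Filter.atTop := by
    have := (tendsto_pow_atTop_atTop_of_one_lt (r := (2:ℝ)) one_lt_two).atTop_mul_const
      (abs_pos.2 hx)
    refine this.congr fun N => ?_
    rw [abs_mul, abs_pow, abs_two]
  exact h.eventually_ge_atTop b

lemma div_two_pow_reflect (δ x : ℝ) {N j : ℕ} (hj : j < N) :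
    δ * x / 2 ^ j = δ / 2 ^ (N - 1) * 2 ^ (N - 1 - j) * x := by
  have : (2:ℝ) ^ (N - 1) = 2 ^ (N - 1 - j) * 2 ^ j := by rw [← pow_add]; congr 1; omega
  rw [this]; field_simp

lemma IsBand.tsum_norm_down_le (hκ : ModulationInvariant Φ κ) {τ : ℝ}
    (hE : TwoPointConvex E τ) (hτ : 0 ≤ τ) {b : ℝ} (hb : b < π) {ζ : ℝ → ℂ} (hζ : IsBand b ζ) :
    ∃ C : ℝ≥0∞, C ≠ ⊤ ∧ ∀ (δ : ℝ) (c : ι →₀ ℂ),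
      ∑' j : ℕ, ‖Φ ((fun m => ζ (δ * κ m / 2 ^ j)) • c)‖ₑ ^ τ ≤ C * ‖Φ c‖ₑ ^ τ := by
  obtain ⟨C, hC, h⟩ := hζ.sum_norm_le hκ hE hτ hb
  refine ⟨C, hC, fun δ c => ENNReal.tsum_le_of_sum_range_le fun N => ?_⟩
  refine le_trans (le_of_eq ?_) (h (δ / 2 ^ (N - 1)) N c)
  rw [← Finset.sum_range_reflect _ N]
  refine Finset.sum_congr rfl fun j hj => ?_
  have hj' := Finset.mem_range.1 hj
  congr 4
  ext m
  rw [div_two_pow_reflect δ (κ m) (show N - 1 - j < N by omega)]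
  congr 4
  omega

lemma IsBand.norm_sum_down_le (hκ : ModulationInvariant Φ κ) {θ : ℝ}
    (hE : TwoPointSmooth E θ) (hθ : 1 ≤ θ) {b : ℝ} (hb : b < π) {ζ : ℝ → ℂ} (hζ : IsBand b ζ) :
    ∃ C : ℝ≥0∞, C ≠ ⊤ ∧ ∀ (δ : ℝ) (N : ℕ) (v : ℕ → ι →₀ ℂ),
      ‖Φ (∑ j ∈ Finset.range N, (fun m => ζ (δ * κ m / 2 ^ j)) • v j)‖ₑ ^ θ ≤
        C * ∑ j ∈ Finset.range N, ‖Φ (v j)‖ₑ ^ θ := by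
  obtain ⟨C, hC, h⟩ := hζ.norm_sum_le hκ hE hθ hb
  refine ⟨C, hC, fun δ N v => ?_⟩
  rw [← Finset.sum_range_reflect (fun j => ‖Φ (v j)‖ₑ ^ θ) N]
  refine le_trans (le_of_eq ?_) (h (δ / 2 ^ (N - 1)) N fun j => v (N - 1 - j))
  congr 3
  rw [← Finset.sum_range_reflect _ N]
  refine Finset.sum_congr rfl fun j hj => ?_
  have hj' := Finset.mem_range.1 hj
  congr 1
  ext m
  rw [div_two_pow_reflect δ (κ m) (show N - 1 - j < N by omega)]
  congr 4
  omega

lemma min_le_geomWeight {a b : ℝ} (ha : 0 < a) (hb : 0 < b) {k j : ℕ} {x L : ℝ}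
    (hx : |(k : ℝ) - j| ≤ |x| + L) :
    ENNReal.ofReal (min ((2:ℝ) ^ (x * a)) ((2:ℝ) ^ (-x * b))) ≤
      ENNReal.ofReal (2 ^ (L * min a b)) * geomWeight (min a b) k j := by
  rw [geomWeight, ← ENNReal.ofReal_mul (by positivity), ← rpow_add two_pos]
  refine ENNReal.ofReal_le_ofReal (min_rpow_le.trans ?_)
  refine rpow_le_rpow_of_exponent_le one_le_two ?_
  have : 0 < min a b := lt_min ha hb
  nlinarith

omit [CompleteSpace E] in
lemma MultBound.enorm_le {σ : ι → ℂ} {A : ℝ} (h : MultBound Φ σ A) (c : ι →₀ ℂ) :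
    ‖Φ (σ • c)‖ₑ ≤ ENNReal.ofReal A * ‖Φ c‖ₑ := by
  simpa using h.enorm_rpow_le zero_le_one c

lemma one_sub_chi_mul (x : ℝ) : (1 - chi x) * (1 - chi (2 * x)) = 1 - chi x := by
  rcases le_total (|x|) (1/4) with h | h
  · rw [chi_eq_one h]; simp
  · rw [chi_eq_zero (x := 2 * x) (by rw [abs_mul, abs_two]; linarith)]; simp

lemma psi_mul_one_sub_chi {x y : ℝ} (h : |x| ≤ |y|) : psi (x / 2) * (1 - chi (2 * y)) = psi (x / 2) := by
  rcases le_total (|y|) (1/4) with h' | h'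
  · rw [psi_eq_zero_of_le (by rw [abs_div, abs_two]; linarith), zero_mul]
  · rw [chi_eq_zero (x := 2 * y) (by rw [abs_mul, abs_two]; linarith)]; simp

theorem upperEst_normFam (hκ : ModulationInvariant Φ κ) (hκ0 : ∀ m, κ m ≠ 0) {τ : ℝ}
    (hE : TwoPointConvex E τ) (hτ : 1 ≤ τ) {γ s : ℝ} (hs : 0 < s) (hsγ : s < γ) :
    ∃ C : ℝ≥0∞, C ≠ ⊤ ∧ ∀ δ : ℝ, 0 < δ →
      UpperEst Φ τ C (fun k => normFam γ s κ (δ / 2 ^ k)) (normSym γ s κ δ) := by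
  have hτ0 : 0 ≤ τ := by linarith
  obtain ⟨D, hD, hLP⟩ := isBand_psi.tsum_norm_down_le hκ hE hτ0 (by linarith [pi_gt_three])
  obtain ⟨C₁, hC₁, h₁⟩ := multBound_dnorm_psiFat hκ hκ0 hs hsγ
  obtain ⟨C₂, hC₂, h₂⟩ := norm_dnorm_chi_le (Φ := Φ) hκ hκ0 hs hsγ
  have hd : 0 < γ - s := by linarith
  set ρ := min s (γ - s) with hρ
  have hρ0 : 0 < ρ := lt_min hs hd
  set C₀ : ℝ≥0∞ := ENNReal.ofReal (C₁ + C₂) * ENNReal.ofReal (2 ^ (1 * ρ))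
  obtain ⟨K, hK, hU⟩ := exists_upperEst (ι := ι) (E := E) hτ hρ0 C₀ (1 + D)
    (by finiteness) (by finiteness)
  refine ⟨K, hK, fun δ hδ => hU Φ _ _ _ (fun j => match j with
    | 0 => normSym γ s κ δ 1
    | 1 => normSym γ s κ δ 2
    | j + 2 => fun m => psi (δ / 2 * κ m / 2 ^ j)) ?_ ?_⟩
  · rintro k σ ⟨h, hh, rfl⟩ c
    have ht : 0 < δ / 2 ^ k := by positivity
    obtain ⟨N, hN⟩ := exists_nat_forall_support c
      (P := fun m N => |2 * (δ / 2 * κ m) / 2 ^ N| ≤ 1 / 4) fun m => eventually_abs_div_le _ (by norm_num)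
    set σ : ι → ℂ := fun m => dnorm γ s (δ / 2 ^ k) h (κ m)
    have hdec : σ • c = (fun m => σ m * chi (δ * κ m)) • c +
        ∑ j ∈ Finset.range N, (fun m => σ m * psiFat (δ / 2 / 2 ^ j * κ m)) •
          (fun m => psi (δ / 2 * κ m / 2 ^ j)) • c := by
      ext m
      simp only [Finsupp.add_apply, Finsupp.coe_finsetSum, Finset.sum_apply, symbol_smul_apply]
      by_cases hm : c m = 0
      · simp [hm]
      have hpp (j : ℕ) : σ m * psiFat (δ / 2 / 2 ^ j * κ m) * (psi (δ / 2 * κ m / 2 ^ j) * c m) =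
          psi (δ / 2 * κ m / 2 ^ j) * (σ m * c m) := by
        have := psiFat_mul_psi (δ / 2 * κ m / 2 ^ j)
        rw [show δ / 2 / 2 ^ j * κ m = δ / 2 * κ m / 2 ^ j by ring]
        linear_combination σ m * c m * this
      simp only [hpp]
      rw [← Finset.sum_mul, sum_psi_down, ← mul_div_assoc,
        chi_eq_one (hN m (Finsupp.mem_support_iff.2 hm)), show 2 * (δ / 2 * κ m) = δ * κ m by ring]
      ring
    obtain ⟨e, he, h2⟩ := h₂ (δ / 2 ^ k) δ h ht (div_le_self hδ.le (one_le_pow₀ one_le_two)) hh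
    have hrat : δ / 2 ^ k / δ = 2 ^ (-(k : ℝ)) := by
      rw [rpow_neg two_pos.le, rpow_natCast]; field_simp
    have hlow (j : ℕ) (hj : j ≤ 1) : ENNReal.ofReal (C₂ * (δ / 2 ^ k / δ) ^ (γ - s)) ≤
        C₀ * geomWeight ρ k j := by
      rw [ENNReal.ofReal_mul hC₂.le, mul_assoc]
      refine mul_le_mul' (ENNReal.ofReal_le_ofReal (by linarith)) ?_
      refine le_trans (ENNReal.ofReal_le_ofReal ?_) (min_le_geomWeight (x := k) hs hd ?_)
      · refine le_min ?_ ?_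
        · rw [hrat, ← rpow_mul two_pos.le]
          exact rpow_le_rpow_of_exponent_le one_le_two (by nlinarith [(Nat.cast_nonneg k : (0:ℝ) ≤ k)])
        · rw [hrat, ← rpow_mul two_pos.le]
      · rw [abs_of_nonneg (Nat.cast_nonneg k : (0:ℝ) ≤ k), abs_le]
        have : (j : ℝ) ≤ 1 := by exact_mod_cast hj
        constructor <;> linarith [(Nat.cast_nonneg k : (0:ℝ) ≤ k), (Nat.cast_nonneg j : (0:ℝ) ≤ j)]
    have h0 : ‖Φ ((fun m => σ m * chi (δ * κ m)) • c)‖ₑ ≤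
        C₀ * geomWeight ρ k 1 * ‖Φ (normSym γ s κ δ 2 • c)‖ₑ +
        C₀ * geomWeight ρ k 0 * ‖Φ (normSym γ s κ δ 1 • c)‖ₑ := by
      have h3 := h2 c
      have h4 : ‖Φ ((fun m => σ m * chi (δ * κ m)) • c)‖ₑ ≤ ENNReal.ofReal (C₂ * (δ / 2 ^ k / δ) ^ (γ - s)) *
          ‖Φ ((fun m => chi (δ * κ m) * qsym e γ s (δ * κ m)) • c)‖ₑ := by
        rw [← ofReal_norm, ← ofReal_norm, ← ENNReal.ofReal_mul (by positivity)]
        exact ENNReal.ofReal_le_ofReal h3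
      refine h4.trans ?_
      rcases he with rfl | rfl
      · exact (mul_le_mul_left (hlow 0 zero_le_one) _).trans le_add_self
      · exact (mul_le_mul_left (hlow 1 le_rfl) _).trans le_self_add
    have h1 (j : ℕ) : ‖Φ ((fun m => σ m * psiFat (δ / 2 / 2 ^ j * κ m)) •
          (fun m => psi (δ / 2 * κ m / 2 ^ j)) • c)‖ₑ ≤ C₀ * geomWeight ρ k (j + 1 + 1) *
          ‖Φ ((fun m => psi (δ / 2 * κ m / 2 ^ j)) • c)‖ₑ := by
      have hu : 0 < δ / 2 / 2 ^ j := by positivity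
      refine ((h₁ _ _ h ht hu hh).enorm_le _).trans (mul_le_mul_left ?_ _)
      rw [ENNReal.ofReal_mul hC₁.le, mul_assoc]
      refine mul_le_mul' (ENNReal.ofReal_le_ofReal (by linarith)) ?_
      have e1 : δ / 2 / 2 ^ j / (δ / 2 ^ k) = 2 ^ ((k : ℝ) - j - 1) := by
        rw [rpow_sub two_pos, rpow_sub two_pos, rpow_natCast, rpow_natCast, rpow_one]; field_simp
      have e2 : δ / 2 ^ k / (δ / 2 / 2 ^ j) = 2 ^ (-((k : ℝ) - j - 1)) := by
        rw [rpow_neg two_pos.le, ← e1, inv_div]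
      rw [e1, e2, ← rpow_mul two_pos.le, ← rpow_mul two_pos.le]
      refine min_le_geomWeight hs hd ?_
      push_cast
      rw [show (k : ℝ) - (j + 1 + 1) = (k - j - 1) + (-1) by ring]
      exact (abs_add_le _ _).trans (by simp)
    refine le_trans ?_ (ENNReal.sum_le_tsum (Finset.range (N + 1 + 1)))
    rw [Finset.sum_range_succ', Finset.sum_range_succ', hdec, map_add, map_sum, add_assoc, add_comm (Φ _)]
    refine (enorm_add_le _ _).trans ?_
    refine add_le_add ?_ h0
    refine (enorm_sum_le _ _).trans (Finset.sum_le_sum fun j _ => h1 j)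
  · intro c
    rw [tsum_eq_zero_add' ENNReal.summable, tsum_eq_zero_add' ENNReal.summable]
    rw [Fin.sum_univ_three]
    have h3 : ∑' j : ℕ, ‖Φ ((fun m => psi (δ / 2 * κ m / 2 ^ j)) • c)‖ₑ ^ τ ≤
        D * ‖Φ (normSym γ s κ δ 0 • c)‖ₑ ^ τ := by
      refine le_trans (le_of_eq (tsum_congr fun j => ?_)) (hLP (δ / 2) _)
      congr 3
      ext m
      simp only [symbol_smul_apply, normSym, Matrix.cons_val_zero]
      rw [← mul_assoc, show δ / 2 * κ m / 2 ^ j = (δ * κ m / 2 ^ j) / 2 by ring,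
        psi_mul_one_sub_chi]
      rw [abs_div, abs_of_pos (by positivity : (0:ℝ) < 2 ^ j)]
      exact div_le_self (abs_nonneg _) (one_le_pow₀ one_le_two)
    calc _ ≤ ‖Φ (normSym γ s κ δ 1 • c)‖ₑ ^ τ + (‖Φ (normSym γ s κ δ 2 • c)‖ₑ ^ τ +
          D * ‖Φ (normSym γ s κ δ 0 • c)‖ₑ ^ τ) := by
          gcongr
      _ ≤ _ := by
          set a := ‖Φ (normSym γ s κ δ 0 • c)‖ₑ ^ τ
          set b := ‖Φ (normSym γ s κ δ 1 • c)‖ₑ ^ τ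
          set d := ‖Φ (normSym γ s κ δ 2 • c)‖ₑ ^ τ
          have : (1 + D) * (a + b + d) = b + (d + D * a) + (a + D * b + D * d) := by ring
          rw [this]; exact le_self_add

end Upper

section Upper

variable {ι E : Type*} [NormedAddCommGroup E] [NormedSpace ℂ E] [CompleteSpace E]
  {Φ : (ι →₀ ℂ) →ₗ[ℂ] E} {κ : ι → ℝ}

lemma exists_multBound_one_sub_chi (hκ : ModulationInvariant Φ κ) :
    ∃ A : ℝ, 0 < A ∧ ∀ t : ℝ, MultBound Φ (fun m => 1 - chi (t * κ m)) A := by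
  obtain ⟨A, hA, h⟩ := isTest_chi.multBound hκ
  refine ⟨1 + ‖(-1 : ℂ)‖ * A, by positivity, fun t => ?_⟩
  exact (MultBound.one.add ((h t).const_mul (-1))).congr fun m => by ring

lemma two_rpow_mul_dsym (β ε : ℝ) {δ h x : ℝ} (hδ : 0 < δ) (hx : x ≠ 0) (k : ℕ) :
    ((2 : ℝ) ^ (-(k * ε)) : ℝ) * dsym β (h * x) =
      dnorm β ε (2 ^ k * δ) h x * ipow ε (δ * x) := by
  have h1 : ipow (-ε) x * ipow ε x = 1 := by
    rw [← ipow_add _ _ hx, neg_add_cancel, ipow, Complex.ofReal_zero, Complex.cpow_zero]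
  have h2 : ((2 ^ k * δ) ^ (-ε) * δ ^ ε : ℝ) = 2 ^ (-(k * ε)) := by
    rw [mul_rpow (by positivity) hδ.le, mul_assoc, ← rpow_add hδ, neg_add_cancel, rpow_zero,
      mul_one, ← rpow_natCast, ← rpow_mul two_pos.le]
    congr 1; ring
  rw [dnorm, ipow_mul _ hδ, ← h2]
  push_cast
  linear_combination (-1 : ℂ) * (((2 ^ k * δ) ^ (-ε) : ℝ) : ℂ) * ((δ ^ ε : ℝ) : ℂ) * dsym β (h * x) * h1

theorem upperEst_diffFam (hκ : ModulationInvariant Φ κ) (hκ0 : ∀ m, κ m ≠ 0) {τ : ℝ}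
    (hE : TwoPointConvex E τ) (hτ : 1 ≤ τ) {β ε : ℝ} (hε : 0 < ε) (hεβ : ε < β) :
    ∃ C : ℝ≥0∞, C ≠ ⊤ ∧ ∀ δ : ℝ, 0 < δ →
      UpperEst Φ τ C (diffFam β ε κ δ) (diffSym ε κ δ) := by
  have hτ0 : 0 ≤ τ := by linarith
  have hβ : 0 < β := hε.trans hεβ
  obtain ⟨D, hD, hLP⟩ := isBand_psi.sum_norm_le hκ hE hτ0 (by linarith [pi_gt_three])
  obtain ⟨C₁, hC₁, h₁⟩ := multBound_dnorm_psiFat hκ hκ0 hε hεβ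
  obtain ⟨C₂, hC₂, h₂⟩ := exists_multBound_one_sub_chi hκ
  have hd : 0 < β - ε := by linarith
  set ρ := min ε (β - ε) with hρ
  have hρ0 : 0 < ρ := lt_min hε hd
  set M := ∑' ν, |dcoef β ν|
  have hM : 0 ≤ M := tsum_nonneg fun _ => abs_nonneg _
  set C₀ : ℝ≥0∞ := ENNReal.ofReal (C₁ + M * C₂) * ENNReal.ofReal (2 ^ (1 * ρ))
  obtain ⟨K, hK, hU⟩ := exists_upperEst (ι := ι) (E := E) hτ hρ0 C₀ (1 + D)
    (by finiteness) (by finiteness)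
  refine ⟨K, hK, fun δ hδ => hU Φ _ _ _ (fun j => match j with
    | 0 => diffSym ε κ δ 0
    | j + 1 => fun m => psi (2 ^ j * (δ * κ m)) * ipow ε (δ * κ m)) ?_ ?_⟩
  · rintro k σ ⟨h, hh, rfl⟩ c
    have ht : 0 < 2 ^ k * δ := by positivity
    obtain ⟨N, hN⟩ := exists_nat_forall_support c
      (P := fun m N => 1 / 2 ≤ |2 ^ N * (δ * κ m)|) fun m => 
        eventually_le_abs_mul (mul_ne_zero hδ.ne' (hκ0 m)) _
    set σ : ι → ℂ := fun m => ((2 : ℝ) ^ (-(k * ε)) : ℝ) * dsym β (h * κ m)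
    have hdec : σ • c = ∑ j ∈ Finset.range N,
        (fun m => dnorm β ε (2 ^ k * δ) h (κ m) * psiFat (2 ^ j * δ * κ m)) •
          (fun m => psi (2 ^ j * (δ * κ m)) * ipow ε (δ * κ m)) • c +
        (fun m => σ m * (1 - chi (δ * κ m))) • diffSym ε κ δ 0 • c := by
      ext m
      simp only [Finsupp.add_apply, Finsupp.coe_finsetSum, Finset.sum_apply, symbol_smul_apply]
      by_cases hm : c m = 0
      · simp [hm]
      have hpp (j : ℕ) : dnorm β ε (2 ^ k * δ) h (κ m) * psiFat (2 ^ j * δ * κ m) *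
          (psi (2 ^ j * (δ * κ m)) * ipow ε (δ * κ m) * c m) =
          psi (2 ^ j * (δ * κ m)) * (σ m * c m) := by
        have := psiFat_mul_psi (2 ^ j * (δ * κ m))
        have hσm : σ m = _ := two_rpow_mul_dsym β ε hδ (hκ0 m) k
        rw [hσm, mul_assoc (2 ^ j)]
        linear_combination dnorm β ε (2 ^ k * δ) h (κ m) * ipow ε (δ * κ m) * c m * this
      simp only [hpp]
      rw [← Finset.sum_mul, sum_psi_up, chi_eq_zero (hN m (Finsupp.mem_support_iff.2 hm))]
      have := one_sub_chi_mul (δ * κ m)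
      simp only [diffSym, Matrix.cons_val_zero]
      linear_combination (-1 : ℂ) * σ m * c m * this
    have h0 : ‖Φ ((fun m => σ m * (1 - chi (δ * κ m))) • diffSym ε κ δ 0 • c)‖ₑ ≤
        C₀ * geomWeight ρ k 0 * ‖Φ (diffSym ε κ δ 0 • c)‖ₑ := by
      have := ((multBound_dsym hκ hβ h).const_mul (((2 : ℝ) ^ (-(k * ε)) : ℝ) : ℂ)).comp (h₂ δ)
      refine (this.enorm_le _).trans (mul_le_mul_left ?_ _)
      rw [Complex.norm_real, Real.norm_of_nonneg (by positivity), mul_assoc, mul_comm,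
        ENNReal.ofReal_mul (by positivity), mul_assoc]
      refine mul_le_mul' (ENNReal.ofReal_le_ofReal (by linarith)) ?_
      refine le_trans (ENNReal.ofReal_le_ofReal ?_) (min_le_geomWeight (x := -k) hε hd ?_)
      · refine le_min (le_of_eq (by congr 1; ring)) ?_
        exact rpow_le_rpow_of_exponent_le one_le_two (by nlinarith [(Nat.cast_nonneg k : (0:ℝ) ≤ k)])
      · simp
    have h1 (j : ℕ) : ‖Φ ((fun m => dnorm β ε (2 ^ k * δ) h (κ m) * psiFat (2 ^ j * δ * κ m)) •
          (fun m => psi (2 ^ j * (δ * κ m)) * ipow ε (δ * κ m)) • c)‖ₑ ≤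
          C₀ * geomWeight ρ k (j + 1) *
          ‖Φ ((fun m => psi (2 ^ j * (δ * κ m)) * ipow ε (δ * κ m)) • c)‖ₑ := by
      have hu : 0 < 2 ^ j * δ := by positivity
      refine ((h₁ _ _ h ht hu hh).enorm_le _).trans (mul_le_mul_left ?_ _)
      rw [ENNReal.ofReal_mul hC₁.le, mul_assoc]
      refine mul_le_mul' (ENNReal.ofReal_le_ofReal (by nlinarith)) ?_
      have e1 : 2 ^ j * δ / (2 ^ k * δ) = 2 ^ ((j : ℝ) - k) := by
        rw [rpow_sub two_pos, rpow_natCast, rpow_natCast]; field_simp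
      have e2 : 2 ^ k * δ / (2 ^ j * δ) = 2 ^ (-((j : ℝ) - k)) := by
        rw [rpow_neg two_pos.le, ← e1, inv_div]
      rw [e1, e2, ← rpow_mul two_pos.le, ← rpow_mul two_pos.le]
      refine min_le_geomWeight hε hd ?_
      push_cast
      rw [show (k : ℝ) - (j + 1) = -(j - k) + (-1) by ring]
      exact (abs_add_le _ _).trans (le_of_eq (by rw [abs_neg, abs_neg, abs_one]))
    refine le_trans ?_ (ENNReal.sum_le_tsum (Finset.range (N + 1)))
    rw [Finset.sum_range_succ', hdec, map_add, map_sum]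
    refine (enorm_add_le _ _).trans (add_le_add ?_ h0)
    refine (enorm_sum_le _ _).trans (Finset.sum_le_sum fun j _ => h1 j)
  · intro c
    rw [tsum_eq_zero_add' ENNReal.summable, Fin.sum_univ_two]
    have h3 : ∑' j : ℕ, ‖Φ ((fun m => psi (2 ^ j * (δ * κ m)) * ipow ε (δ * κ m)) • c)‖ₑ ^ τ ≤
        D * ‖Φ (diffSym ε κ δ 1 • c)‖ₑ ^ τ := by
      refine ENNReal.tsum_le_of_sum_range_le fun N => ?_
      refine le_trans (le_of_eq (Finset.sum_congr rfl fun j _ => ?_)) (hLP δ N _)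
      congr 3
      ext m
      simp only [symbol_smul_apply, diffSym, Matrix.cons_val_one, Matrix.cons_val_fin_one]
      have hc : psi (2 ^ j * (δ * κ m)) * chi (δ * κ m / 2) = psi (2 ^ j * (δ * κ m)) := by
        rcases le_total (1/2) (|δ * κ m|) with hx | hx
        · rw [psi_eq_zero_of_ge, zero_mul]
          rw [abs_mul, abs_pow, abs_two]
          exact hx.trans (le_mul_of_one_le_left (abs_nonneg _) (one_le_pow₀ one_le_two))
        · rw [chi_eq_one, mul_one]
          rw [abs_div, abs_two]; linarith
      rw [show δ * 2 ^ j * κ m = 2 ^ j * (δ * κ m) by ring]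
      linear_combination (-1 : ℂ) * ipow ε (δ * κ m) * c m * hc
    calc _ ≤ ‖Φ (diffSym ε κ δ 0 • c)‖ₑ ^ τ + D * ‖Φ (diffSym ε κ δ 1 • c)‖ₑ ^ τ := by
          gcongr
      _ ≤ _ := by
          set a := ‖Φ (diffSym ε κ δ 0 • c)‖ₑ ^ τ
          set b := ‖Φ (diffSym ε κ δ 1 • c)‖ₑ ^ τ
          have : (1 + D) * (a + b) = a + D * b + (b + D * a) := by ring
          rw [this]; exact le_self_add

end Upper

section Jackson

lemma hasSum_psi_down (x : ℝ) : HasSum (fun j : ℕ => psi (x / 2 ^ (j + 1))) (1 - chi x) := by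
  obtain ⟨N, hN⟩ := (eventually_abs_div_le x (by norm_num : (0 : ℝ) < 1 / 8)).exists_forall_of_atTop
  have h := sum_psi_down (x / 2) N
  rw [chi_eq_one (x := 2 * (x / 2 / 2 ^ N)), show 2 * (x / 2) = x by ring] at h
  · rw [← h]
    have e : ∀ j : ℕ, x / 2 / 2 ^ j = x / 2 ^ (j + 1) := fun j => by field_simp; ring
    simp only [e]
    refine hasSum_sum_of_ne_finset_zero fun j hj => psi_eq_zero_of_le (hN _ ?_)
    simp only [Finset.mem_range, not_lt] at hj
    omega
  · have := hN N le_rfl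
    rw [show 2 * (x / 2 / 2 ^ N) = x / 2 ^ N by ring]
    linarith

variable {ι E : Type*} [NormedAddCommGroup E] [NormedSpace ℂ E] [CompleteSpace E]
  {Φ : (ι →₀ ℂ) →ₗ[ℂ] E} {κ : ι → ℝ}

lemma exists_multBound_one_sub_chi_mul_inv (hκ : ModulationInvariant Φ κ) :
    ∃ A : ℝ, 0 < A ∧ ∀ t : ℝ,
      MultBound Φ (fun m => (1 - chi (t * κ m)) * (Complex.I * (t * κ m : ℝ))⁻¹) A := by
  have hband := isBand_psi.mul (g := fun x : ℝ => (Complex.I * (x : ℂ))⁻¹) fun x hx _ =>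
    ContDiffAt.inv (contDiffAt_const.mul Complex.ofRealCLM.contDiff.contDiffAt)
      (mul_ne_zero Complex.I_ne_zero (Complex.ofReal_ne_zero.2 hx))
  obtain ⟨A, hA, h⟩ := hband.isTest.multBound hκ
  have hs : Summable fun j : ℕ => (1 / 2 : ℝ) ^ (j + 1) * A :=
    ((summable_nat_add_iff 1).2 summable_geometric_two).mul_right A
  refine ⟨∑' j : ℕ, (1 / 2 : ℝ) ^ (j + 1) * A,
    hs.tsum_pos (fun j => by positivity) 0 (by positivity), fun t => ?_⟩
  refine MultBound.hasSum (fun m => (hasSum_psi_down (t * κ m)).mul_right _) (fun j => ?_) hs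
  have h1 := (h (t / 2 ^ (j + 1))).const_mul ((1 / 2 : ℝ) ^ (j + 1) : ℝ)
  rw [Complex.norm_real, norm_of_nonneg (by positivity)] at h1
  refine h1.congr fun m => ?_
  rw [show t / 2 ^ (j + 1) * κ m = t * κ m / 2 ^ (j + 1) by ring]
  have : (Complex.I * (t * κ m : ℝ))⁻¹ =
      ((1 / 2 : ℝ) ^ (j + 1) : ℝ) * (Complex.I * (t * κ m / 2 ^ (j + 1) : ℝ))⁻¹ := by
    push_cast
    rw [one_div, inv_pow, ← mul_inv]
    congr 1
    field_simp
  rw [this]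
  ring

lemma continuous_dsym {γ : ℝ} (hγ : 0 < γ) : Continuous (dsym γ) := by
  refine continuous_tsum (fun ν => by fun_prop) (summable_abs_dcoef hγ) fun ν x => ?_
  simp [Complex.norm_exp_ofReal_mul_I, -Complex.ofReal_mul]

/-- The average of `e^{-iγh} dsym γ h` over steps `h` between `0` and `x`. -/
def dmean (γ x : ℝ) : ℂ :=
  ∫ y in Set.Ioc (0 : ℝ) 1, Complex.exp ((-(γ * y * x) : ℝ) * Complex.I) * dsym γ (y * x)

lemma integrableOn_dmean {γ : ℝ} (hγ : 0 < γ) (x : ℝ) : IntegrableOn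
    (fun y : ℝ => Complex.exp ((-(γ * y * x) : ℝ) * Complex.I) * dsym γ (y * x))
      (Set.Ioc (0 : ℝ) 1) := by
  refine Continuous.integrableOn_Ioc ?_
  have := continuous_dsym hγ
  fun_prop

lemma hasSum_dmean_sub_one {γ : ℝ} (hγ : 0 < γ) {x : ℝ} (hx : x ≠ 0) :
    HasSum (fun ν : ℕ => ((dcoef γ (ν + 1) / (ν + 1) : ℝ) : ℂ) *
      ((1 - Complex.exp ((-(ν + 1) * x : ℝ) * Complex.I)) * (Complex.I * x)⁻¹))
      (dmean γ x - 1) := by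
  have key : HasSum (fun ν : ℕ => ∫ y in Set.Ioc (0 : ℝ) 1,
      (dcoef γ ν : ℂ) * Complex.exp ((-ν * x : ℂ) * Complex.I * y)) (dmean γ x) := by
    refine hasSum_integral_of_dominated_convergence (fun ν _ => |dcoef γ ν|) (fun ν => ?_)
      (fun ν => ?_) ?_ ?_ ?_
    · exact Continuous.aestronglyMeasurable (by fun_prop)
    · refine .of_forall fun y => ?_
      rw [norm_mul, show (-ν * x : ℂ) * Complex.I * y = (-ν * x * y : ℝ) * Complex.I by push_cast; ring,
        Complex.norm_exp_ofReal_mul_I]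
      simp
    · exact .of_forall fun _ => summable_abs_dcoef hγ
    · exact integrable_const _
    · refine .of_forall fun y => ?_
      convert! (summable_dsym hγ (y * x)).hasSum.mul_left
        (Complex.exp ((-(γ * y * x) : ℝ) * Complex.I)) using 2 with ν
      rw [mul_left_comm, ← Complex.exp_add]
      congr 2
      push_cast; ring
  rw [← hasSum_nat_add_iff' 1] at key
  convert! key using 1
  · ext ν
    rw [← intervalIntegral.integral_of_le zero_le_one, intervalIntegral.integral_const_mul,
      integral_exp_mul_complex (mul_ne_zero (mul_ne_zero (by push_cast; exact neg_ne_zero.2 (Nat.cast_add_one_ne_zero ν)) (by simpa using hx))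
        Complex.I_ne_zero)]
    have h1 : ((ν : ℂ) + 1) ≠ 0 := Nat.cast_add_one_ne_zero ν
    have h2 : (x : ℂ) ≠ 0 := by simpa using hx
    push_cast
    rw [mul_zero, Complex.exp_zero, mul_one]
    field_simp
    ring
  · simp [dcoef_zero]

lemma exists_multBound_dmean_sub_one (hκ : ModulationInvariant Φ κ) (hκ0 : ∀ m, κ m ≠ 0) {γ : ℝ}
    (hγ : 0 < γ) : ∃ A : ℝ, 0 < A ∧ ∀ t a : ℝ, 0 < t → 0 < a →
      MultBound Φ (fun m => (dmean γ (t * κ m) - 1) * (1 - chi (a * (t * κ m)))) (A * a) := by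
  obtain ⟨A, hA, h⟩ := exists_multBound_one_sub_chi_mul_inv hκ
  have hs := (summable_nat_add_iff 1).2 (summable_abs_dcoef hγ)
  refine ⟨(∑' ν, |dcoef γ (ν + 1)|) * (2 * A) + 1, ?_, fun t a ht ha => ?_⟩
  · have : 0 ≤ ∑' ν, |dcoef γ (ν + 1)| := tsum_nonneg fun _ => abs_nonneg _
    positivity
  have h1 : MultBound Φ (fun m => (dmean γ (t * κ m) - 1) * (1 - chi (a * (t * κ m))))
      (∑' ν, |dcoef γ (ν + 1)| * ((1 + 1) * A * a)) := by
    refine MultBound.hasSum (fun m =>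
      (hasSum_dmean_sub_one hγ (mul_ne_zero ht.ne' (hκ0 m))).mul_right _) (fun ν => ?_)
      (hs.mul_right _)
    have hexp := MultBound.one.add ((hκ.multBound (-(ν + 1) * t)).const_mul (-1))
    rw [norm_neg, norm_one, one_mul] at hexp
    have h2 := (hexp.comp ((h (a * t)).const_mul a)).const_mul
      ((dcoef γ (ν + 1) / (ν + 1) : ℝ) : ℂ)
    refine (h2.congr fun m => ?_).mono ?_
    · rw [show -((ν : ℝ) + 1) * t * κ m = -((ν : ℝ) + 1) * (t * κ m) by ring,
        show a * t * κ m = a * (t * κ m) by ring]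
      have ha' : (a : ℂ) ≠ 0 := by exact_mod_cast ha.ne'
      have hx : ((t * κ m : ℝ) : ℂ) ≠ 0 := by exact_mod_cast mul_ne_zero ht.ne' (hκ0 m)
      rw [Complex.ofReal_mul a]
      field_simp
      ring
    · rw [Complex.norm_real, Complex.norm_real, norm_eq_abs, norm_eq_abs, abs_of_pos ha, abs_div,
        abs_of_pos (by positivity : (0 : ℝ) < ν + 1)]
      have : |dcoef γ (ν + 1)| / ((ν : ℝ) + 1) ≤ |dcoef γ (ν + 1)| :=
        div_le_self (abs_nonneg _) (by linarith [(Nat.cast_nonneg ν : (0 : ℝ) ≤ ν)])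
      calc _ ≤ |dcoef γ (ν + 1)| * ((1 + 1) * (a * A)) := by gcongr
        _ = _ := by ring
  refine h1.mono ?_
  rw [tsum_mul_right]
  nlinarith

lemma norm_dmean_smul_le (hκ : ModulationInvariant Φ κ) {γ : ℝ} (hγ : 0 < γ) {δ S : ℝ} (hδ : 0 ≤ δ)
    {c : ι →₀ ℂ} (h : ∀ h : ℝ, |h| ≤ δ → ‖Φ ((fun m => dsym γ (h * κ m)) • c)‖ ≤ S) :
    ‖Φ ((fun m => dmean γ (δ * κ m)) • c)‖ ≤ S := by
  simp only [dmean]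
  rw [map_integral_symbol fun m => integrableOn_dmean hγ _]
  refine (norm_setIntegral_le_of_norm_le_const (C := S) (by simp) fun y hy => ?_).trans ?_
  · rw [← hκ (γ * y * δ)]
    refine le_trans (le_of_eq ?_) (h (y * δ) ?_)
    · congr 2
      ext m
      simp only [symbol_smul_apply]
      rw [← mul_assoc, ← mul_assoc, ← Complex.exp_add, ← add_mul, ← Complex.ofReal_add,
        show γ * y * δ * κ m + -(γ * y * (δ * κ m)) = 0 by ring]
      simp [mul_assoc]
    · rw [abs_of_nonneg (mul_nonneg hy.1.le hδ)]
      exact mul_le_of_le_one_left hδ hy.2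
  · simp

lemma exists_norm_one_sub_chi_le (hκ : ModulationInvariant Φ κ) (hκ0 : ∀ m, κ m ≠ 0) {γ : ℝ}
    (hγ : 0 < γ) : ∃ a C : ℝ, 0 < a ∧ a ≤ 1 ∧ 0 < C ∧ ∀ (δ S : ℝ) (c : ι →₀ ℂ), 0 < δ →
      (∀ h : ℝ, |h| ≤ δ → ‖Φ ((fun m => dsym γ (h * κ m)) • c)‖ ≤ S) →
        ‖Φ ((fun m => 1 - chi (a * (δ * κ m))) • c)‖ ≤ C * S := by
  obtain ⟨A, hA, hJ⟩ := exists_multBound_dmean_sub_one hκ hκ0 hγ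
  obtain ⟨B, hB, hχ⟩ := exists_multBound_one_sub_chi hκ
  set a := min 1 ((4 * A)⁻¹)
  have ha : 0 < a := lt_min one_pos (by positivity)
  refine ⟨a, 2 * B, ha, min_le_left _ _, by positivity, fun δ S c hδ hc => ?_⟩
  set u := (fun m => 1 - chi (a * (δ * κ m))) • c with hu
  have h1 : ‖Φ ((fun m => dmean γ (δ * κ m)) • u)‖ ≤ B * S := by
    refine norm_dmean_smul_le hκ hγ hδ.le fun h hh => ?_
    refine le_trans (le_of_eq ?_) (((hχ (a * δ)).2 _).trans
      (mul_le_mul_of_nonneg_left (hc h hh) hB.le))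
    congr 2
    ext m
    simp only [hu, symbol_smul_apply, mul_assoc]
    ring
  have h2 := (hJ δ (2 * a) hδ (by positivity)).2 u
  have h3 : Φ u = Φ ((fun m => dmean γ (δ * κ m)) • u) -
      Φ ((fun m => (dmean γ (δ * κ m) - 1) * (1 - chi (2 * a * (δ * κ m)))) • u) := by
    rw [← map_sub]
    congr 1
    ext m
    simp only [hu, Finsupp.sub_apply, symbol_smul_apply]
    have := one_sub_chi_mul (a * (δ * κ m))
    rw [← mul_assoc 2] at this
    linear_combination (dmean γ (δ * κ m) - 1) * c m * this
  have h4 : A * (2 * a) ≤ 1 / 2 := by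
    have h : a ≤ (4 * A)⁻¹ := min_le_right _ _
    calc A * (2 * a) ≤ A * (2 * (4 * A)⁻¹) := by gcongr
      _ = 1 / 2 := by field_simp; norm_num
  have h5 := norm_sub_le (Φ ((fun m => dmean γ (δ * κ m)) • u))
    (Φ ((fun m => (dmean γ (δ * κ m) - 1) * (1 - chi (2 * a * (δ * κ m)))) • u))
  rw [← h3] at h5
  have h6 := h2.trans (mul_le_mul_of_nonneg_right h4 (norm_nonneg _))
  linarith

/-- The high frequencies of a function are controlled by its modulus of smoothness. -/
theorem exists_norm_one_sub_chi_two_le (hκ : ModulationInvariant Φ κ) (hκ0 : ∀ m, κ m ≠ 0) {γ : ℝ}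
    (hγ : 0 < γ) : ∃ C : ℝ, 0 < C ∧ ∀ (δ S : ℝ) (c : ι →₀ ℂ), 0 < δ →
      (∀ h : ℝ, |h| ≤ δ → ‖Φ ((fun m => dsym γ (h * κ m)) • c)‖ ≤ S) →
        ‖Φ ((fun m => 1 - chi (2 * (δ * κ m))) • c)‖ ≤ C * S := by
  obtain ⟨a, C, ha, ha1, hC, hJ⟩ := exists_norm_one_sub_chi_le hκ hκ0 hγ
  have hband : IsBand (1 / 2) (fun x => chi x - chi (2 / a * x)) := by
    have h2a : 0 < 2 / a := by positivity
    have h2a' : 2 ≤ 2 / a := by rw [le_div_iff₀ ha]; linarith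
    refine ⟨isTest_chi.sub (isTest_chi.comp_mul h2a.ne'), ⟨a / 8, by positivity, fun x hx => ?_⟩,
      fun x hx => ?_⟩
    · have : |2 / a * x| ≤ 1 / 4 := by
        rw [abs_mul, abs_of_pos h2a, div_mul_eq_mul_div, div_le_iff₀ ha]; linarith
      simp only [chi_eq_one (x := x) (by linarith), chi_eq_one this, sub_self]
    · have : 1 / 2 ≤ |2 / a * x| := by
        rw [abs_mul, abs_of_pos h2a]; nlinarith [abs_nonneg x]
      simp only [chi_eq_zero hx.le, chi_eq_zero this, sub_self]
  have hπ := pi_gt_three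
  have hquot := hband.mul (g := fun x => (ipow γ x * dquot γ x)⁻¹) fun x hx hx2 =>
    ((contDiffAt_ipow γ hx).mul (contDiffAt_dquot γ (by linarith))).inv
      (mul_ne_zero (ipow_ne_zero γ hx) (dquot_ne_zero γ (by linarith)))
  obtain ⟨B, hB, hm⟩ := hquot.isTest.multBound hκ
  refine ⟨B + C, by positivity, fun δ S c hδ hc => ?_⟩
  have hdec : (fun m => 1 - chi (2 * (δ * κ m))) • c =
      (fun m => (fun x => (chi x - chi (2 / a * x)) * (ipow γ x * dquot γ x)⁻¹) (a * δ * κ m)) •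
        (fun m => dsym γ (a * δ * κ m)) • c + (fun m => 1 - chi (a * (δ * κ m))) • c := by
    ext m
    simp only [Finsupp.add_apply, symbol_smul_apply]
    have h0 : a * δ * κ m ≠ 0 := mul_ne_zero (by positivity) (hκ0 m)
    rw [show 2 * (δ * κ m) = 2 / a * (a * δ * κ m) by field_simp,
      show a * (δ * κ m) = a * δ * κ m by ring]
    set x := a * δ * κ m
    rcases le_or_gt (|x|) (1 / 2) with hx | hx
    · rw [dsym_eq hγ h0 (by linarith)]
      have h1 := inv_mul_cancel₀
        (mul_ne_zero (ipow_ne_zero γ h0) (dquot_ne_zero γ (x := x) (by linarith)))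
      linear_combination (-(chi x - chi (2 / a * x)) * c m) * h1
    · have : chi x - chi (2 / a * x) = 0 := hband.high x hx
      linear_combination (1 - (ipow γ x * dquot γ x)⁻¹ * dsym γ x) * c m * this
  rw [hdec, map_add]
  refine (norm_add_le _ _).trans ?_
  rw [add_mul]
  refine add_le_add (((hm _).2 _).trans (mul_le_mul_of_nonneg_left (hc _ ?_) hB.le)) (hJ δ S c hδ hc)
  rw [abs_of_pos (by positivity)]
  exact mul_le_of_le_one_left hδ.le ha1

end Jackson

/-! ### Lower estimates for the two families of differences -/

section Lower

variable {ι E : Type*} [NormedAddCommGroup E] [NormedSpace ℂ E] [CompleteSpace E]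
  {Φ : (ι →₀ ℂ) →ₗ[ℂ] E} {κ : ι → ℝ}

/-- The part of `diffFam` with steps less than `1/2`. -/
def diffFamCut (β ε : ℝ) (κ : ι → ℝ) (δ : ℝ) (k : ℕ) : Set (ι → ℂ) :=
  {σ | 2 ^ k * δ < 1 / 2 ∧ σ ∈ diffFam β ε κ δ k}

lemma exists_one_sub_chi_two_rpow_le (hκ : ModulationInvariant Φ κ) (hκ0 : ∀ m, κ m ≠ 0) {β θ : ℝ}
    (hβ : 0 < β) (hθ : 0 < θ) (ε : ℝ) : ∃ C : ℝ≥0∞, C ≠ ⊤ ∧ ∀ (δ : ℝ) (c : ι →₀ ℂ), 0 < δ →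
      δ < 1 / 2 → ‖Φ ((fun m => 1 - chi (2 * (δ * κ m))) • c)‖ₑ ^ θ ≤
        C * ⨆ σ ∈ diffFamCut β ε κ δ 0, ‖Φ (σ • c)‖ₑ ^ θ := by
  obtain ⟨C, hC, hJ⟩ := exists_norm_one_sub_chi_two_le hκ hκ0 hβ
  refine ⟨ENNReal.ofReal C ^ θ, by finiteness, fun δ c hδ hδ2 => ?_⟩
  set M := ⨆ σ ∈ diffFamCut β ε κ δ 0, ‖Φ (σ • c)‖ₑ ^ θ
  by_cases hM : M = ⊤
  · rw [hM, ENNReal.mul_top (by simp [hC])]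
    exact le_top
  have h := hJ δ (M ^ (1 / θ)).toReal c hδ fun h hh => ?_
  · rw [← ofReal_norm]
    refine (ENNReal.rpow_le_rpow (ENNReal.ofReal_le_ofReal h) hθ.le).trans ?_
    rw [ENNReal.ofReal_mul hC.le, ENNReal.mul_rpow_of_nonneg _ _ hθ.le,
      ENNReal.ofReal_toReal (by finiteness), ← ENNReal.rpow_mul, one_div_mul_cancel hθ.ne',
      ENNReal.rpow_one]
  · rw [← toReal_enorm]
    refine ENNReal.toReal_mono (by finiteness) ?_
    rw [one_div, ENNReal.le_rpow_inv_iff hθ]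
    refine le_iSup₂_of_le (fun m => dsym β (h * κ m)) ⟨by simpa using hδ2, h, by simpa using hh, ?_⟩
      le_rfl
    simp

lemma exists_chi_mul_qsym_rpow_le (hκ : ModulationInvariant Φ κ) (hκ1 : ∀ m, 1 ≤ |κ m|) {θ : ℝ}
    (hE : TwoPointSmooth E θ) (hθ : 1 ≤ θ) {β : ℝ} (hβ : 0 < β) (γ s : ℝ) {e : ℝ} (he : e ≠ 0) :
    ∃ C : ℝ≥0∞, C ≠ ⊤ ∧ ∀ (δ : ℝ) (c : ι →₀ ℂ), 0 < δ →
      ‖Φ ((fun m => chi (δ * κ m) * qsym e γ s (δ * κ m)) • c)‖ₑ ^ θ ≤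
        C * ∑' j, ⨆ σ ∈ diffFamCut β (γ - s) κ δ j, ‖Φ (σ • c)‖ₑ ^ θ := by
  have hπ := pi_gt_three
  have hκ0 : ∀ m, κ m ≠ 0 := fun m => abs_pos.1 (by linarith [hκ1 m])
  have hband := isBand_psi.mul (g := fun x => qsym e γ s x * (ipow β x * dquot β x)⁻¹) fun x hx hx2 =>
    (contDiffAt_qsym he γ s hx).mul (((contDiffAt_ipow β hx).mul
      (contDiffAt_dquot β (by linarith))).inv
        (mul_ne_zero (ipow_ne_zero β hx) (dquot_ne_zero β (by linarith))))
  obtain ⟨C, hC, h⟩ := hband.norm_sum_le hκ hE hθ (by linarith)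
  refine ⟨C, hC, fun δ c hδ => ?_⟩
  obtain ⟨N, hN⟩ := exists_nat_forall_support c
    (P := fun m N => 1 / 2 ≤ |2 ^ N * (δ * κ m)|) fun m =>
      eventually_le_abs_mul (mul_ne_zero hδ.ne' (hκ0 m)) _
  set v : ℕ → ι →₀ ℂ := fun j => if 2 ^ j * δ < 1 / 2 then
    (fun m => ((2 : ℝ) ^ (-(j * (γ - s))) : ℝ) * dsym β (2 ^ j * δ * κ m)) • c else 0 with hv
  have hdec : (fun m => chi (δ * κ m) * qsym e γ s (δ * κ m)) • c =
      ∑ j ∈ Finset.range N, (fun m => (fun x => psi x *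
        (qsym e γ s x * (ipow β x * dquot β x)⁻¹)) (δ * 2 ^ j * κ m)) • v j := by
    ext m
    rw [Finsupp.finsetSum_apply]
    simp only [symbol_smul_apply]
    by_cases hm : c m = 0
    · rw [hm, mul_zero, Finset.sum_eq_zero fun j _ => ?_]
      rw [hv]
      dsimp only
      split_ifs <;> simp [symbol_smul_apply, hm]
    have h1 := sum_psi_up (δ * κ m) N
    rw [chi_eq_zero (hN m (Finsupp.mem_support_iff.2 hm)), sub_zero] at h1
    rw [← h1, Finset.sum_mul, Finset.sum_mul]
    refine Finset.sum_congr rfl fun j _ => ?_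
    have h0 : δ * 2 ^ j * κ m ≠ 0 := mul_ne_zero (by positivity) (hκ0 m)
    have hq := qsym_mul e γ s (u := 2 ^ j) (by positivity) (δ * κ m)
    rw [show 2 ^ j * (δ * κ m) = δ * 2 ^ j * κ m by ring] at hq ⊢
    rw [hv]
    dsimp only
    split_ifs with hj
    · rw [symbol_smul_apply, show 2 ^ j * δ * κ m = δ * 2 ^ j * κ m by ring]
      rcases le_or_gt (1 / 2) (|δ * 2 ^ j * κ m|) with hx | hx
      · rw [psi_eq_zero_of_ge hx]; ring
      · rw [hq, dsym_eq hβ h0 (by linarith)]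
        have h2 := inv_mul_cancel₀ (mul_ne_zero (ipow_ne_zero β h0)
          (dquot_ne_zero β (x := δ * 2 ^ j * κ m) (by linarith)))
        have h3 : ((((2 : ℝ) ^ j) ^ (γ - s) : ℝ) : ℂ) * ((2 : ℝ) ^ (-(j * (γ - s))) : ℝ) = 1 := by
          rw [← Complex.ofReal_mul, ← rpow_natCast, ← rpow_mul two_pos.le, ← rpow_add two_pos,
            add_neg_cancel, rpow_zero, Complex.ofReal_one]
        set y := δ * 2 ^ j * κ m
        generalize (ipow β y * dquot β y)⁻¹ = w at *
        generalize ((((2 : ℝ) ^ j) ^ (γ - s) : ℝ) : ℂ) = w1 at *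
        generalize (((2 : ℝ) ^ (-(j * (γ - s))) : ℝ) : ℂ) = w2 at *
        linear_combination (-(psi y * qsym e γ s (δ * κ m) * c m)) * h3 -
          psi y * qsym e γ s (δ * κ m) * c m * w1 * w2 * h2
    · rw [psi_eq_zero_of_ge]
      · simp
      · rw [abs_mul, abs_of_pos (by positivity)]
        nlinarith [hκ1 m]
  rw [hdec]
  refine (h δ N v).trans (mul_le_mul_right (le_trans (Finset.sum_le_sum fun j _ => ?_)
    (ENNReal.sum_le_tsum (Finset.range N))) _)
  rw [hv]
  dsimp only
  split_ifs with hj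
  · exact le_iSup₂_of_le _ ⟨hj, 2 ^ j * δ, by rw [abs_of_pos (by positivity)], rfl⟩ le_rfl
  · rw [map_zero, enorm_zero, ENNReal.zero_rpow_of_pos (by linarith)]
    exact zero_le

theorem lowerEst_normSym (hκ : ModulationInvariant Φ κ) (hκ1 : ∀ m, 1 ≤ |κ m|) {θ : ℝ}
    (hE : TwoPointSmooth E θ) (hθ : 1 ≤ θ) {β : ℝ} (hβ : 0 < β) (γ s : ℝ) :
    ∃ C : ℝ≥0∞, C ≠ ⊤ ∧ ∀ δ : ℝ, 0 < δ → δ < 1 / 2 →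
      LowerEst Φ θ C (diffFamCut β (γ - s) κ δ) (normSym γ s κ δ) := by
  have hκ0 : ∀ m, κ m ≠ 0 := fun m => abs_pos.1 (by linarith [hκ1 m])
  obtain ⟨C₀, hC₀, h₀⟩ := exists_one_sub_chi_two_rpow_le hκ hκ0 hβ (one_pos.trans_le hθ) (γ - s)
  obtain ⟨C₁, hC₁, h₁⟩ := exists_chi_mul_qsym_rpow_le hκ hκ1 hE hθ hβ γ s one_ne_zero
  obtain ⟨C₂, hC₂, h₂⟩ := exists_chi_mul_qsym_rpow_le hκ hκ1 hE hθ hβ γ s (neg_ne_zero.2 one_ne_zero)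
  refine ⟨C₀ + C₁ + C₂, by finiteness, fun δ hδ hδ2 i c => ?_⟩
  fin_cases i
  · refine (h₀ δ c hδ hδ2).trans ((mul_le_mul_right (ENNReal.le_tsum 0) _).trans
      (mul_le_mul_left ?_ _))
    rw [add_assoc]
    exact le_self_add
  · refine (h₁ δ c hδ).trans (mul_le_mul_left ?_ _)
    rw [add_right_comm]
    exact le_add_self
  · exact (h₂ δ c hδ).trans (mul_le_mul_left le_add_self _)

lemma dnorm_self {γ : ℝ} (s : ℝ) {t : ℝ} (ht : 0 < t) (x : ℝ) :
    dnorm γ s t t x = dsym γ (t * x) * ipow (-s) (t * x) := by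
  rw [dnorm, ipow_mul _ ht]; ring

theorem lowerEst_diffSym (hκ : ModulationInvariant Φ κ) (hκ0 : ∀ m, κ m ≠ 0) {θ : ℝ}
    (hE : TwoPointSmooth E θ) (hθ : 1 ≤ θ) {γ : ℝ} (hγ : 0 < γ) (s : ℝ) :
    ∃ C : ℝ≥0∞, C ≠ ⊤ ∧ ∀ δ : ℝ, 0 < δ →
      LowerEst Φ θ C (fun j => normFam γ s κ (δ / 2 ^ (j + 1))) (diffSym (γ - s) κ δ) := by
  have hπ := pi_gt_three
  have hband := isBand_psi.mul (g := fun x => (ipow γ (1 / 2 * x) * dquot γ (1 / 2 * x) *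
      ipow (-s) (1 / 2 * x))⁻¹) fun x hx hx2 => by
    have h2 : |1 / 2 * x| ≤ 1 / 4 := by
      rw [abs_mul, abs_of_pos (by norm_num : (0 : ℝ) < 1 / 2)]; linarith
    have h0 : 1 / 2 * x ≠ 0 := mul_ne_zero (by norm_num) hx
    have h3 := (((contDiffAt_ipow γ h0).mul (contDiffAt_dquot γ (by linarith))).mul
      (contDiffAt_ipow (-s) h0)).inv (mul_ne_zero (mul_ne_zero (ipow_ne_zero γ h0)
        (dquot_ne_zero γ (by linarith))) (ipow_ne_zero _ h0))
    exact h3.comp x (contDiffAt_const.mul contDiffAt_id)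
  obtain ⟨C₁, hC₁, h₁⟩ := hband.norm_sum_down_le hκ hE hθ (by linarith)
  have htest := isTest_chi.mul_of_ball (g := fun x => (dquot γ x)⁻¹) (b := 1 / 2)
    (fun x hx => chi_eq_zero hx.le) fun x hx => (contDiffAt_dquot γ (by linarith)).inv
      (dquot_ne_zero γ (by linarith))
  obtain ⟨A, hA, hm⟩ := htest.multBound hκ
  refine ⟨C₁ + ENNReal.ofReal (‖(((2 : ℝ) ^ (γ - s) : ℝ) : ℂ)‖ * A) ^ θ, by finiteness,
    fun δ hδ i c => ?_⟩
  fin_cases i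
  · obtain ⟨N, hN⟩ := exists_nat_forall_support c
      (P := fun m N => |δ * κ m / 2 ^ N| ≤ 1 / 8) fun m => eventually_abs_div_le _ (by norm_num)
    set v : ℕ → ι →₀ ℂ := fun j => 
      (fun m => dnorm γ s (δ / 2 ^ (j + 1)) (δ / 2 ^ (j + 1)) (κ m)) • c with hv
    have hdec : (fun m => 1 - chi (2 * (δ * κ m))) • c =
        ∑ j ∈ Finset.range N, (fun m => (fun x => psi x * (ipow γ (1 / 2 * x) * dquot γ (1 / 2 * x) *
          ipow (-s) (1 / 2 * x))⁻¹) (δ * κ m / 2 ^ j)) • v j := by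
      ext m
      rw [Finsupp.finsetSum_apply]
      simp only [symbol_smul_apply]
      by_cases hm : c m = 0
      · simp [hm, hv, symbol_smul_apply]
      have h1 := sum_psi_down (δ * κ m) N
      have h2 := hN m (Finsupp.mem_support_iff.2 hm)
      rw [chi_eq_one (x := 2 * (δ * κ m / 2 ^ N)) (by rw [abs_mul, abs_two]; linarith)] at h1
      rw [← h1, Finset.sum_mul]
      refine Finset.sum_congr rfl fun j _ => ?_
      rw [hv]
      simp only [symbol_smul_apply]
      rw [dnorm_self s (by positivity),
        show δ / 2 ^ (j + 1) * κ m = 1 / 2 * (δ * κ m / 2 ^ j) by field_simp; ring]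
      have h0 : δ * κ m / 2 ^ j ≠ 0 := div_ne_zero (mul_ne_zero hδ.ne' (hκ0 m)) (by positivity)
      set y := δ * κ m / 2 ^ j
      rcases le_or_gt (1 / 2) (|y|) with hx | hx
      · rw [psi_eq_zero_of_ge hx]; ring
      · have hy : |1 / 2 * y| ≤ 1 / 4 := by
          rw [abs_mul, abs_of_pos (by norm_num : (0 : ℝ) < 1 / 2)]; linarith
        have hy0 : 1 / 2 * y ≠ 0 := mul_ne_zero (by norm_num) h0
        rw [dsym_eq hγ hy0 (by linarith)]
        have h3 := inv_mul_cancel₀ (mul_ne_zero (mul_ne_zero (ipow_ne_zero γ hy0)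
          (dquot_ne_zero γ (x := 1 / 2 * y) (by linarith))) (ipow_ne_zero (-s) hy0))
        linear_combination (-(psi y * c m)) * h3
    refine le_trans ?_ (mul_le_mul_left le_self_add _)
    change ‖Φ ((fun m => 1 - chi (2 * (δ * κ m))) • c)‖ₑ ^ θ ≤ _
    rw [hdec]
    refine (h₁ δ N v).trans (mul_le_mul_right (le_trans (Finset.sum_le_sum fun j _ => ?_)
      (ENNReal.sum_le_tsum (Finset.range N))) _)
    exact le_iSup₂_of_le _ ⟨δ / 2 ^ (j + 1), by rw [abs_of_pos (by positivity)], rfl⟩ le_rfl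
  · refine le_trans ?_ (mul_le_mul_left le_add_self _)
    refine le_trans ?_ (mul_le_mul_right (le_trans (le_iSup₂_of_le _
      ⟨δ / 2 ^ (0 + 1), by rw [abs_of_pos (by positivity)], rfl⟩ le_rfl) (ENNReal.le_tsum 0)) _)
    refine le_trans (le_of_eq ?_) (((hm (δ / 2)).const_mul _).enorm_rpow_le (by linarith) _)
    congr 3
    ext m
    simp only [symbol_smul_apply, diffSym]
    rw [dnorm_self s (by positivity), zero_add, pow_one]
    change chi (δ * κ m / 2) * ipow (γ - s) (δ * κ m) * c m = _
    have h0 : δ / 2 * κ m ≠ 0 := mul_ne_zero (by positivity) (hκ0 m)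
    rw [show δ * κ m / 2 = δ / 2 * κ m by ring, show δ * κ m = 2 * (δ / 2 * κ m) by ring,
      ipow_mul _ two_pos]
    set y := δ / 2 * κ m
    rcases le_or_gt (1 / 2) (|y|) with hx | hx
    · rw [chi_eq_zero hx]; ring
    · rw [dsym_eq hγ h0 (by linarith), sub_eq_add_neg, ipow_add _ _ h0]
      have h3 := inv_mul_cancel₀ (dquot_ne_zero γ (x := y) (by linarith))
      linear_combination (-(chi y * ((2 : ℝ) ^ (γ + -s) : ℝ) * ipow γ y * ipow (-s) y * c m)) * h3

end Lower

/-! ### The discrete form of the estimates -/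

section Discrete

variable {ι E : Type*} [NormedAddCommGroup E] [NormedSpace ℂ E]
  {Φ : (ι →₀ ℂ) →ₗ[ℂ] E} {κ₁ κ₂ : ι → ℝ}

/-- The mixed modulus of smoothness of `Φ c`. -/
def symbolMod (Φ : (ι →₀ ℂ) →ₗ[ℂ] E) (κ₁ κ₂ : ι → ℝ) (γ₁ γ₂ : ℝ) (c : ι →₀ ℂ) (t₁ t₂ : ℝ) :
    ℝ≥0∞ :=
  ⨆ (h₁ : ℝ) (_ : |h₁| ≤ t₁) (h₂ : ℝ) (_ : |h₂| ≤ t₂),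
    ‖Φ ((fun m => dsym γ₁ (h₁ * κ₁ m)) • (fun m => dsym γ₂ (h₂ * κ₂ m)) • c)‖ₑ

/-- Symbols of fractional differences with steps at most `t`, multiplied by a fixed symbol. -/
def stepFam (γ w : ℝ) (ρ : ι → ℂ) (κ : ι → ℝ) (t : ℝ) : Set (ι → ℂ) :=
  {σ | ∃ h, |h| ≤ t ∧ σ = fun m => (w : ℂ) * (dsym γ (h * κ m) * ρ m)}

lemma normFam_eq_stepFam (γ s : ℝ) (κ : ι → ℝ) (t : ℝ) :
    normFam γ s κ t = stepFam γ (t ^ (-s)) (fun m => ipow (-s) (κ m)) κ t := rfl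

lemma diffFam_eq_stepFam (β ε : ℝ) (κ : ι → ℝ) (δ : ℝ) (k : ℕ) :
    diffFam β ε κ δ k = stepFam β (2 ^ (-(k * ε))) (fun _ => 1) κ (2 ^ k * δ) := by
  simp only [diffFam, stepFam, mul_one]

lemma iSup_stepFam_rpow {γ₁ γ₂ w₁ w₂ : ℝ} (hw₁ : 0 ≤ w₁) (hw₂ : 0 ≤ w₂) (ρ₁ ρ₂ : ι → ℂ)
    (t₁ t₂ : ℝ) {τ : ℝ} (hτ : 0 < τ) (c : ι →₀ ℂ) :
    (⨆ σ ∈ stepFam γ₁ w₁ ρ₁ κ₁ t₁, ⨆ σ' ∈ stepFam γ₂ w₂ ρ₂ κ₂ t₂, ‖Φ (σ • σ' • c)‖ₑ ^ τ) =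
      (ENNReal.ofReal w₁ * ENNReal.ofReal w₂ *
        symbolMod Φ κ₁ κ₂ γ₁ γ₂ (ρ₁ • ρ₂ • c) t₁ t₂) ^ τ := by
  have key (h₁ h₂ : ℝ) : ‖Φ ((fun m => (w₁ : ℂ) * (dsym γ₁ (h₁ * κ₁ m) * ρ₁ m)) •
      (fun m => (w₂ : ℂ) * (dsym γ₂ (h₂ * κ₂ m) * ρ₂ m)) • c)‖ₑ =
      ENNReal.ofReal w₁ * ENNReal.ofReal w₂ * ‖Φ ((fun m => dsym γ₁ (h₁ * κ₁ m)) •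
        (fun m => dsym γ₂ (h₂ * κ₂ m)) • ρ₁ • ρ₂ • c)‖ₑ := by
    have e : ((fun m => (w₁ : ℂ) * (dsym γ₁ (h₁ * κ₁ m) * ρ₁ m)) •
        (fun m => (w₂ : ℂ) * (dsym γ₂ (h₂ * κ₂ m) * ρ₂ m)) • c) =
        ((w₁ : ℂ) * w₂) • ((fun m => dsym γ₁ (h₁ * κ₁ m)) •
        (fun m => dsym γ₂ (h₂ * κ₂ m)) • ρ₁ • ρ₂ • c) := by
      ext m
      simp only [symbol_smul_apply, Finsupp.smul_apply, smul_eq_mul]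
      ring
    rw [e, map_smul, enorm_smul, enorm_mul, ← ofReal_norm, ← ofReal_norm (w₂ : ℂ),
      Complex.norm_real, Complex.norm_real, norm_of_nonneg hw₁, norm_of_nonneg hw₂]
  refine le_antisymm ?_ ?_
  · refine iSup₂_le fun σ hσ => iSup₂_le fun σ' hσ' => ENNReal.rpow_le_rpow ?_ hτ.le
    obtain ⟨h₁, hh₁, rfl⟩ := hσ
    obtain ⟨h₂, hh₂, rfl⟩ := hσ'
    rw [key]
    refine mul_le_mul_right ?_ _
    unfold symbolMod
    refine le_iSup₂_of_le h₁ hh₁ ?_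
    exact le_iSup₂_of_le h₂ hh₂ le_rfl
  · rw [← ENNReal.le_rpow_inv_iff hτ]
    simp only [symbolMod, ENNReal.mul_iSup]
    refine iSup₂_le fun h₁ hh₁ => iSup₂_le fun h₂ hh₂ => ?_
    rw [← key, ENNReal.le_rpow_inv_iff hτ]
    exact le_iSup₂_of_le _ ⟨h₁, hh₁, rfl⟩ (le_iSup₂_of_le _ ⟨h₂, hh₂, rfl⟩ le_rfl)

/-- The weighted `ℓ^τ` norm of the values of `N` at the points `(δ₁ / 2^k, δ₂ / 2^k')`. -/
def normSum (N : ℝ → ℝ → ℝ≥0∞) (s₁ s₂ τ δ₁ δ₂ : ℝ) : ℝ≥0∞ :=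
  (∑' k : ℕ, ∑' k' : ℕ, (ENNReal.ofReal ((δ₁ / 2 ^ k) ^ (-s₁)) *
    ENNReal.ofReal ((δ₂ / 2 ^ k') ^ (-s₂)) * N (δ₁ / 2 ^ k) (δ₂ / 2 ^ k')) ^ τ) ^ (1 / τ)

/-- The weighted `ℓ^τ` norm of the values of `N` at the points `(2^k δ₁, 2^k' δ₂)`. -/
def diffSum (N : ℝ → ℝ → ℝ≥0∞) (ε₁ ε₂ τ δ₁ δ₂ : ℝ) : ℝ≥0∞ :=
  (∑' k : ℕ, ∑' k' : ℕ, (ENNReal.ofReal ((2 : ℝ) ^ (-(k * ε₁))) *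
    ENNReal.ofReal ((2 : ℝ) ^ (-(k' * ε₂))) * N (2 ^ k * δ₁) (2 ^ k' * δ₂)) ^ τ) ^ (1 / τ)

/-- The part of `diffSum` over the points with coordinates less than `1/2`. -/
def diffSumCut (N : ℝ → ℝ → ℝ≥0∞) (ε₁ ε₂ θ δ₁ δ₂ : ℝ) : ℝ≥0∞ :=
  (∑' k : ℕ, ∑' k' : ℕ, if 2 ^ k * δ₁ < 1 / 2 ∧ 2 ^ k' * δ₂ < 1 / 2 then
    (ENNReal.ofReal ((2 : ℝ) ^ (-(k * ε₁))) * ENNReal.ofReal ((2 : ℝ) ^ (-(k' * ε₂))) *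
      N (2 ^ k * δ₁) (2 ^ k' * δ₂)) ^ θ else 0) ^ (1 / θ)

lemma one_smul_one_smul (c : ι →₀ ℂ) : (fun _ => 1 : ι → ℂ) • (fun _ => 1 : ι → ℂ) • c = c := by
  ext m; simp [symbol_smul_apply]

variable [CompleteSpace E]

theorem exists_normSum_le_diffSumCut (hκ₁ : ModulationInvariant Φ κ₁)
    (hκ₂ : ModulationInvariant Φ κ₂) (h₁ : ∀ m, 1 ≤ |κ₁ m|) (h₂ : ∀ m, 1 ≤ |κ₂ m|) {θ τ : ℝ}
    (hθ : 1 ≤ θ) (hτ : 1 ≤ τ) (hEθ : TwoPointSmooth E θ) (hEτ : TwoPointConvex E τ)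
    {γ₁ γ₂ s₁ s₂ β₁ β₂ : ℝ} (hs₁ : 0 < s₁) (hs₂ : 0 < s₂) (hsγ₁ : s₁ < γ₁) (hsγ₂ : s₂ < γ₂)
    (hβ₁ : 0 < β₁) (hβ₂ : 0 < β₂) : ∃ C : ℝ≥0∞, C ≠ ⊤ ∧ ∀ (δ₁ δ₂ : ℝ) (c : ι →₀ ℂ),
      δ₁ ∈ Set.Ioo (0 : ℝ) (1 / 2) → δ₂ ∈ Set.Ioo (0 : ℝ) (1 / 2) →
        normSum (symbolMod Φ κ₁ κ₂ γ₁ γ₂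
          ((fun m => ipow (-s₁) (κ₁ m)) • (fun m => ipow (-s₂) (κ₂ m)) • c)) s₁ s₂ τ δ₁ δ₂ ≤
            C * diffSumCut (symbolMod Φ κ₁ κ₂ β₁ β₂ c) (γ₁ - s₁) (γ₂ - s₂) θ δ₁ δ₂ := by
  have hθ0 : 0 < θ := by linarith
  have hτ0 : 0 < τ := by linarith
  have n₁ : ∀ m, κ₁ m ≠ 0 := fun m => abs_pos.1 (by linarith [h₁ m])
  have n₂ : ∀ m, κ₂ m ≠ 0 := fun m => abs_pos.1 (by linarith [h₂ m])
  obtain ⟨C₁, hC₁, u₁⟩ := upperEst_normFam hκ₁ n₁ hEτ hτ hs₁ hsγ₁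
  obtain ⟨C₂, hC₂, u₂⟩ := upperEst_normFam hκ₂ n₂ hEτ hτ hs₂ hsγ₂
  obtain ⟨D₁, hD₁, l₁⟩ := lowerEst_normSym hκ₁ h₁ hEθ hθ hβ₁ γ₁ s₁
  obtain ⟨D₂, hD₂, l₂⟩ := lowerEst_normSym hκ₂ h₂ hEθ hθ hβ₂ γ₂ s₂
  refine ⟨(C₁ * C₁ * (C₂ * C₂) * ((3 : ℕ) * (3 : ℕ))) ^ (1 / τ) * (D₁ * D₂) ^ (1 / θ),
    by finiteness, fun δ₁ δ₂ c hδ₁ hδ₂ => ?_⟩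
  · have h := (u₁ δ₁ hδ₁.1).le_of_lowerEst hτ0 hθ0 (u₂ δ₂ hδ₂.1) (l₁ δ₁ hδ₁.1 hδ₁.2)
      (l₂ δ₂ hδ₂.1 hδ₂.2) c
    convert! h using 1
    · rw [normSum]
      congr 1
      refine tsum_congr fun k => tsum_congr fun k' => ?_
      have p₁ := hδ₁.1
      have p₂ := hδ₂.1
      rw [normFam_eq_stepFam, normFam_eq_stepFam,
        iSup_stepFam_rpow (by positivity) (by positivity) _ _ _ _ hτ0]
    · rw [diffSumCut]
      congr 2
      refine tsum_congr fun k => tsum_congr fun k' => ?_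
      simp only [diffFamCut, Set.mem_ofPred_eq]
      by_cases c₁ : 2 ^ k * δ₁ < 1 / 2
      · by_cases c₂ : 2 ^ k' * δ₂ < 1 / 2
        · simp only [c₁, c₂, true_and, and_self, if_true]
          rw [diffFam_eq_stepFam, diffFam_eq_stepFam]
          exact (one_smul_one_smul c ▸ iSup_stepFam_rpow (by positivity) (by positivity)
            (fun _ => 1) (fun _ => 1) _ _ hθ0 c).symm
        · simp only [c₂, false_and, and_false, if_false, iSup_false, bot_eq_zero, ENNReal.iSup_zero]
      · simp only [c₁, false_and, if_false, iSup_false, bot_eq_zero, ENNReal.iSup_zero]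

theorem exists_diffSum_le_normSum (hκ₁ : ModulationInvariant Φ κ₁)
    (hκ₂ : ModulationInvariant Φ κ₂) (n₁ : ∀ m, κ₁ m ≠ 0) (n₂ : ∀ m, κ₂ m ≠ 0) {θ τ : ℝ}
    (hθ : 1 ≤ θ) (hτ : 1 ≤ τ) (hEθ : TwoPointSmooth E θ) (hEτ : TwoPointConvex E τ)
    {γ₁ γ₂ s₁ s₂ β₁ β₂ : ℝ} (hγ₁ : 0 < γ₁) (hγ₂ : 0 < γ₂) (hsγ₁ : s₁ < γ₁) (hsγ₂ : s₂ < γ₂)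
    (hβ₁ : γ₁ - s₁ < β₁) (hβ₂ : γ₂ - s₂ < β₂) : ∃ C : ℝ≥0∞, C ≠ ⊤ ∧ ∀ (δ₁ δ₂ : ℝ) (c : ι →₀ ℂ),
      0 < δ₁ → 0 < δ₂ →
        diffSum (symbolMod Φ κ₁ κ₂ β₁ β₂ c) (γ₁ - s₁) (γ₂ - s₂) τ δ₁ δ₂ ≤
          C * normSum (symbolMod Φ κ₁ κ₂ γ₁ γ₂
            ((fun m => ipow (-s₁) (κ₁ m)) • (fun m => ipow (-s₂) (κ₂ m)) • c)) s₁ s₂ θ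
              (δ₁ / 2) (δ₂ / 2) := by
  have hθ0 : 0 < θ := by linarith
  have hτ0 : 0 < τ := by linarith
  obtain ⟨C₁, hC₁, u₁⟩ := upperEst_diffFam hκ₁ n₁ hEτ hτ (sub_pos.2 hsγ₁) hβ₁
  obtain ⟨C₂, hC₂, u₂⟩ := upperEst_diffFam hκ₂ n₂ hEτ hτ (sub_pos.2 hsγ₂) hβ₂
  obtain ⟨D₁, hD₁, l₁⟩ := lowerEst_diffSym hκ₁ n₁ hEθ hθ hγ₁ s₁
  obtain ⟨D₂, hD₂, l₂⟩ := lowerEst_diffSym hκ₂ n₂ hEθ hθ hγ₂ s₂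
  refine ⟨(C₁ * C₁ * (C₂ * C₂) * ((2 : ℕ) * (2 : ℕ))) ^ (1 / τ) * (D₁ * D₂) ^ (1 / θ),
    by finiteness, fun δ₁ δ₂ c hδ₁ hδ₂ => ?_⟩
  · have h := (u₁ δ₁ hδ₁).le_of_lowerEst hτ0 hθ0 (u₂ δ₂ hδ₂) (l₁ δ₁ hδ₁) (l₂ δ₂ hδ₂) c
    convert! h using 1
    · rw [diffSum]
      congr 1
      refine tsum_congr fun k => tsum_congr fun k' => ?_
      rw [diffFam_eq_stepFam, diffFam_eq_stepFam,
        iSup_stepFam_rpow (by positivity) (by positivity) _ _ _ _ hτ0, one_smul_one_smul]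
    · rw [normSum]
      congr 2
      refine tsum_congr fun k => tsum_congr fun k' => ?_
      rw [normFam_eq_stepFam, normFam_eq_stepFam,
        iSup_stepFam_rpow (by positivity) (by positivity) _ _ _ _ hθ0]
      simp only [pow_succ', div_div]

theorem exists_enorm_le_normSum (hκ₁ : ModulationInvariant Φ κ₁)
    (hκ₂ : ModulationInvariant Φ κ₂) (h₁ : ∀ m, 1 ≤ |κ₁ m|) (h₂ : ∀ m, 1 ≤ |κ₂ m|) {θ : ℝ}
    (hθ : 1 ≤ θ) (hEθ : TwoPointSmooth E θ) {γ₁ γ₂ : ℝ} (hγ₁ : 0 < γ₁) (hγ₂ : 0 < γ₂)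
    (s₁ s₂ : ℝ) : ∃ C : ℝ≥0∞, C ≠ ⊤ ∧ ∀ c : ι →₀ ℂ,
      ‖Φ c‖ₑ ≤ C * normSum (symbolMod Φ κ₁ κ₂ γ₁ γ₂
        ((fun m => ipow (-s₁) (κ₁ m)) • (fun m => ipow (-s₂) (κ₂ m)) • c)) s₁ s₂ θ (1 / 2) (1 / 2) := by
  have hθ0 : 0 < θ := by linarith
  have n₁ : ∀ m, κ₁ m ≠ 0 := fun m => abs_pos.1 (by linarith [h₁ m])
  have n₂ : ∀ m, κ₂ m ≠ 0 := fun m => abs_pos.1 (by linarith [h₂ m])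
  obtain ⟨D₁, hD₁, l₁⟩ := lowerEst_diffSym hκ₁ n₁ hEθ hθ hγ₁ s₁
  obtain ⟨D₂, hD₂, l₂⟩ := lowerEst_diffSym hκ₂ n₂ hEθ hθ hγ₂ s₂
  refine ⟨(D₁ * D₂) ^ (1 / θ), by finiteness, fun c => ?_⟩
  have h := (l₁ 1 one_pos).le_tsum_tsum (l₂ 1 one_pos) 0 0 c
  have e : diffSym (γ₁ - s₁) κ₁ 1 0 • diffSym (γ₂ - s₂) κ₂ 1 0 • c = c := by
    have e' : ∀ x : ℝ, 1 ≤ |x| → 1 - chi (2 * x) = 1 := fun x hx => by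
      rw [chi_eq_zero, sub_zero]
      rw [abs_mul, abs_two]; linarith
    ext m
    simp only [symbol_smul_apply, diffSym, Matrix.cons_val_zero, e' _ (h₁ m), e' _ (h₂ m), one_mul]
  rw [e, ← ENNReal.le_rpow_inv_iff hθ0] at h
  refine h.trans (le_of_eq ?_)
  rw [ENNReal.mul_rpow_of_nonneg _ _ (by positivity), one_div, normSum, one_div θ]
  congr 2
  refine tsum_congr fun k => tsum_congr fun k' => ?_
  rw [normFam_eq_stepFam, normFam_eq_stepFam,
    iSup_stepFam_rpow (by positivity) (by positivity) _ _ _ _ hθ0]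
  simp only [pow_succ', div_div]

end Discrete

/-! ### Integrals and dyadic sums -/

lemma lintegral_lintegral_le_tsum_tsum {S T : Set ℝ} {I J : ℕ → Set ℝ} (hI : ∀ k, MeasurableSet (I k))
    (hJ : ∀ k, MeasurableSet (J k)) (hS : S ⊆ ⋃ k, I k) (hT : T ⊆ ⋃ k, J k)
    {w₁ w₂ : ℝ → ℝ} {N : ℝ → ℝ → ℝ≥0∞} {W₁ W₂ v₁ v₂ : ℕ → ℝ≥0∞} {n : ℕ → ℕ → ℝ≥0∞}
    {C₁ C₂ : ℝ≥0∞} {τ : ℝ} (hτ : 0 ≤ τ) (hw : ∀ k, ∀ x ∈ I k, 0 ≤ w₁ x)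
    (h₁ : ∀ k, ∀ x ∈ I k, ENNReal.ofReal (w₁ x) ≤ W₁ k)
    (h₂ : ∀ k, ∀ x ∈ J k, ENNReal.ofReal (w₂ x) ≤ W₂ k)
    (g₁ : ∀ k, W₁ k * volume (I k) ≤ C₁ * v₁ k ^ τ)
    (g₂ : ∀ k, W₂ k * volume (J k) ≤ C₂ * v₂ k ^ τ)
    (hN : ∀ k k', ∀ x ∈ I k, ∀ y ∈ J k', N x y ≤ n k k') :
    ∫⁻ x in S, ∫⁻ y in T, ENNReal.ofReal (w₁ x * w₂ y) * N x y ^ τ ≤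
      C₁ * C₂ * ∑' k, ∑' k', (v₁ k * v₂ k' * n k k') ^ τ := by
  have inner (k : ℕ) (x : ℝ) (hx : x ∈ I k) :
      ∫⁻ y in T, ENNReal.ofReal (w₁ x * w₂ y) * N x y ^ τ ≤
        ∑' k', W₁ k * W₂ k' * n k k' ^ τ * volume (J k') := by
    refine (lintegral_mono_set hT).trans ((lintegral_iUnion_le _ _).trans ?_)
    refine ENNReal.tsum_le_tsum fun k' => ?_
    rw [← setLIntegral_const]
    refine setLIntegral_mono' (hJ k') fun y hy => ?_
    rw [ENNReal.ofReal_mul (hw k x hx)]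
    exact mul_le_mul' (mul_le_mul' (h₁ k x hx) (h₂ k' y hy))
      (ENNReal.rpow_le_rpow (hN k k' x hx y hy) hτ)
  refine (lintegral_mono_set hS).trans ((lintegral_iUnion_le _ _).trans ?_)
  rw [← ENNReal.tsum_mul_left]
  refine ENNReal.tsum_le_tsum fun k => ?_
  calc _ ≤ ∫⁻ _ in I k, ∑' k', W₁ k * W₂ k' * n k k' ^ τ * volume (J k') :=
        setLIntegral_mono' (hI k) (inner k)
    _ = ∑' k', (W₁ k * volume (I k)) * (W₂ k' * volume (J k')) * n k k' ^ τ := by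
        rw [setLIntegral_const, ← ENNReal.tsum_mul_right]
        exact tsum_congr fun k' => by ring
    _ ≤ ∑' k', C₁ * C₂ * (v₁ k * v₂ k' * n k k') ^ τ := by
        refine ENNReal.tsum_le_tsum fun k' => ?_
        refine (mul_le_mul_left (mul_le_mul' (g₁ k) (g₂ k')) _).trans (le_of_eq ?_)
        rw [ENNReal.mul_rpow_of_nonneg _ _ hτ, ENNReal.mul_rpow_of_nonneg _ _ hτ]
        ring
    _ = _ := ENNReal.tsum_mul_left

lemma tsum_tsum_le_lintegral_lintegral {S T : Set ℝ} {I J : ℕ → Set ℝ} (hI : ∀ k, MeasurableSet (I k))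
    (hJ : ∀ k, MeasurableSet (J k)) (dI : Pairwise (Function.onFun Disjoint I))
    (dJ : Pairwise (Function.onFun Disjoint J)) (hS : ∀ k, I k ⊆ S) (hT : ∀ k, J k ⊆ T)
    {w₁ w₂ : ℝ → ℝ} {N : ℝ → ℝ → ℝ≥0∞} {W₁ W₂ v₁ v₂ : ℕ → ℝ≥0∞} {n : ℕ → ℕ → ℝ≥0∞}
    {C₁ C₂ : ℝ≥0∞} {τ : ℝ} (hτ : 0 ≤ τ) (hw : ∀ k, ∀ x ∈ I k, 0 ≤ w₁ x)
    (h₁ : ∀ k, ∀ x ∈ I k, W₁ k ≤ ENNReal.ofReal (w₁ x))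
    (h₂ : ∀ k, ∀ x ∈ J k, W₂ k ≤ ENNReal.ofReal (w₂ x))
    (g₁ : ∀ k, v₁ k ^ τ ≤ C₁ * (W₁ k * volume (I k)))
    (g₂ : ∀ k, v₂ k ^ τ ≤ C₂ * (W₂ k * volume (J k)))
    (hN : ∀ k k', ∀ x ∈ I k, ∀ y ∈ J k', n k k' ≤ N x y) :
    ∑' k, ∑' k', (v₁ k * v₂ k' * n k k') ^ τ ≤
      C₁ * C₂ * ∫⁻ x in S, ∫⁻ y in T, ENNReal.ofReal (w₁ x * w₂ y) * N x y ^ τ := by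
  have inner (k : ℕ) (x : ℝ) (hx : x ∈ I k) :
      ∑' k', W₁ k * W₂ k' * n k k' ^ τ * volume (J k') ≤
      ∫⁻ y in T, ENNReal.ofReal (w₁ x * w₂ y) * N x y ^ τ := by
    refine le_trans ?_ (lintegral_mono_set (Set.iUnion_subset hT))
    rw [lintegral_iUnion hJ dJ]
    refine ENNReal.tsum_le_tsum fun k' => ?_
    rw [← setLIntegral_const]
    refine setLIntegral_mono' (hJ k') fun y hy => ?_
    rw [ENNReal.ofReal_mul (hw k x hx)]
    exact mul_le_mul' (mul_le_mul' (h₁ k x hx) (h₂ k' y hy))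
      (ENNReal.rpow_le_rpow (hN k k' x hx y hy) hτ)
  refine le_trans ?_ (mul_le_mul_right (lintegral_mono_set (Set.iUnion_subset hS)) _)
  rw [lintegral_iUnion hI dI, ← ENNReal.tsum_mul_left]
  refine ENNReal.tsum_le_tsum fun k => ?_
  calc _ ≤ ∑' k', C₁ * C₂ * ((W₁ k * volume (I k)) * (W₂ k' * volume (J k')) * n k k' ^ τ) := by
        refine ENNReal.tsum_le_tsum fun k' => ?_
        rw [ENNReal.mul_rpow_of_nonneg _ _ hτ, ENNReal.mul_rpow_of_nonneg _ _ hτ]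
        refine (mul_le_mul_left (mul_le_mul' (g₁ k) (g₂ k')) _).trans (le_of_eq ?_)
        ring
    _ = C₁ * C₂ * ∫⁻ _ in I k, ∑' k', W₁ k * W₂ k' * n k k' ^ τ * volume (J k') := by
        rw [setLIntegral_const, ← ENNReal.tsum_mul_right, ENNReal.tsum_mul_left]
        congr 1
        exact tsum_congr fun k' => by ring
    _ ≤ _ := mul_le_mul_right (setLIntegral_mono' (hI k) (inner k)) _

/-- The continuous counterpart of `normSum`. -/
def normInt (N : ℝ → ℝ → ℝ≥0∞) (s₁ s₂ τ δ₁ δ₂ : ℝ) : ℝ≥0∞ :=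
  (∫⁻ t₁ in Set.Ioo (0 : ℝ) δ₁, ∫⁻ t₂ in Set.Ioo (0 : ℝ) δ₂,
    ENNReal.ofReal (t₁ ^ (-s₁ * τ - 1) * t₂ ^ (-s₂ * τ - 1)) * N t₁ t₂ ^ τ) ^ (1 / τ)

/-- The continuous counterpart of `diffSum`. -/
def diffInt (N : ℝ → ℝ → ℝ≥0∞) (ε₁ ε₂ τ δ₁ δ₂ : ℝ) : ℝ≥0∞ :=
  (∫⁻ t₁ in Set.Ioo δ₁ 1, ∫⁻ t₂ in Set.Ioo δ₂ 1,
    ENNReal.ofReal ((δ₁ / t₁) ^ (ε₁ * τ) / t₁ * ((δ₂ / t₂) ^ (ε₂ * τ) / t₂)) *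
      N t₁ t₂ ^ τ) ^ (1 / τ)

lemma half_pow_succ (δ : ℝ) (k : ℕ) : δ / 2 ^ k - δ / 2 ^ (k + 1) = δ / 2 ^ (k + 1) := by
  rw [pow_succ]; field_simp; ring

lemma Ioo_zero_subset_iUnion (δ : ℝ) :
    Set.Ioo 0 δ ⊆ ⋃ k : ℕ, Set.Ioc (δ / 2 ^ (k + 1)) (δ / 2 ^ k) := by
  intro t ht
  obtain ⟨k, h, h'⟩ := exists_nat_pow_near_of_lt_one (x := t / δ) (y := 1 / 2)
    (div_pos ht.1 (ht.1.trans ht.2)) ((div_le_one (ht.1.trans ht.2)).2 ht.2.le) (by norm_num)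
    (by norm_num)
  refine Set.mem_iUnion.2 ⟨k, ?_, ?_⟩
  · rw [lt_div_iff₀ (ht.1.trans ht.2), one_div_pow] at h
    rwa [div_eq_inv_mul, ← one_div]
  · rw [div_le_iff₀ (ht.1.trans ht.2), one_div_pow] at h'
    rwa [div_eq_inv_mul, ← one_div]

lemma Ioo_one_subset_iUnion {δ : ℝ} (hδ : 0 < δ) :
    Set.Ioo δ 1 ⊆ ⋃ k : ℕ, Set.Ico (2 ^ k * δ) (2 ^ (k + 1) * δ) := by
  intro t ht
  obtain ⟨k, h, h'⟩ := exists_nat_pow_near (x := t / δ) (y := 2) ((one_le_div hδ).2 ht.1.le)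
    one_lt_two
  exact Set.mem_iUnion.2 ⟨k, (le_div_iff₀ hδ).1 h, (div_lt_iff₀ hδ).1 h'⟩

lemma two_pow_mul_sub (δ : ℝ) (k : ℕ) : 2 ^ (k + 1) * δ - 2 ^ k * δ = 2 ^ k * δ := by
  rw [pow_succ]; ring

lemma pairwise_disjoint_half_pow {δ : ℝ} (hδ : 0 ≤ δ) : Pairwise (Function.onFun Disjoint
    fun k : ℕ => Set.Ioo (δ / 2 ^ (k + 1)) (δ / 2 ^ k)) := by
  refine Antitone.pairwise_disjoint_on_Ioo_succ (f := fun k : ℕ => δ / 2 ^ k) ?_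
  exact antitone_nat_of_succ_le fun k => by
    have := half_pow_succ δ k
    have : 0 ≤ δ / 2 ^ (k + 1) := by positivity
    linarith

lemma pairwise_disjoint_two_pow {δ : ℝ} (hδ : 0 ≤ δ) : Pairwise (Function.onFun Disjoint
    fun k : ℕ => Set.Ioo (2 ^ k * δ) (2 ^ (k + 1) * δ)) := by
  refine Monotone.pairwise_disjoint_on_Ioo_succ (f := fun k : ℕ => 2 ^ k * δ) ?_
  exact monotone_nat_of_le_succ fun k => by
    have := two_pow_mul_sub δ k
    have : 0 ≤ 2 ^ k * δ := by positivity
    linarith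

lemma two_rpow_neg_mul (x : ℝ) (k : ℕ) : (2 : ℝ) ^ (-(k * x)) = (1 / 2 ^ k) ^ x := by
  rw [one_div, inv_rpow (by positivity), ← rpow_natCast, ← rpow_mul two_pos.le, rpow_neg two_pos.le]

variable {N : ℝ → ℝ → ℝ≥0∞} {s₁ s₂ ε₁ ε₂ τ δ₁ δ₂ : ℝ}

lemma normInt_le_normSum (hN : ∀ x y x' y', x ≤ x' → y ≤ y' → N x y ≤ N x' y') (hs₁ : 0 < s₁)
    (hs₂ : 0 < s₂) (hτ : 0 < τ) (hδ₁ : 0 < δ₁) (hδ₂ : 0 < δ₂) :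
    normInt N s₁ s₂ τ δ₁ δ₂ ≤
      (ENNReal.ofReal (2 ^ (s₁ * τ)) * ENNReal.ofReal (2 ^ (s₂ * τ))) ^ (1 / τ) *
        normSum N s₁ s₂ τ δ₁ δ₂ := by
  rw [normInt, normSum, ← ENNReal.mul_rpow_of_nonneg _ _ (by positivity)]
  refine ENNReal.rpow_le_rpow ?_ (by positivity)
  have hw {s δ : ℝ} (hs : 0 < s) (hδ : 0 < δ) (k : ℕ) : ∀ x ∈ Set.Ioc (δ / 2 ^ (k + 1)) (δ / 2 ^ k),
      ENNReal.ofReal (x ^ (-s * τ - 1)) ≤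
        ENNReal.ofReal ((δ / 2 ^ (k + 1)) ^ (-s * τ - 1)) := fun x hx =>
    ENNReal.ofReal_le_ofReal (rpow_le_rpow_of_nonpos (by positivity) hx.1.le (by nlinarith))
  have hg {s δ : ℝ} (hδ : 0 < δ) (k : ℕ) : ENNReal.ofReal ((δ / 2 ^ (k + 1)) ^ (-s * τ - 1)) *
      volume (Set.Ioc (δ / 2 ^ (k + 1)) (δ / 2 ^ k)) ≤
        ENNReal.ofReal (2 ^ (s * τ)) * ENNReal.ofReal ((δ / 2 ^ k) ^ (-s)) ^ τ := by
    rw [Real.volume_Ioc, half_pow_succ, ENNReal.ofReal_rpow_of_nonneg (by positivity) hτ.le,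
      ← ENNReal.ofReal_mul (by positivity), ← ENNReal.ofReal_mul (by positivity), ← rpow_mul
      (by positivity), rpow_sub_one (by positivity), div_mul_cancel₀ _ (by positivity), pow_succ,
      ← div_div, div_rpow (by positivity) two_pos.le, neg_mul, rpow_neg two_pos.le, div_inv_eq_mul,
      mul_comm]
  exact lintegral_lintegral_le_tsum_tsum (fun _ => measurableSet_Ioc) (fun _ => measurableSet_Ioc)
    (Ioo_zero_subset_iUnion δ₁) (Ioo_zero_subset_iUnion δ₂) hτ.le
    (fun k x hx => rpow_nonneg ((by positivity : 0 ≤ δ₁ / 2 ^ (k + 1)).trans hx.1.le) _)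
    (hw hs₁ hδ₁) (hw hs₂ hδ₂) (hg hδ₁) (hg hδ₂) fun k k' x hx y hy => hN _ _ _ _ hx.2 hy.2

lemma normSum_le_normInt (hN : ∀ x y x' y', x ≤ x' → y ≤ y' → N x y ≤ N x' y') (hs₁ : 0 < s₁)
    (hs₂ : 0 < s₂) (hτ : 0 < τ) (hδ₁ : 0 < δ₁) (hδ₂ : 0 < δ₂) :
    normSum N s₁ s₂ τ (δ₁ / 2) (δ₂ / 2) ≤
      (ENNReal.ofReal (2 ^ (s₁ * τ + 1)) * ENNReal.ofReal (2 ^ (s₂ * τ + 1))) ^ (1 / τ) *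
        normInt N s₁ s₂ τ δ₁ δ₂ := by
  rw [normInt, normSum, ← ENNReal.mul_rpow_of_nonneg _ _ (by positivity)]
  refine ENNReal.rpow_le_rpow ?_ (by positivity)
  simp only [div_div, ← pow_succ']
  have hw {s δ : ℝ} (hs : 0 < s) (hδ : 0 < δ) (k : ℕ) : ∀ x ∈ Set.Ioo (δ / 2 ^ (k + 1)) (δ / 2 ^ k),
      ENNReal.ofReal ((δ / 2 ^ k) ^ (-s * τ - 1)) ≤ ENNReal.ofReal (x ^ (-s * τ - 1)) :=
    fun x hx => ENNReal.ofReal_le_ofReal (rpow_le_rpow_of_nonpos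
      ((by positivity : 0 < δ / 2 ^ (k + 1)).trans hx.1) hx.2.le (by nlinarith))
  have hg {s δ : ℝ} (hδ : 0 < δ) (k : ℕ) : ENNReal.ofReal ((δ / 2 ^ (k + 1)) ^ (-s)) ^ τ ≤
      ENNReal.ofReal (2 ^ (s * τ + 1)) * (ENNReal.ofReal ((δ / 2 ^ k) ^ (-s * τ - 1)) *
      volume (Set.Ioo (δ / 2 ^ (k + 1)) (δ / 2 ^ k))) := by
    rw [Real.volume_Ioo, half_pow_succ, ENNReal.ofReal_rpow_of_nonneg (by positivity) hτ.le,
      ← ENNReal.ofReal_mul (by positivity), ← ENNReal.ofReal_mul (by positivity), ← rpow_mul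
      (by positivity)]
    have e : δ / 2 ^ k = 2 * (δ / 2 ^ (k + 1)) := by rw [pow_succ]; field_simp
    rw [e, mul_rpow two_pos.le (by positivity), rpow_sub_one (x := δ / 2 ^ (k + 1)) (by positivity),
      mul_assoc, div_mul_cancel₀ _ (by positivity), ← mul_assoc, ← rpow_add two_pos]
    ring_nf
    simp
  have hsub {δ : ℝ} (hδ : 0 < δ) (k : ℕ) : Set.Ioo (δ / 2 ^ (k + 1)) (δ / 2 ^ k) ⊆ Set.Ioo 0 δ :=
    Set.Ioo_subset_Ioo (by positivity) (div_le_self hδ.le (one_le_pow₀ one_le_two))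
  exact tsum_tsum_le_lintegral_lintegral (fun _ => measurableSet_Ioo) (fun _ => measurableSet_Ioo)
    (pairwise_disjoint_half_pow hδ₁.le) (pairwise_disjoint_half_pow hδ₂.le) (hsub hδ₁) (hsub hδ₂)
    hτ.le (fun k x hx => rpow_nonneg ((by positivity : 0 ≤ δ₁ / 2 ^ (k + 1)).trans hx.1.le) _)
    (hw hs₁ hδ₁) (hw hs₂ hδ₂) (hg hδ₁) (hg hδ₂) fun k k' x hx y hy => hN _ _ _ _ hx.1.le hy.1.le

lemma diffInt_le_diffSum (hN : ∀ x y x' y', x ≤ x' → y ≤ y' → N x y ≤ N x' y') (hε₁ : 0 < ε₁)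
    (hε₂ : 0 < ε₂) (hτ : 0 < τ) (hδ₁ : 0 < δ₁) (hδ₂ : 0 < δ₂) :
    diffInt N ε₁ ε₂ τ δ₁ δ₂ ≤
      (ENNReal.ofReal (2 ^ (ε₁ * τ)) * ENNReal.ofReal (2 ^ (ε₂ * τ))) ^ (1 / τ) *
        diffSum N ε₁ ε₂ τ δ₁ δ₂ := by
  rw [diffInt, diffSum, ← ENNReal.mul_rpow_of_nonneg _ _ (by positivity)]
  refine ENNReal.rpow_le_rpow ?_ (by positivity)
  have hp {δ : ℝ} (hδ : 0 < δ) {k : ℕ} {x : ℝ} (hx : x ∈ Set.Ico (2 ^ k * δ) (2 ^ (k + 1) * δ)) :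
      0 < x := lt_of_lt_of_le (by positivity) hx.1
  have hw {ε δ : ℝ} (hε : 0 < ε) (hδ : 0 < δ) (k : ℕ) :
      ∀ x ∈ Set.Ico (2 ^ k * δ) (2 ^ (k + 1) * δ),
      ENNReal.ofReal ((δ / x) ^ (ε * τ) / x) ≤
        ENNReal.ofReal ((1 / 2 ^ k) ^ (ε * τ) / (2 ^ k * δ)) := fun x hx => by
    have := hp hδ hx
    refine ENNReal.ofReal_le_ofReal (div_le_div₀ (by positivity) (rpow_le_rpow (by positivity) ?_
      (by positivity)) (by positivity) hx.1)
    rw [div_le_div_iff₀ this (by positivity)]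
    linarith [hx.1]
  have hg {ε δ : ℝ} (hδ : 0 < δ) (k : ℕ) :
      ENNReal.ofReal ((1 / 2 ^ k) ^ (ε * τ) / (2 ^ k * δ)) *
      volume (Set.Ico (2 ^ k * δ) (2 ^ (k + 1) * δ)) ≤ ENNReal.ofReal (2 ^ (ε * τ)) *
        ENNReal.ofReal ((2 : ℝ) ^ (-(((k + 1 : ℕ) : ℝ) * ε))) ^ τ := by
    rw [Real.volume_Ico, two_pow_mul_sub, ENNReal.ofReal_rpow_of_nonneg (by positivity) hτ.le,
      ← ENNReal.ofReal_mul (by positivity), ← ENNReal.ofReal_mul (by positivity),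
      div_mul_cancel₀ _ (by positivity), two_rpow_neg_mul, ← rpow_mul (by positivity),
      ← mul_rpow (by positivity) (by positivity), pow_succ']
    field_simp
    exact le_rfl
  refine (lintegral_lintegral_le_tsum_tsum (fun _ => measurableSet_Ico) (fun _ => measurableSet_Ico)
    (Ioo_one_subset_iUnion hδ₁) (Ioo_one_subset_iUnion hδ₂) hτ.le
    (fun k x hx => by have := hp hδ₁ hx; positivity)
    (hw hε₁ hδ₁) (hw hε₂ hδ₂) (hg hδ₁) (hg hδ₂)
    fun k k' x hx y hy => hN _ _ _ _ hx.2.le hy.2.le).trans (mul_le_mul_right ?_ _)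
  refine le_trans (ENNReal.tsum_le_tsum fun k => ?_) (ENNReal.tsum_comp_le_tsum_of_injective
    (add_left_injective 1) _)
  exact ENNReal.tsum_comp_le_tsum_of_injective (add_left_injective 1) (fun k' : ℕ =>
    (ENNReal.ofReal ((2 : ℝ) ^ (-(((k + 1 : ℕ) : ℝ) * ε₁))) *
      ENNReal.ofReal ((2 : ℝ) ^ (-((k' : ℝ) * ε₂))) * N (2 ^ (k + 1) * δ₁) (2 ^ k' * δ₂)) ^ τ)

lemma diffSumCut_le_diffInt (hN : ∀ x y x' y', x ≤ x' → y ≤ y' → N x y ≤ N x' y') (hε₁ : 0 < ε₁)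
    (hε₂ : 0 < ε₂) (hτ : 0 < τ) (hδ₁ : 0 < δ₁) (hδ₂ : 0 < δ₂) :
    diffSumCut N ε₁ ε₂ τ δ₁ δ₂ ≤
      (ENNReal.ofReal (2 ^ (ε₁ * τ + 1)) * ENNReal.ofReal (2 ^ (ε₂ * τ + 1))) ^ (1 / τ) *
        diffInt N ε₁ ε₂ τ δ₁ δ₂ := by
  rw [diffInt, diffSumCut, ← ENNReal.mul_rpow_of_nonneg _ _ (by positivity)]
  refine ENNReal.rpow_le_rpow ?_ (by positivity)
  let I (δ : ℝ) (k : ℕ) : Set ℝ := Set.Ioo (2 ^ k * δ) (2 ^ (k + 1) * δ) ∩ Set.Ioo δ 1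
  let v (ε δ : ℝ) (k : ℕ) : ℝ≥0∞ :=
    if 2 ^ k * δ < 1 / 2 then ENNReal.ofReal ((2 : ℝ) ^ (-(k * ε))) else 0
  have e (k k' : ℕ) : (if 2 ^ k * δ₁ < 1 / 2 ∧ 2 ^ k' * δ₂ < 1 / 2 then
      (ENNReal.ofReal ((2 : ℝ) ^ (-(k * ε₁))) * ENNReal.ofReal ((2 : ℝ) ^ (-(k' * ε₂))) *
        N (2 ^ k * δ₁) (2 ^ k' * δ₂)) ^ τ else 0) =
      (v ε₁ δ₁ k * v ε₂ δ₂ k' * N (2 ^ k * δ₁) (2 ^ k' * δ₂)) ^ τ := by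
    by_cases h₁ : 2 ^ k * δ₁ < 1 / 2 <;> by_cases h₂ : 2 ^ k' * δ₂ < 1 / 2 <;>
      simp only [v, h₁, h₂, and_self, and_true, and_false, if_true, if_false, zero_mul,
        mul_zero, ENNReal.zero_rpow_of_pos hτ]
  simp only [e]
  have hw {ε δ : ℝ} (hε : 0 < ε) (hδ : 0 < δ) (k : ℕ) : ∀ x ∈ I δ k,
      ENNReal.ofReal ((1 / 2 ^ (k + 1)) ^ (ε * τ) / (2 ^ (k + 1) * δ)) ≤
      ENNReal.ofReal ((δ / x) ^ (ε * τ) / x) := fun x hx => by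
    have := hδ.trans hx.2.1
    refine ENNReal.ofReal_le_ofReal (div_le_div₀ (by positivity) (rpow_le_rpow (by positivity) ?_
      (by positivity)) this hx.1.2.le)
    rw [div_le_div_iff₀ (by positivity) this]
    linarith [hx.1.2]
  have hg {ε δ : ℝ} (hδ : 0 < δ) (k : ℕ) : v ε δ k ^ τ ≤ ENNReal.ofReal (2 ^ (ε * τ + 1)) *
      (ENNReal.ofReal ((1 / 2 ^ (k + 1)) ^ (ε * τ) / (2 ^ (k + 1) * δ)) * volume (I δ k)) := by
    by_cases h : 2 ^ k * δ < 1 / 2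
    · have hI : I δ k = Set.Ioo (2 ^ k * δ) (2 ^ (k + 1) * δ) :=
        Set.inter_eq_left.2 (Set.Ioo_subset_Ioo (le_mul_of_one_le_left hδ.le
          (one_le_pow₀ one_le_two)) (by rw [pow_succ]; linarith))
      simp only [v, h, if_true]
      rw [hI, Real.volume_Ioo, two_pow_mul_sub, ENNReal.ofReal_rpow_of_nonneg (by positivity) hτ.le,
        ← ENNReal.ofReal_mul (by positivity), ← ENNReal.ofReal_mul (by positivity),
        two_rpow_neg_mul, ← rpow_mul (by positivity), rpow_add_one two_ne_zero]
      refine ENNReal.ofReal_le_ofReal (le_of_eq ?_)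
      rw [show (1 : ℝ) / 2 ^ k = 2 * (1 / 2 ^ (k + 1)) by rw [pow_succ]; field_simp,
        mul_rpow two_pos.le (by positivity), pow_succ]
      field_simp
    · simp only [v, h, if_false, ENNReal.zero_rpow_of_pos hτ, zero_le]
  exact tsum_tsum_le_lintegral_lintegral (fun _ => measurableSet_Ioo.inter measurableSet_Ioo)
    (fun _ => measurableSet_Ioo.inter measurableSet_Ioo)
    (fun i j h => (pairwise_disjoint_two_pow hδ₁.le h).mono Set.inter_subset_left
      Set.inter_subset_left)
    (fun i j h => (pairwise_disjoint_two_pow hδ₂.le h).mono Set.inter_subset_left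
      Set.inter_subset_left)
    (fun _ => Set.inter_subset_right) (fun _ => Set.inter_subset_right) hτ.le
    (fun k x hx => by have := hδ₁.trans hx.2.1; positivity)
    (hw hε₁ hδ₁) (hw hε₂ hδ₂) (hg hδ₁) (hg hδ₂)
    fun k k' x hx y hy => hN _ _ _ _ hx.1.1.le hy.1.1.le

/-! ### Fractional differences in `L_p` of the torus -/

section Torus

open UnitAddTorus (mFourier)

/-- The two-dimensional torus with periods one. -/
abbrev Torus : Type := UnitAddTorus (Fin 2)

instance : IsProbabilityMeasure (volume : Measure UnitAddCircle) := ⟨UnitAddCircle.measure_univ⟩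

instance : IsProbabilityMeasure (volume : Measure Torus) :=
  inferInstanceAs (IsProbabilityMeasure (Measure.pi fun _ : Fin 2 => (volume : Measure UnitAddCircle)))

/-- The point of the torus with coordinate `i` equal to `h / 2π` and the other one zero. -/
def stepPt (i : Fin 2) (h : ℝ) : Torus := Pi.single i ((h / (2 * π) : ℝ) : UnitAddCircle)

lemma mFourier_add_apply (m : Fin 2 → ℤ) (x y : Torus) :
    mFourier m (x + y) = mFourier m x * mFourier m y := by
  simp only [mFourier, ContinuousMap.coe_mk, Pi.add_apply, fourier_apply, smul_add,
    AddCircle.toCircle_add, Circle.coe_mul, Finset.prod_mul_distrib]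

lemma mFourier_stepPt (m : Fin 2 → ℤ) (i : Fin 2) (h : ℝ) :
    mFourier m (stepPt i h) = Complex.exp ((h * (m i : ℝ) : ℝ) * Complex.I) := by
  have e (n : ℤ) (x : ℝ) : (fourier n ((x / (2 * π) : ℝ) : UnitAddCircle) : ℂ) =
      Complex.exp ((x * (n : ℝ) : ℝ) * Complex.I) := by
    rw [fourier_coe_apply]
    congr 1
    push_cast
    field_simp
  simp only [mFourier, ContinuousMap.coe_mk]
  rw [Finset.prod_eq_single i]
  · rw [stepPt, Pi.single_eq_same, e]
  · intro j _ hj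
    rw [stepPt, Pi.single_eq_of_ne hj, fourier_eval_zero]
  · simp

lemma norm_mFourier_apply (m : Fin 2 → ℤ) (x : Torus) : ‖mFourier m x‖ = 1 := by
  simp only [mFourier, fourier_apply, ContinuousMap.coe_mk, norm_prod, Circle.norm_coe,
    Finset.prod_const_one]

lemma integral_mul_mFourier_eq_zero {ψ : Torus → ℂ} {i : Fin 2}
    (hψ : ∀ t h, ψ (t + stepPt i h) = ψ t) {m : Fin 2 → ℤ} (hm : m i ≠ 0) :
    ∫ t, ψ t * mFourier m t = 0 := by
  have h := integral_add_right_eq_self (μ := (volume : Measure Torus)) (fun t => ψ t * mFourier m t) (stepPt i (π / m i))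
  have hm' : (m i : ℝ) ≠ 0 := by exact_mod_cast hm
  have e : mFourier m (stepPt i (π / m i)) = -1 := by
    rw [mFourier_stepPt, div_mul_cancel₀ _ hm', Complex.exp_pi_mul_I]
  simp only [hψ, mFourier_add_apply, e, mul_neg, mul_one, integral_neg] at h
  exact self_eq_neg.1 h.symm

variable {q : ℝ≥0∞} [Fact (1 ≤ q)]

variable (q) in
/-- The space of `q`-integrable complex functions on the torus. -/
abbrev LpT : Type := Lp ℂ q (volume : Measure Torus)

variable (q) in
/-- The monomials as elements of `LpT q`. -/
def expLp (m : Fin 2 → ℤ) : LpT q := ContinuousMap.toLp q volume ℂ (mFourier m)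

lemma coeFn_expLp (m : Fin 2 → ℤ) : expLp q m =ᵐ[volume] mFourier m :=
  ContinuousMap.coeFn_toLp volume (mFourier m)

variable (q) in
/-- The trigonometric polynomial with given coefficients. -/
def poly : ((Fin 2 → ℤ) →₀ ℂ) →ₗ[ℂ] LpT q := Finsupp.linearCombination ℂ (expLp q)

lemma poly_single (m : Fin 2 → ℤ) (a : ℂ) : poly q (Finsupp.single m a) = a • expLp q m :=
  Finsupp.linearCombination_single ..

lemma denseRange_poly (hq : q ≠ ⊤) : DenseRange (poly q) := by
  have h := (ContinuousMap.toLp_denseRange ℂ (volume : Measure Torus) ℂ hq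
    ).topologicalClosure_map_submodule UnitAddTorus.span_mFourier_closure_eq_top
  rw [Submodule.map_span, ← Set.range_comp] at h
  rw [DenseRange, dense_iff_closure_eq, ← LinearMap.coe_range, poly, Finsupp.range_linearCombination,
    ← Submodule.topologicalClosure_coe]
  exact congrArg _ h

lemma poly_ext {X : Type*} [NormedAddCommGroup X] [NormedSpace ℂ X] (hq : q ≠ ⊤)
    {f g : LpT q →L[ℂ] X} (h : ∀ m, f (expLp q m) = g (expLp q m)) : f = g := by
  refine ContinuousLinearMap.coeFn_injective ((denseRange_poly hq).equalizer f.continuous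
    g.continuous (funext fun c => ?_))
  have e : f.toLinearMap ∘ₗ poly q = g.toLinearMap ∘ₗ poly q := Finsupp.lhom_ext fun m a => by
    simp only [LinearMap.comp_apply, poly_single, map_smul, ContinuousLinearMap.coe_coe, h]
  exact LinearMap.congr_fun e c

lemma integrable_mul_LpT {ψ : Torus → ℂ} (hψ : Measurable ψ) (h1 : ∀ t, ‖ψ t‖ ≤ 1) (F : LpT q) :
    Integrable (fun t => ψ t * F t) :=
  ((Lp.memLp F).integrable Fact.out).bdd_mul hψ.aestronglyMeasurable (.of_forall h1)

variable (q) in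
/-- The functional given by integration against a bounded function. -/
def pairing (ψ : Torus → ℂ) (hψ : Measurable ψ) (h1 : ∀ t, ‖ψ t‖ ≤ 1) : LpT q →L[ℂ] ℂ :=
  LinearMap.mkContinuous
    { toFun := fun F => ∫ t, ψ t * F t
      map_add' := fun F G => by
        rw [← integral_add (integrable_mul_LpT hψ h1 F) (integrable_mul_LpT hψ h1 G)]
        refine integral_congr_ae ?_
        filter_upwards [Lp.coeFn_add F G] with t ht
        rw [ht, Pi.add_apply, mul_add]
      map_smul' := fun a F => by
        rw [RingHom.id_apply, smul_eq_mul, ← integral_const_mul]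
        refine integral_congr_ae ?_
        filter_upwards [Lp.coeFn_smul a F] with t ht
        rw [ht, Pi.smul_apply, smul_eq_mul]
        ring } 1 fun F => by
    have h : ‖∫ t, ψ t * F t‖ₑ ≤ ‖F‖ₑ := by
      refine (enorm_integral_le_lintegral_enorm _).trans ?_
      calc _ ≤ ∫⁻ t, ‖F t‖ₑ := lintegral_mono fun t => by
            rw [enorm_mul]
            refine mul_le_of_le_one_left' ?_
            rw [← ofReal_norm, ← ENNReal.ofReal_one]
            exact ENNReal.ofReal_le_ofReal (h1 t)
        _ = eLpNorm F 1 volume := eLpNorm_one_eq_lintegral_enorm.symm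
        _ ≤ eLpNorm F q volume := eLpNorm_le_eLpNorm_of_exponent_le Fact.out
            (Lp.aestronglyMeasurable F)
        _ = ‖F‖ₑ := (Lp.enorm_def F).symm
    rw [one_mul]
    exact enorm_le_iff_norm_le.1 h

lemma pairing_apply {ψ : Torus → ℂ} (hψ : Measurable ψ) (h1 : ∀ t, ‖ψ t‖ ≤ 1) (F : LpT q) :
    pairing q ψ hψ h1 F = ∫ t, ψ t * F t := rfl

lemma pairing_expLp {ψ : Torus → ℂ} (hψ : Measurable ψ) (h1 : ∀ t, ‖ψ t‖ ≤ 1) (m : Fin 2 → ℤ) :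
    pairing q ψ hψ h1 (expLp q m) = ∫ t, ψ t * mFourier m t := by
  rw [pairing_apply]
  refine integral_congr_ae ?_
  filter_upwards [coeFn_expLp (q := q) m] with t ht
  rw [ht]

variable (q) in
/-- The Fourier coefficients. -/
def coef (m : Fin 2 → ℤ) : LpT q →L[ℂ] ℂ :=
  pairing q (mFourier (-m)) (mFourier (-m)).continuous.measurable
    fun t => (norm_mFourier_apply _ t).le

lemma coef_expLp (m n : Fin 2 → ℤ) : coef q m (expLp q n) = if n = m then 1 else 0 := by
  rw [coef, pairing_expLp]
  simp only [← UnitAddTorus.mFourier_add]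
  split_ifs with h
  · simp [h, UnitAddTorus.mFourier_zero]
  · obtain ⟨i, hi⟩ := Function.ne_iff.1 h
    have := integral_mul_mFourier_eq_zero (ψ := fun _ => 1) (i := i) (fun _ _ => rfl)
      (m := -m + n) (by simp only [Pi.add_apply, Pi.neg_apply]; omega)
    simpa only [one_mul] using this

lemma coef_poly (m : Fin 2 → ℤ) (c : (Fin 2 → ℤ) →₀ ℂ) : coef q m (poly q c) = c m := by
  have e : (coef q m).toLinearMap ∘ₗ poly q = Finsupp.lapply m := Finsupp.lhom_ext fun n a => by
    simp only [LinearMap.comp_apply, poly_single, map_smul, ContinuousLinearMap.coe_coe, coef_expLp,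
      Finsupp.lapply_apply, Finsupp.single_apply, smul_eq_mul, mul_ite, mul_one, mul_zero]
  exact LinearMap.congr_fun e c

end Torus

section Torus

open UnitAddTorus (mFourier)

variable {q : ℝ≥0∞} [Fact (1 ≤ q)]

lemma measurePreserving_add_stepPt (i : Fin 2) (h : ℝ) :
    MeasurePreserving (fun t : Torus => t + stepPt i h) volume volume :=
  measurePreserving_add_right volume _

variable (q) in
/-- Translation by `h / 2π` in the coordinate `i`. -/
def shift (i : Fin 2) (h : ℝ) : LpT q →ₗᵢ[ℂ] LpT q :=
  Lp.compMeasurePreservingₗᵢ ℂ _ (measurePreserving_add_stepPt i h)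

lemma coeFn_shift (i : Fin 2) (h : ℝ) (F : LpT q) :
    shift q i h F =ᵐ[volume] fun t => F (t + stepPt i h) :=
  Lp.coeFn_compMeasurePreserving F (measurePreserving_add_stepPt i h)

lemma shift_expLp (i : Fin 2) (h : ℝ) (m : Fin 2 → ℤ) :
    shift q i h (expLp q m) = Complex.exp ((h * (m i : ℝ) : ℝ) * Complex.I) • expLp q m := by
  refine Lp.ext ?_
  filter_upwards [coeFn_shift i h (expLp q m), Lp.coeFn_smul (Complex.exp ((h * (m i : ℝ) : ℝ) *
    Complex.I)) (expLp q m), coeFn_expLp (q := q) m, (measurePreserving_add_stepPt i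
    h).quasiMeasurePreserving.ae (coeFn_expLp (q := q) m)] with t h1 h2 h3 h4
  rw [h1, h2, h4, Pi.smul_apply, h3, mFourier_add_apply, mFourier_stepPt, smul_eq_mul, mul_comm]

lemma linearCombination_symbol_smul {ι X : Type*} [NormedAddCommGroup X] [NormedSpace ℂ X]
    {v : ι → X} {T : X →L[ℂ] X} {σ : ι → ℂ} (h : ∀ m, T (v m) = σ m • v m) (c : ι →₀ ℂ) :
    Finsupp.linearCombination ℂ v (σ • c) = T (Finsupp.linearCombination ℂ v c) := by
  rw [map_symbol_smul]
  simp only [Finsupp.linearCombination_single]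
  simp only [Finsupp.linearCombination_apply, Finsupp.sum, map_sum, map_smul, h]
  exact Finset.sum_congr rfl fun m _ => smul_comm _ _ _

lemma modulationInvariant_poly (i : Fin 2) :
    ModulationInvariant (poly q) (fun m => (m i : ℝ)) := fun s c => by
  rw [poly, linearCombination_symbol_smul (T := (shift q i s).toContinuousLinearMap) (shift_expLp i s)]
  exact (shift q i s).norm_map _

variable (q) in
/-- The fractional difference operator of order `γ` and step `h` in the coordinate `i`. -/
def fdiff (i : Fin 2) (γ h : ℝ) : LpT q →L[ℂ] LpT q :=
  ∑' ν : ℕ, (dcoef γ ν : ℂ) • (shift q i ((γ - ν) * h)).toContinuousLinearMap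

lemma norm_dcoef_smul_shift_le (i : Fin 2) (γ h : ℝ) (ν : ℕ) :
    ‖(dcoef γ ν : ℂ) • (shift q i ((γ - ν) * h)).toContinuousLinearMap‖ ≤ |dcoef γ ν| := by
  rw [norm_smul, Complex.norm_real, Real.norm_eq_abs]
  exact mul_le_of_le_one_right (abs_nonneg _) (LinearIsometry.norm_toContinuousLinearMap_le _)

lemma summable_fdiff (i : Fin 2) {γ : ℝ} (hγ : 0 < γ) (h : ℝ) :
    Summable fun ν : ℕ => (dcoef γ ν : ℂ) • (shift q i ((γ - ν) * h)).toContinuousLinearMap :=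
  .of_norm_bounded (summable_abs_dcoef hγ) (norm_dcoef_smul_shift_le i γ h)

lemma hasSum_fdiff (i : Fin 2) {γ : ℝ} (hγ : 0 < γ) (h : ℝ) (F : LpT q) :
    HasSum (fun ν : ℕ => (dcoef γ ν : ℂ) • shift q i ((γ - ν) * h) F) (fdiff q i γ h F) := by
  have e := (ContinuousLinearMap.apply ℂ (LpT q) F).hasSum (summable_fdiff (q := q) i hγ h).hasSum
  exact e

lemma norm_fdiff_le (i : Fin 2) {γ : ℝ} (hγ : 0 < γ) (h : ℝ) (F : LpT q) :
    ‖fdiff q i γ h F‖ ≤ (∑' ν, |dcoef γ ν|) * ‖F‖ :=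
  (ContinuousLinearMap.le_opNorm _ F).trans (mul_le_mul_of_nonneg_right
    (tsum_of_norm_bounded (summable_abs_dcoef hγ).hasSum (norm_dcoef_smul_shift_le i γ h))
    (norm_nonneg F))

lemma fdiff_expLp (i : Fin 2) {γ : ℝ} (hγ : 0 < γ) (h : ℝ) (m : Fin 2 → ℤ) :
    fdiff q i γ h (expLp q m) = dsym γ (h * (m i : ℝ)) • expLp q m := by
  refine (hasSum_fdiff i hγ h _).unique ?_
  have e := (summable_dsym hγ (h * (m i : ℝ))).hasSum.smul_const (expLp q m)
  simp only [mul_smul] at e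
  simp only [shift_expLp, mul_assoc]
  exact e

lemma poly_dsym_smul (i : Fin 2) {γ : ℝ} (hγ : 0 < γ) (h : ℝ) (c : (Fin 2 → ℤ) →₀ ℂ) :
    poly q ((fun m : Fin 2 → ℤ => dsym γ (h * (m i : ℝ))) • c) = fdiff q i γ h (poly q c) :=
  linearCombination_symbol_smul (fdiff_expLp i hγ h) c

lemma coef_of_diagonal (hq : q ≠ ⊤) {T : LpT q →L[ℂ] LpT q} {σ : (Fin 2 → ℤ) → ℂ}
    (h : ∀ m, T (expLp q m) = σ m • expLp q m) (m : Fin 2 → ℤ) (F : LpT q) :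
    coef q m (T F) = σ m * coef q m F := by
  have := poly_ext hq (f := coef q m ∘L T) (g := σ m • coef q m) fun n => by
    simp only [ContinuousLinearMap.comp_apply, h, map_smul, coef_expLp,
      _root_.smul_apply, smul_eq_mul]
    split_ifs with e <;> simp [e]
  exact DFunLike.congr_fun this F

lemma coef_fdiff (hq : q ≠ ⊤) (i : Fin 2) {γ : ℝ} (hγ : 0 < γ) (h : ℝ) (m : Fin 2 → ℤ)
    (F : LpT q) : coef q m (fdiff q i γ h F) = dsym γ (h * (m i : ℝ)) * coef q m F :=
  coef_of_diagonal (σ := fun m => dsym γ (h * (m i : ℝ))) hq (fdiff_expLp i hγ h) m F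

/-- The symbol of a smooth cut-off at frequencies of size `n`. -/
def cutSym (n : ℕ) (m : Fin 2 → ℤ) : ℂ := chi (1 / (n + 1) * (m 0 : ℝ)) * chi (1 / (n + 1) * (m 1 : ℝ))

/-- The square of integer points which contains the support of `cutSym n`. -/
def cutBox (n : ℕ) : Finset (Fin 2 → ℤ) := Fintype.piFinset fun _ => Finset.Icc (-(n + 1 : ℤ)) (n + 1)

lemma abs_lt_of_chi_ne_zero {n : ℕ} {a : ℤ} (h : chi (1 / (n + 1) * (a : ℝ)) ≠ 0) :
    a ∈ Finset.Icc (-(n + 1 : ℤ)) (n + 1) := by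
  have h1 := lt_of_not_ge (mt chi_eq_zero h)
  have hn : (0 : ℝ) < n + 1 := by positivity
  rw [abs_mul, abs_of_pos (by positivity : (0 : ℝ) < 1 / (n + 1)), one_div_mul_eq_div,
    div_lt_iff₀ hn] at h1
  rw [Finset.mem_Icc, ← abs_le]
  have : |(a : ℝ)| ≤ (n + 1 : ℝ) := by linarith
  exact_mod_cast this

lemma mem_cutBox {n : ℕ} {m : Fin 2 → ℤ} (h : cutSym n m ≠ 0) : m ∈ cutBox n := by
  rw [cutBox, Fintype.mem_piFinset, Fin.forall_fin_two]
  exact ⟨abs_lt_of_chi_ne_zero (left_ne_zero_of_mul h), abs_lt_of_chi_ne_zero (right_ne_zero_of_mul h)⟩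

/-- The Fourier coefficients, smoothly cut off at frequencies of size `n`. -/
def cut (n : ℕ) (F : LpT q) : (Fin 2 → ℤ) →₀ ℂ :=
  Finsupp.onFinset (cutBox n) (fun m => cutSym n m * coef q m F) fun _ h =>
    mem_cutBox (left_ne_zero_of_mul h)

lemma cut_apply (n : ℕ) (F : LpT q) (m : Fin 2 → ℤ) : cut n F m = cutSym n m * coef q m F := rfl

lemma cut_fdiff (hq : q ≠ ⊤) (n : ℕ) (i : Fin 2) {γ : ℝ} (hγ : 0 < γ) (h : ℝ) (F : LpT q) :
    cut n (fdiff q i γ h F) = (fun m : Fin 2 → ℤ => dsym γ (h * (m i : ℝ))) • cut n F := by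
  ext m
  rw [cut_apply, coef_fdiff hq i hγ, symbol_smul_apply, cut_apply, mul_left_comm]

lemma cut_sub (n : ℕ) (F G : LpT q) : cut n (F - G) = cut n F - cut n G := by
  ext m
  rw [cut_apply, Finsupp.sub_apply, cut_apply, cut_apply, map_sub, mul_sub]

lemma continuous_poly_cut (n : ℕ) : Continuous fun F : LpT q => poly q (cut n F) := by
  simp only [poly, cut, Finsupp.linearCombination_onFinset]
  fun_prop

lemma cut_poly (n : ℕ) (c : (Fin 2 → ℤ) →₀ ℂ) : cut n (poly q c) = cutSym n • c := by
  ext m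
  rw [cut_apply, coef_poly, symbol_smul_apply]

lemma exists_cut_bound (hq : q ≠ ⊤) :
    ∃ A : ℝ, 0 < A ∧ ∀ n (F : LpT q), ‖poly q (cut n F)‖ ≤ A * ‖F‖ := by
  obtain ⟨A, hA, h0⟩ := isTest_chi.multBound (modulationInvariant_poly (q := q) 0)
  obtain ⟨B, hB, h1⟩ := isTest_chi.multBound (modulationInvariant_poly (q := q) 1)
  refine ⟨A * B, mul_pos hA hB, fun n F => ?_⟩
  refine (denseRange_poly hq).induction_on F (isClosed_le (continuous_poly_cut n).norm
    (by fun_prop)) fun c => ?_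
  rw [cut_poly]
  exact ((h0 (1 / (n + 1))).comp (h1 (1 / (n + 1)))).2 c

lemma cutSym_eq_one (m : Fin 2 → ℤ) : ∀ᶠ n in Filter.atTop, cutSym n m = 1 := by
  have h (a : ℤ) : ∀ᶠ n : ℕ in Filter.atTop, chi (1 / (n + 1) * (a : ℝ)) = 1 := by
    have : Filter.Tendsto (fun n : ℕ => |1 / ((n : ℝ) + 1) * (a : ℝ)|) Filter.atTop (nhds 0) := by
      simpa using (tendsto_one_div_add_atTop_nhds_zero_nat.mul_const (a : ℝ)).abs
    filter_upwards [this.eventually_le_const (by norm_num : (0 : ℝ) < 1 / 4)] with n hn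
    exact chi_eq_one hn
  filter_upwards [h (m 0), h (m 1)] with n h0 h1
  rw [cutSym, h0, h1, mul_one]

lemma tendsto_poly_cut (hq : q ≠ ⊤) (F : LpT q) :
    Filter.Tendsto (fun n => poly q (cut n F)) Filter.atTop (nhds F) := by
  obtain ⟨A, hA, h⟩ := exists_cut_bound hq
  rw [Metric.tendsto_atTop']
  intro ε hε
  obtain ⟨c, hc⟩ := Metric.denseRange_iff.1 (denseRange_poly hq) F (ε / (A + 1)) (by positivity)
  have h1 : ∀ᶠ n in Filter.atTop, ∀ m ∈ c.support, cutSym n m = 1 :=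
    (Filter.eventually_all_finset _).2 fun m _ => cutSym_eq_one m
  obtain ⟨N, hN⟩ := Filter.eventually_atTop.1 h1
  refine ⟨N, fun n hn => ?_⟩
  have e : poly q (cut n (poly q c)) = poly q c := by
    rw [cut_poly]
    congr 1
    ext m
    rw [symbol_smul_apply]
    by_cases hm : m ∈ c.support
    · rw [hN n hn.le m hm, one_mul]
    · rw [Finsupp.notMem_support_iff.1 hm, mul_zero]
  rw [dist_eq_norm] at hc ⊢
  calc ‖poly q (cut n F) - F‖ = ‖poly q (cut n (F - poly q c)) - (F - poly q c)‖ := by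
        rw [cut_sub, map_sub, e, sub_sub_sub_cancel_right]
    _ ≤ A * ‖F - poly q c‖ + ‖F - poly q c‖ := (norm_sub_le _ _).trans (add_le_add_left (h n _) _)
    _ = (A + 1) * ‖F - poly q c‖ := by ring
    _ < (A + 1) * (ε / (A + 1)) := mul_lt_mul_of_pos_left hc (by positivity)
    _ = ε := by field_simp

lemma eq_of_coef_eq (hq : q ≠ ⊤) {F G : LpT q} (h : ∀ m, coef q m F = coef q m G) : F = G := by
  have e (n : ℕ) : cut n F = cut n G := by ext m; rw [cut_apply, cut_apply, h]
  refine tendsto_nhds_unique (tendsto_poly_cut hq F) ?_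
  simpa only [e] using tendsto_poly_cut hq G

end Torus

/-! ### Limits of weighted sums -/

section Sums

open Filter Topology

lemma tsum_tsum_le_of_tendsto {a : ℕ → ℕ → ℝ≥0∞} {a' : ℕ → ℕ → ℕ → ℝ≥0∞}
    (h : ∀ k k', Tendsto (fun n => a' n k k') atTop (𝓝 (a k k'))) {B : ℝ≥0∞}
    (hb : ∀ n, ∑' k, ∑' k', a' n k k' ≤ B) : ∑' k, ∑' k', a k k' ≤ B := by
  rw [← ENNReal.tsum_prod, ENNReal.tsum_eq_iSup_sum]
  refine iSup_le fun s => le_of_tendsto' (tendsto_finsetSum s fun p _ => h p.1 p.2) fun n => ?_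
  refine le_trans ?_ (hb n)
  rw [← ENNReal.tsum_prod (f := a' n)]
  exact ENNReal.sum_le_tsum s

lemma tendsto_tsum_tsum_zero {ι : Type*} {l : Filter ι} [l.IsCountablyGenerated]
    {a : ι → ℕ → ℕ → ℝ≥0∞} {b : ℕ → ℕ → ℝ≥0∞}
    (h : ∀ k k', Tendsto (fun i => a i k k') l (𝓝 0)) (hb : ∀ i k k', a i k k' ≤ b k k')
    (hb' : ∑' k, ∑' k', b k k' ≠ ⊤) : Tendsto (fun i => ∑' k, ∑' k', a i k k') l (𝓝 0) := by
  have e (c : ℕ → ℕ → ℝ≥0∞) :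
      ∑' k, ∑' k', c k k' = ∫⁻ x : ℕ × ℕ, c x.1 x.2 ∂Measure.count := by
    rw [lintegral_count, ENNReal.tsum_prod]
  simp only [e] at hb' ⊢
  have := tendsto_lintegral_filter_of_dominated_convergence (μ := Measure.count)
    (F := fun i (x : ℕ × ℕ) => a i x.1 x.2) (f := fun _ => 0) (l := l)
    (fun x : ℕ × ℕ => b x.1 x.2) (.of_forall fun _ => .of_discrete)
    (.of_forall fun i => .of_forall fun x => hb i x.1 x.2) hb'
    (.of_forall fun x => h x.1 x.2)
  simpa using this

lemma tsum_tsum_rpow_le {a b : ℕ → ℕ → ℝ≥0∞} {A : ℝ≥0∞} {τ : ℝ} (hτ : 0 < τ)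
    (h : ∀ k k', a k k' ≤ A ^ τ * b k k') :
    (∑' k, ∑' k', a k k') ^ (1 / τ) ≤ A * (∑' k, ∑' k', b k k') ^ (1 / τ) := by
  calc _ ≤ (A ^ τ * ∑' k, ∑' k', b k k') ^ (1 / τ) := by
        refine ENNReal.rpow_le_rpow ?_ (by positivity)
        simp only [← ENNReal.tsum_mul_left]
        exact ENNReal.tsum_le_tsum fun k => ENNReal.tsum_le_tsum fun k' => h k k'
    _ = _ := by
        rw [ENNReal.mul_rpow_of_nonneg _ _ (by positivity), one_div, ENNReal.rpow_rpow_inv hτ.ne']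

variable {N N' : ℝ → ℝ → ℝ≥0∞} {A : ℝ≥0∞} {a₁ a₂ τ : ℝ}

lemma weight_mul_rpow_le {u v x y : ℝ≥0∞} (h : x ≤ A * y) (hτ : 0 < τ) :
    (u * v * x) ^ τ ≤ A ^ τ * (u * v * y) ^ τ := by
  rw [← ENNReal.mul_rpow_of_nonneg _ _ hτ.le, mul_left_comm]
  exact ENNReal.rpow_le_rpow (mul_le_mul_right h _) hτ.le

lemma normSum_le_mul (h : ∀ x y, N x y ≤ A * N' x y) (hτ : 0 < τ) (δ₁ δ₂ : ℝ) :
    normSum N a₁ a₂ τ δ₁ δ₂ ≤ A * normSum N' a₁ a₂ τ δ₁ δ₂ :=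
  tsum_tsum_rpow_le hτ fun _ _ => weight_mul_rpow_le (h _ _) hτ

lemma diffSumCut_le_mul (h : ∀ x y, N x y ≤ A * N' x y) (hτ : 0 < τ) (δ₁ δ₂ : ℝ) :
    diffSumCut N a₁ a₂ τ δ₁ δ₂ ≤ A * diffSumCut N' a₁ a₂ τ δ₁ δ₂ :=
  tsum_tsum_rpow_le hτ fun _ _ => by
    split_ifs
    · exact weight_mul_rpow_le (h _ _) hτ
    · exact zero_le

lemma tendsto_weight_mul_rpow {ι : Type*} {l : Filter ι} {f : ι → ℝ≥0∞} {y : ℝ≥0∞}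
    (h : Tendsto f l (𝓝 y)) (u v : ℝ) :
    Tendsto (fun i => (ENNReal.ofReal u * ENNReal.ofReal v * f i) ^ τ) l
      (𝓝 ((ENNReal.ofReal u * ENNReal.ofReal v * y) ^ τ)) :=
  (ENNReal.Tendsto.const_mul h (.inr (by finiteness))).ennrpow_const τ

lemma tsum_tsum_rpow_le_of_tendsto {a : ℕ → ℕ → ℝ≥0∞} {a' : ℕ → ℕ → ℕ → ℝ≥0∞} (hτ : 0 < τ)
    (h : ∀ k k', Tendsto (fun n => a' n k k') atTop (𝓝 (a k k'))) {B : ℝ≥0∞}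
    (hb : ∀ n, (∑' k, ∑' k', a' n k k') ^ (1 / τ) ≤ B) : (∑' k, ∑' k', a k k') ^ (1 / τ) ≤ B := by
  simp only [one_div, ENNReal.rpow_inv_le_iff hτ] at hb ⊢
  exact tsum_tsum_le_of_tendsto h hb

variable {M : ℕ → ℝ → ℝ → ℝ≥0∞} {B : ℝ≥0∞} {δ₁ δ₂ : ℝ}

lemma normSum_le_of_tendsto (hτ : 0 < τ)
    (h : ∀ x y, Tendsto (fun n => M n x y) atTop (𝓝 (N x y)))
    (hb : ∀ n, normSum (M n) a₁ a₂ τ δ₁ δ₂ ≤ B) : normSum N a₁ a₂ τ δ₁ δ₂ ≤ B :=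
  tsum_tsum_rpow_le_of_tendsto hτ (fun _ _ => tendsto_weight_mul_rpow (h _ _) _ _) hb

lemma diffSum_le_of_tendsto (hτ : 0 < τ)
    (h : ∀ x y, Tendsto (fun n => M n x y) atTop (𝓝 (N x y)))
    (hb : ∀ n, diffSum (M n) a₁ a₂ τ δ₁ δ₂ ≤ B) : diffSum N a₁ a₂ τ δ₁ δ₂ ≤ B :=
  tsum_tsum_rpow_le_of_tendsto hτ (fun _ _ => tendsto_weight_mul_rpow (h _ _) _ _) hb

lemma tendsto_normSum_zero {ι : Type*} {l : Filter ι} [l.IsCountablyGenerated]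
    {M : ι → ℝ → ℝ → ℝ≥0∞} (hτ : 0 < τ) (h : ∀ x y, Tendsto (fun i => M i x y) l (𝓝 0))
    (hA : A ≠ ⊤) (hb : ∀ i x y, M i x y ≤ A * N x y) (hN : normSum N a₁ a₂ τ δ₁ δ₂ ≠ ⊤) :
    Tendsto (fun i => normSum (M i) a₁ a₂ τ δ₁ δ₂) l (𝓝 0) := by
  have hN' : ∑' k : ℕ, ∑' k' : ℕ, A ^ τ * (ENNReal.ofReal ((δ₁ / 2 ^ k) ^ (-a₁)) *
      ENNReal.ofReal ((δ₂ / 2 ^ k') ^ (-a₂)) * N (δ₁ / 2 ^ k) (δ₂ / 2 ^ k')) ^ τ ≠ ⊤ := by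
    simp only [ENNReal.tsum_mul_left]
    refine ENNReal.mul_ne_top (by finiteness) fun e => hN ?_
    rw [normSum, e, ENNReal.top_rpow_of_pos (by positivity)]
  have := (tendsto_tsum_tsum_zero (l := l) (fun k k' => ?_) (fun i k k' => weight_mul_rpow_le
    (u := ENNReal.ofReal ((δ₁ / 2 ^ k) ^ (-a₁))) (v := ENNReal.ofReal ((δ₂ / 2 ^ k') ^ (-a₂)))
    (hb i (δ₁ / 2 ^ k) (δ₂ / 2 ^ k')) hτ) hN').ennrpow_const (1 / τ)
  · simp only [normSum]
    rwa [ENNReal.zero_rpow_of_pos (by positivity)] at this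
  · have := tendsto_weight_mul_rpow (τ := τ) (h (δ₁ / 2 ^ k) (δ₂ / 2 ^ k')) ((δ₁ / 2 ^ k) ^ (-a₁))
      ((δ₂ / 2 ^ k') ^ (-a₂))
    rwa [mul_zero, ENNReal.zero_rpow_of_pos hτ] at this

end Sums

/-! ### The mixed modulus of smoothness in `L_p` of the torus -/

section Torus

open Filter Topology

variable {q : ℝ≥0∞} [Fact (1 ≤ q)]

/-- The mixed modulus of smoothness of an element of `LpT q`. -/
def lpMod (γ₁ γ₂ : ℝ) (F : LpT q) (t₁ t₂ : ℝ) : ℝ≥0∞ :=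
  ⨆ (h₁ : ℝ) (_ : |h₁| ≤ t₁) (h₂ : ℝ) (_ : |h₂| ≤ t₂), ‖fdiff q 0 γ₁ h₁ (fdiff q 1 γ₂ h₂ F)‖ₑ

lemma lpMod_le_iff {γ₁ γ₂ t₁ t₂ : ℝ} {F : LpT q} {B : ℝ≥0∞} : lpMod γ₁ γ₂ F t₁ t₂ ≤ B ↔
    ∀ h₁, |h₁| ≤ t₁ → ∀ h₂, |h₂| ≤ t₂ → ‖fdiff q 0 γ₁ h₁ (fdiff q 1 γ₂ h₂ F)‖ₑ ≤ B := by
  simp only [lpMod, iSup_le_iff]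

lemma le_lpMod {γ₁ γ₂ t₁ t₂ h₁ h₂ : ℝ} (F : LpT q) (hh₁ : |h₁| ≤ t₁) (hh₂ : |h₂| ≤ t₂) :
    ‖fdiff q 0 γ₁ h₁ (fdiff q 1 γ₂ h₂ F)‖ₑ ≤ lpMod γ₁ γ₂ F t₁ t₂ :=
  lpMod_le_iff.1 le_rfl h₁ hh₁ h₂ hh₂

lemma lpMod_mono (γ₁ γ₂ : ℝ) (F : LpT q) (x y x' y' : ℝ) (hx : x ≤ x') (hy : y ≤ y') :
    lpMod γ₁ γ₂ F x y ≤ lpMod γ₁ γ₂ F x' y' :=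
  lpMod_le_iff.2 fun _ h₁ _ h₂ => le_lpMod F (h₁.trans hx) (h₂.trans hy)

lemma lpMod_le_enorm {γ₁ γ₂ : ℝ} (hγ₁ : 0 < γ₁) (hγ₂ : 0 < γ₂) (F : LpT q) (t₁ t₂ : ℝ) :
    lpMod γ₁ γ₂ F t₁ t₂ ≤
      ENNReal.ofReal ((∑' ν, |dcoef γ₁ ν|) * ∑' ν, |dcoef γ₂ ν|) * ‖F‖ₑ := by
  have h0 : 0 ≤ ∑' ν, |dcoef γ₁ ν| := tsum_nonneg fun _ => abs_nonneg _
  refine lpMod_le_iff.2 fun h₁ _ h₂ _ => ?_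
  rw [← ofReal_norm, ← ofReal_norm, ← ENNReal.ofReal_mul (by positivity)]
  refine ENNReal.ofReal_le_ofReal ((norm_fdiff_le 0 hγ₁ h₁ _).trans ?_)
  rw [mul_assoc]
  exact mul_le_mul_of_nonneg_left (norm_fdiff_le 1 hγ₂ h₂ F) h0

lemma lpMod_le_add (γ₁ γ₂ : ℝ) (F G : LpT q) (t₁ t₂ : ℝ) :
    lpMod γ₁ γ₂ F t₁ t₂ ≤ lpMod γ₁ γ₂ G t₁ t₂ + lpMod γ₁ γ₂ (F - G) t₁ t₂ := by
  refine lpMod_le_iff.2 fun h₁ hh₁ h₂ hh₂ => ?_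
  calc _ = ‖fdiff q 0 γ₁ h₁ (fdiff q 1 γ₂ h₂ G) + fdiff q 0 γ₁ h₁ (fdiff q 1 γ₂ h₂ (F - G))‖ₑ := by
        rw [map_sub, map_sub, add_sub_cancel]
    _ ≤ _ := (enorm_add_le _ _).trans (add_le_add (le_lpMod G hh₁ hh₂) (le_lpMod _ hh₁ hh₂))

lemma lpMod_sub_comm (γ₁ γ₂ : ℝ) (F G : LpT q) (t₁ t₂ : ℝ) :
    lpMod γ₁ γ₂ (F - G) t₁ t₂ = lpMod γ₁ γ₂ (G - F) t₁ t₂ := by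
  rw [← neg_sub]
  simp only [lpMod, map_neg, enorm_neg]

lemma lpMod_sub_le (γ₁ γ₂ : ℝ) (F G : LpT q) (t₁ t₂ : ℝ) :
    lpMod γ₁ γ₂ (F - G) t₁ t₂ ≤ lpMod γ₁ γ₂ F t₁ t₂ + lpMod γ₁ γ₂ G t₁ t₂ := by
  refine lpMod_le_iff.2 fun h₁ hh₁ h₂ hh₂ => ?_
  rw [map_sub, map_sub]
  exact enorm_sub_le.trans (add_le_add (le_lpMod F hh₁ hh₂) (le_lpMod G hh₁ hh₂))

lemma tendsto_lpMod_zero {ι : Type*} {l : Filter ι} {F : ι → LpT q} (hF : Tendsto F l (𝓝 0))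
    {γ₁ γ₂ : ℝ} (hγ₁ : 0 < γ₁) (hγ₂ : 0 < γ₂) (t₁ t₂ : ℝ) :
    Tendsto (fun i => lpMod γ₁ γ₂ (F i) t₁ t₂) l (𝓝 0) := by
  refine tendsto_of_tendsto_of_tendsto_of_le_of_le tendsto_const_nhds ?_ (fun _ => zero_le)
    fun i => lpMod_le_enorm hγ₁ hγ₂ (F i) t₁ t₂
  have := ENNReal.Tendsto.const_mul (a := ENNReal.ofReal ((∑' ν, |dcoef γ₁ ν|) *
    ∑' ν, |dcoef γ₂ ν|)) hF.enorm (.inr (by finiteness))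
  rwa [enorm_zero, mul_zero] at this

lemma tendsto_lpMod {F : ℕ → LpT q} {G : LpT q} (hF : Tendsto F atTop (𝓝 G)) {γ₁ γ₂ : ℝ}
    (hγ₁ : 0 < γ₁) (hγ₂ : 0 < γ₂) (t₁ t₂ : ℝ) :
    Tendsto (fun n => lpMod γ₁ γ₂ (F n) t₁ t₂) atTop (𝓝 (lpMod γ₁ γ₂ G t₁ t₂)) := by
  have hG : lpMod γ₁ γ₂ G t₁ t₂ ≠ ⊤ :=
    ne_top_of_le_ne_top (by finiteness) (lpMod_le_enorm hγ₁ hγ₂ G t₁ t₂)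
  rw [ENNReal.tendsto_nhds hG]
  intro ε hε
  have h0 := tendsto_lpMod_zero (F := fun n => F n - G) (by simpa using hF.sub_const G) hγ₁ hγ₂ t₁ t₂
  filter_upwards [h0.eventually_le_const hε] with n hn
  constructor
  · refine tsub_le_iff_right.2 ((lpMod_le_add γ₁ γ₂ G (F n) t₁ t₂).trans ?_)
    rw [lpMod_sub_comm]
    exact add_le_add_right hn _
  · exact (lpMod_le_add γ₁ γ₂ (F n) G t₁ t₂).trans (add_le_add_right hn _)

end Torus

section Torus

open Filter Topology

/-- The frequencies with no zero coordinate. -/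
abbrev Freq : Type := {m : Fin 2 → ℤ // m 0 ≠ 0 ∧ m 1 ≠ 0}

/-- The coordinates of a frequency. -/
def freq (i : Fin 2) (j : Freq) : ℝ := j.1 i

lemma one_le_abs_freq (i : Fin 2) (j : Freq) : 1 ≤ |freq i j| := by
  have h : j.1 i ≠ 0 := by
    revert i
    exact Fin.forall_fin_two.2 j.2
  rw [freq]
  exact_mod_cast Int.one_le_abs h

lemma freq_ne_zero (i : Fin 2) (j : Freq) : freq i j ≠ 0 :=
  abs_pos.1 (one_pos.trans_le (one_le_abs_freq i j))

variable {q : ℝ≥0∞} [Fact (1 ≤ q)]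

variable (q) in
/-- The trigonometric polynomial with given coefficients at the frequencies with no zero
coordinate. -/
def polyFreq : (Freq →₀ ℂ) →ₗ[ℂ] LpT q := Finsupp.linearCombination ℂ fun j : Freq => expLp q j.1

lemma polyFreq_eq (c : Freq →₀ ℂ) : polyFreq q c = poly q (c.mapDomain Subtype.val) :=
  (Finsupp.linearCombination_mapDomain ℂ (v' := expLp q) Subtype.val c).symm

lemma modulationInvariant_polyFreq (i : Fin 2) :
    ModulationInvariant (polyFreq q) (freq i) := fun s c => by
  have e := linearCombination_symbol_smul (T := (shift q i s).toContinuousLinearMap)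
    (fun j : Freq => shift_expLp i s j.1) c
  exact (congrArg norm e).trans ((shift q i s).norm_map _)

lemma polyFreq_dsym_smul (i : Fin 2) {γ : ℝ} (hγ : 0 < γ) (h : ℝ) (c : Freq →₀ ℂ) :
    polyFreq q ((fun j => dsym γ (h * freq i j)) • c) = fdiff q i γ h (polyFreq q c) :=
  linearCombination_symbol_smul (fun j : Freq => fdiff_expLp i hγ h j.1) c

lemma symbolMod_polyFreq {γ₁ γ₂ : ℝ} (hγ₁ : 0 < γ₁) (hγ₂ : 0 < γ₂) (c : Freq →₀ ℂ) :
    symbolMod (polyFreq q) (freq 0) (freq 1) γ₁ γ₂ c = lpMod γ₁ γ₂ (polyFreq q c) := by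
  ext t₁ t₂
  simp only [symbolMod, lpMod, polyFreq_dsym_smul _ hγ₁, polyFreq_dsym_smul _ hγ₂]

lemma coef_polyFreq (c : Freq →₀ ℂ) (j : Freq) : coef q j.1 (polyFreq q c) = c j := by
  rw [polyFreq_eq, coef_poly, Finsupp.mapDomain_apply Subtype.val_injective]

lemma coef_polyFreq_eq_zero (c : Freq →₀ ℂ) {m : Fin 2 → ℤ} (hm : ¬ (m 0 ≠ 0 ∧ m 1 ≠ 0)) :
    coef q m (polyFreq q c) = 0 := by
  rw [polyFreq_eq, coef_poly, Finsupp.mapDomain_of_notMem_range]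
  rintro ⟨j, rfl⟩
  exact hm j.2

/-- The Fourier coefficients at frequencies with a zero coordinate vanish. -/
def IsMeanZero (F : LpT q) : Prop := ∀ m : Fin 2 → ℤ, ¬ (m 0 ≠ 0 ∧ m 1 ≠ 0) → coef q m F = 0

/-- The part of `cut n F` at the frequencies with no zero coordinate. -/
def cutFreq (n : ℕ) (F : LpT q) : Freq →₀ ℂ := (cut n F).subtypeDomain _

lemma cutFreq_apply (n : ℕ) (F : LpT q) (j : Freq) : cutFreq n F j = cutSym n j.1 * coef q j.1 F :=
  rfl

lemma polyFreq_cutFreq (n : ℕ) {F : LpT q} (hF : IsMeanZero F) :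
    polyFreq q (cutFreq n F) = poly q (cut n F) := by
  classical
  rw [polyFreq_eq, cutFreq]
  congr 1
  have e := Finsupp.extendDomain_subtypeDomain (P := fun m : Fin 2 → ℤ => m 0 ≠ 0 ∧ m 1 ≠ 0)
    (cut n F) fun m hm => by
      by_contra h
      exact Finsupp.mem_support_iff.1 hm (by rw [cut_apply, hF m h, mul_zero])
  rwa [Finsupp.extendDomain_eq_embDomain_subtype, Finsupp.embDomain_eq_mapDomain] at e

lemma fdiff_poly_cut (hq : q ≠ ⊤) (n : ℕ) (i : Fin 2) {γ : ℝ} (hγ : 0 < γ) (h : ℝ) (F : LpT q) :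
    fdiff q i γ h (poly q (cut n F)) = poly q (cut n (fdiff q i γ h F)) := by
  rw [cut_fdiff hq n i hγ, poly_dsym_smul i hγ]

lemma lpMod_poly_cut_le (hq : q ≠ ⊤) {A : ℝ}
    (hA : ∀ n (F : LpT q), ‖poly q (cut n F)‖ ≤ A * ‖F‖) (n : ℕ) {γ₁ γ₂ : ℝ} (hγ₁ : 0 < γ₁)
    (hγ₂ : 0 < γ₂) (F : LpT q) (t₁ t₂ : ℝ) :
    lpMod γ₁ γ₂ (poly q (cut n F)) t₁ t₂ ≤ ENNReal.ofReal A * lpMod γ₁ γ₂ F t₁ t₂ := by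
  refine lpMod_le_iff.2 fun h₁ hh₁ h₂ hh₂ => ?_
  rw [fdiff_poly_cut hq n 1 hγ₂, fdiff_poly_cut hq n 0 hγ₁]
  refine le_trans ?_ (mul_le_mul_right (le_lpMod F hh₁ hh₂) _)
  rw [← ofReal_norm, ← ofReal_norm, ← ENNReal.ofReal_mul' (norm_nonneg _)]
  exact ENNReal.ofReal_le_ofReal (hA n _)

lemma ipow_neg_smul (s₁ s₂ : ℝ) (c : Freq →₀ ℂ) :
    (fun j => ipow (-s₁) (freq 0 j)) • (fun j => ipow (-s₂) (freq 1 j)) •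
      (fun j => ipow s₁ (freq 0 j)) • (fun j => ipow s₂ (freq 1 j)) • c = c := by
  ext j
  have e (i : Fin 2) (s : ℝ) : ipow (-s) (freq i j) * ipow s (freq i j) = 1 := by
    rw [← ipow_add _ _ (freq_ne_zero i j), neg_add_cancel, ipow, Complex.ofReal_zero,
      Complex.cpow_zero]
  simp only [symbol_smul_apply]
  linear_combination ipow (-s₂) (freq 1 j) * ipow s₂ (freq 1 j) * c j * e 0 s₁ + c j * e 1 s₂

variable {θ τ γ₁ γ₂ s₁ s₂ β₁ β₂ : ℝ}

theorem exists_normInt_le_diffInt (hq : q ≠ ⊤) (hθ : 1 ≤ θ) (hτ : 1 ≤ τ)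
    (hEθ : TwoPointSmooth (LpT q) θ) (hEτ : TwoPointConvex (LpT q) τ) (hs₁ : 0 < s₁) (hs₂ : 0 < s₂)
    (hsγ₁ : s₁ < γ₁) (hsγ₂ : s₂ < γ₂) (hβ₁ : 0 < β₁) (hβ₂ : 0 < β₂) :
    ∃ C : ℝ≥0∞, C ≠ ⊤ ∧ ∀ (δ₁ δ₂ : ℝ) (F G : LpT q), δ₁ ∈ Set.Ioo (0 : ℝ) (1 / 2) →
      δ₂ ∈ Set.Ioo (0 : ℝ) (1 / 2) → IsMeanZero F → IsMeanZero G →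
      (∀ m : Fin 2 → ℤ, coef q m G = ipow s₁ (m 0) * ipow s₂ (m 1) * coef q m F) →
        normInt (lpMod γ₁ γ₂ F) s₁ s₂ τ δ₁ δ₂ ≤
          C * diffInt (lpMod β₁ β₂ G) (γ₁ - s₁) (γ₂ - s₂) θ δ₁ δ₂ := by
  have hθ0 : 0 < θ := by linarith
  have hτ0 : 0 < τ := by linarith
  have hγ₁ := hs₁.trans hsγ₁
  have hγ₂ := hs₂.trans hsγ₂
  obtain ⟨A, hA, hAb⟩ := exists_cut_bound hq
  obtain ⟨C, hC, h⟩ := exists_normSum_le_diffSumCut (modulationInvariant_polyFreq (q := q) 0)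
    (modulationInvariant_polyFreq 1) (one_le_abs_freq 0) (one_le_abs_freq 1) hθ hτ hEθ hEτ hs₁ hs₂
    hsγ₁ hsγ₂ hβ₁ hβ₂
  refine ⟨(ENNReal.ofReal (2 ^ (s₁ * τ)) * ENNReal.ofReal (2 ^ (s₂ * τ))) ^ (1 / τ) *
    (C * (ENNReal.ofReal A * (ENNReal.ofReal (2 ^ ((γ₁ - s₁) * θ + 1)) *
      ENNReal.ofReal (2 ^ ((γ₂ - s₂) * θ + 1))) ^ (1 / θ))), by finiteness,
    fun δ₁ δ₂ F G hδ₁ hδ₂ hF hG hFG => ?_⟩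
  refine (normInt_le_normSum (lpMod_mono γ₁ γ₂ F) hs₁ hs₂ hτ0 hδ₁.1 hδ₂.1).trans ?_
  rw [mul_assoc]
  refine mul_le_mul_right ?_ _
  refine normSum_le_of_tendsto hτ0
    (fun x y => tendsto_lpMod (tendsto_poly_cut hq F) hγ₁ hγ₂ x y) fun n => ?_
  have e : cutFreq n G =
      (fun j => ipow s₁ (freq 0 j)) • (fun j => ipow s₂ (freq 1 j)) • cutFreq n F := by
    ext j
    simp only [cutFreq_apply, symbol_smul_apply, hFG, freq]
    ring
  have hn := h δ₁ δ₂ (cutFreq n G) hδ₁ hδ₂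
  rw [e, ipow_neg_smul, ← e, symbolMod_polyFreq hγ₁ hγ₂, symbolMod_polyFreq hβ₁ hβ₂,
    polyFreq_cutFreq n hF, polyFreq_cutFreq n hG] at hn
  refine hn.trans ?_
  rw [mul_assoc, mul_assoc]
  refine mul_le_mul_right ((diffSumCut_le_mul (lpMod_poly_cut_le hq hAb n hβ₁ hβ₂ G) hθ0
    δ₁ δ₂).trans (mul_le_mul_right ?_ _)) _
  exact diffSumCut_le_diffInt (lpMod_mono β₁ β₂ G) (sub_pos.2 hsγ₁) (sub_pos.2 hsγ₂) hθ0 hδ₁.1 hδ₂.1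

theorem exists_diffInt_le_normInt (hq : q ≠ ⊤) (hθ : 1 ≤ θ) (hτ : 1 ≤ τ)
    (hEθ : TwoPointSmooth (LpT q) θ) (hEτ : TwoPointConvex (LpT q) τ) (hs₁ : 0 < s₁) (hs₂ : 0 < s₂)
    (hsγ₁ : s₁ < γ₁) (hsγ₂ : s₂ < γ₂) (hβ₁ : γ₁ - s₁ < β₁) (hβ₂ : γ₂ - s₂ < β₂) :
    ∃ C : ℝ≥0∞, C ≠ ⊤ ∧ ∀ F : LpT q, IsMeanZero F → normInt (lpMod γ₁ γ₂ F) s₁ s₂ θ 1 1 ≠ ⊤ →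
      ∃ G : LpT q, IsMeanZero G ∧
        (∀ m : Fin 2 → ℤ, coef q m G = ipow s₁ (m 0) * ipow s₂ (m 1) * coef q m F) ∧
        ∀ δ₁ δ₂ : ℝ, 0 < δ₁ → 0 < δ₂ → diffInt (lpMod β₁ β₂ G) (γ₁ - s₁) (γ₂ - s₂) τ δ₁ δ₂ ≤
          C * normInt (lpMod γ₁ γ₂ F) s₁ s₂ θ δ₁ δ₂ := by
  have hθ0 : 0 < θ := by linarith
  have hτ0 : 0 < τ := by linarith
  have hγ₁ := hs₁.trans hsγ₁
  have hγ₂ := hs₂.trans hsγ₂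
  have hβ₁0 := (sub_pos.2 hsγ₁).trans hβ₁
  have hβ₂0 := (sub_pos.2 hsγ₂).trans hβ₂
  obtain ⟨A, hA, hAb⟩ := exists_cut_bound hq
  obtain ⟨C, hC, h⟩ := exists_diffSum_le_normSum (modulationInvariant_polyFreq (q := q) 0)
    (modulationInvariant_polyFreq 1) (freq_ne_zero 0) (freq_ne_zero 1) hθ hτ hEθ hEτ hγ₁ hγ₂
    hsγ₁ hsγ₂ hβ₁ hβ₂
  obtain ⟨C', hC', h'⟩ := exists_enorm_le_normSum (modulationInvariant_polyFreq (q := q) 0)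
    (modulationInvariant_polyFreq 1) (one_le_abs_freq 0) (one_le_abs_freq 1) hθ hEθ hγ₁ hγ₂ s₁ s₂
  refine ⟨(ENNReal.ofReal (2 ^ ((γ₁ - s₁) * τ)) * ENNReal.ofReal (2 ^ ((γ₂ - s₂) * τ))) ^ (1 / τ) *
    (C * (ENNReal.ofReal A * (ENNReal.ofReal (2 ^ (s₁ * θ + 1)) *
      ENNReal.ofReal (2 ^ (s₂ * θ + 1))) ^ (1 / θ))), by finiteness, fun F hF hfin => ?_⟩
  set d : ℕ → Freq →₀ ℂ := fun n =>
    (fun j => ipow s₁ (freq 0 j)) • (fun j => ipow s₂ (freq 1 j)) • cutFreq n F with hd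
  have hcut (n : ℕ) (x y : ℝ) : lpMod γ₁ γ₂ (poly q (cut n F)) x y ≤
      ENNReal.ofReal A * lpMod γ₁ γ₂ F x y := lpMod_poly_cut_le hq hAb n hγ₁ hγ₂ F x y
  have hfin' : normSum (lpMod γ₁ γ₂ F) s₁ s₂ θ (1 / 2) (1 / 2) ≠ ⊤ :=
    ne_top_of_le_ne_top (by finiteness)
      (normSum_le_normInt (lpMod_mono γ₁ γ₂ F) hs₁ hs₂ hθ0 one_pos one_pos)
  have hcauchy : CauchySeq fun n => polyFreq q (d n) := by
    rw [cauchySeq_iff_tendsto_dist_atTop_0]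
    have key (p : ℕ × ℕ) : ‖polyFreq q (d p.1) - polyFreq q (d p.2)‖ₑ ≤ C' * normSum
        (lpMod γ₁ γ₂ (poly q (cut p.1 F) - poly q (cut p.2 F))) s₁ s₂ θ (1 / 2) (1 / 2) := by
      have e : d p.1 - d p.2 = (fun j => ipow s₁ (freq 0 j)) • (fun j => ipow s₂ (freq 1 j)) •
          (cutFreq p.1 F - cutFreq p.2 F) := by
        ext j
        simp only [hd, Finsupp.sub_apply, symbol_smul_apply]
        ring
      have := h' (d p.1 - d p.2)
      rwa [e, ipow_neg_smul, ← e, symbolMod_polyFreq hγ₁ hγ₂, map_sub, map_sub,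
        polyFreq_cutFreq _ hF, polyFreq_cutFreq _ hF] at this
    have h0 : Tendsto (fun p : ℕ × ℕ => poly q (cut p.1 F) - poly q (cut p.2 F)) atTop (𝓝 0) := by
      have t := tendsto_poly_cut hq F
      rw [← prod_atTop_atTop_eq]
      simpa using (t.comp tendsto_fst).sub (t.comp tendsto_snd)
    have h1 := tendsto_normSum_zero (a₁ := s₁) (a₂ := s₂) (δ₁ := 1 / 2) (δ₂ := 1 / 2)
      (A := 2 * ENNReal.ofReal A) hθ0
      (fun x y => tendsto_lpMod_zero h0 hγ₁ hγ₂ x y) (by finiteness) (fun p x y => by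
        refine (lpMod_sub_le ..).trans ?_
        rw [mul_assoc, two_mul]
        exact add_le_add (hcut _ x y) (hcut _ x y)) hfin'
    have h2 := ENNReal.Tendsto.const_mul (a := C') h1 (.inr hC')
    rw [mul_zero] at h2
    have h3 := tendsto_of_tendsto_of_tendsto_of_le_of_le tendsto_const_nhds h2 (fun _ => zero_le) key
    have h4 := (ENNReal.tendsto_toReal ENNReal.zero_ne_top).comp h3
    simpa [Function.comp_def, dist_eq_norm] using h4
  obtain ⟨G, hG⟩ := cauchySeq_tendsto_of_complete hcauchy
  have hcoef (m : Fin 2 → ℤ) : Tendsto (fun n => coef q m (polyFreq q (d n))) atTop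
      (𝓝 (coef q m G)) := ((coef q m).continuous.tendsto G).comp hG
  have hG0 : IsMeanZero G := fun m hm => by
    refine tendsto_nhds_unique (hcoef m) ?_
    simp only [coef_polyFreq_eq_zero _ hm, tendsto_const_nhds]
  refine ⟨G, hG0, fun m => ?_, fun δ₁ δ₂ hδ₁ hδ₂ => ?_⟩
  · by_cases hm : m 0 ≠ 0 ∧ m 1 ≠ 0
    · refine tendsto_nhds_unique (hcoef m) (tendsto_const_nhds.congr' ?_)
      filter_upwards [cutSym_eq_one m] with n hn
      rw [coef_polyFreq (d n) ⟨m, hm⟩]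
      simp only [hd, symbol_smul_apply, cutFreq_apply, hn, freq]
      ring
    · rw [hG0 m hm, hF m hm, mul_zero]
  · refine (diffInt_le_diffSum (lpMod_mono β₁ β₂ G) (sub_pos.2 hsγ₁) (sub_pos.2 hsγ₂) hτ0
      hδ₁ hδ₂).trans ?_
    rw [mul_assoc]
    refine mul_le_mul_right ?_ _
    refine diffSum_le_of_tendsto hτ0 (fun x y => tendsto_lpMod hG hβ₁0 hβ₂0 x y) fun n => ?_
    have hn := h δ₁ δ₂ (d n) hδ₁ hδ₂
    rw [hd, ipow_neg_smul, symbolMod_polyFreq hγ₁ hγ₂, symbolMod_polyFreq hβ₁0 hβ₂0,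
      polyFreq_cutFreq n hF] at hn
    refine hn.trans ?_
    rw [mul_assoc, mul_assoc]
    refine mul_le_mul_right ((normSum_le_mul (hcut n) hθ0 _ _).trans (mul_le_mul_right ?_ _)) _
    exact normSum_le_normInt (lpMod_mono γ₁ γ₂ F) hs₁ hs₂ hθ0 hδ₁ hδ₂

end Torus

/-! ### Periodic functions of two variables as functions on the torus -/

section Torus

open UnitAddTorus (mFourier)

/-- The point `x / 2π` of the circle of length one. -/
def toCircle (x : ℝ) : UnitAddCircle := ((x / (2 * π) : ℝ) : UnitAddCircle)

lemma two_pi_ne_zero' : (2 * π : ℝ) ≠ 0 := by positivity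

lemma toCircle_add (x y : ℝ) : toCircle (x + y) = toCircle x + toCircle y := by
  rw [toCircle, add_div, AddCircle.coe_add, toCircle, toCircle]

lemma measurable_toCircle : Measurable toCircle :=
  (AddCircle.measurable_mk').comp (measurable_id.div_const _)

lemma lintegral_toCircle (φ : UnitAddCircle → ℝ≥0∞) :
    ∫⁻ x in Set.Ioc (0 : ℝ) (2 * π), φ (toCircle x) = ENNReal.ofReal (2 * π) * ∫⁻ a, φ a := by
  let e := (Homeomorph.mulLeft₀ (2 * π) two_pi_ne_zero').toMeasurableEquiv
  have he : ∀ x, e x = 2 * π * x := fun _ => rfl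
  have h : (volume : Measure ℝ) = ENNReal.ofReal (2 * π) • Measure.map e volume := by
    change _ = _ • Measure.map (2 * π * ·) volume
    rw [Real.map_volume_mul_left two_pi_ne_zero', smul_smul, abs_of_pos (by positivity),
      ← ENNReal.ofReal_mul (by positivity), mul_inv_cancel₀ two_pi_ne_zero', ENNReal.ofReal_one,
      one_smul]
  conv_lhs => rw [h]
  have hI : e ⁻¹' Set.Ioc 0 (2 * π) = Set.Ioc 0 1 := by
    ext x
    simp only [Set.mem_preimage, he, Set.mem_Ioc]
    rw [mul_le_iff_le_one_right (by positivity), mul_pos_iff_of_pos_left (by positivity)]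
  rw [Measure.restrict_smul, lintegral_smul_measure, smul_eq_mul, e.restrict_map, lintegral_map_equiv,
    hI, ← UnitAddCircle.lintegral_preimage 0 φ, zero_add]
  congr 1
  refine lintegral_congr fun x => ?_
  rw [toCircle, he, mul_div_cancel_left₀ _ two_pi_ne_zero']

lemma integral_toCircle {E : Type*} [NormedAddCommGroup E] [NormedSpace ℝ E] (φ : UnitAddCircle → E) :
    ∫ x in (0 : ℝ)..(2 * π), φ (toCircle x) = (2 * π) • ∫ a, φ a := by
  rw [← UnitAddCircle.intervalIntegral_preimage 0 φ, zero_add]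
  have := intervalIntegral.integral_comp_div (a := 0) (b := 2 * π)
    (fun x : ℝ => φ (x : UnitAddCircle)) two_pi_ne_zero'
  rwa [zero_div, div_self two_pi_ne_zero'] at this

lemma quasiMeasurePreserving_toCircle : Measure.QuasiMeasurePreserving toCircle volume volume := by
  have h1 : Measure.QuasiMeasurePreserving (fun x : ℝ => x / (2 * π)) volume volume := by
    simp only [div_eq_inv_mul]
    refine ⟨measurable_const_mul _, ?_⟩
    rw [Real.map_volume_mul_left (inv_ne_zero two_pi_ne_zero')]
    exact Measure.smul_absolutelyContinuous
  have h2 : Measure.QuasiMeasurePreserving (fun x : ℝ => (x : UnitAddCircle)) volume volume := by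
    refine ⟨AddCircle.measurable_mk', Measure.AbsolutelyContinuous.mk fun s hs h0 => ?_⟩
    rw [Measure.map_apply AddCircle.measurable_mk' hs, ← Measure.restrict_univ (μ := volume),
      ← iUnion_Ioc_add_intCast (0 : ℝ)]
    change (volume.restrict _) {x : ℝ | (x : UnitAddCircle) ∈ s} = 0
    rw [← compl_compl {x : ℝ | (x : UnitAddCircle) ∈ s}, ← mem_ae_iff]
    refine (ae_restrict_iUnion_iff _ fun x : ℝ => ¬ (x : UnitAddCircle) ∈ s).2 fun n => ?_
    exact (UnitAddCircle.measurePreserving_mk _).quasiMeasurePreserving.ae (measure_eq_zero_iff_ae_notMem.1 h0)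
  exact h2.comp h1

/-- The point of the torus with coordinate `i` equal to `a` and the other one equal to `b`. -/
def pt (i : Fin 2) (a b : UnitAddCircle) : Torus := Function.update (fun _ => b) i a

lemma measurePreserving_pt (i : Fin 2) :
    MeasurePreserving (fun p : UnitAddCircle × UnitAddCircle => pt i p.1 p.2) volume volume := by
  have h := (volume_preserving_finTwoArrow UnitAddCircle).symm
  fin_cases i
  · convert! h using 2 with p
    ext j
    fin_cases j <;> rfl
  · convert! h.comp (Measure.measurePreserving_swap) using 2 with p
    ext j
    fin_cases j <;> rfl

/-- The point of the torus which corresponds to `(x, y)`. -/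
def toTorus (x y : ℝ) : Torus := pt 0 (toCircle x) (toCircle y)

lemma toTorus_eq (x y : ℝ) : toTorus x y = pt 1 (toCircle y) (toCircle x) := by
  ext j
  fin_cases j <;> rfl

lemma toTorus_eq_stepPt (x y : ℝ) : toTorus x y = stepPt 0 x + stepPt 1 y := by
  ext j
  fin_cases j <;> simp [toTorus, pt, stepPt, toCircle]

lemma toTorus_add_left (x s y : ℝ) : toTorus (x + s) y = toTorus x y + stepPt 0 s := by
  ext j
  fin_cases j <;> simp [toTorus, pt, stepPt, toCircle, add_div]

lemma toTorus_add_right (x y s : ℝ) : toTorus x (y + s) = toTorus x y + stepPt 1 s := by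
  ext j
  fin_cases j <;> simp [toTorus, pt, stepPt, toCircle, add_div]

lemma measurable_toTorus : Measurable fun p : ℝ × ℝ => toTorus p.1 p.2 :=
  (measurePreserving_pt 0).measurable.comp
    ((measurable_toCircle.comp measurable_fst).prodMk (measurable_toCircle.comp measurable_snd))

lemma lintegral_toTorus {H : Torus → ℝ≥0∞} (hH : AEMeasurable H) :
    ∫⁻ x in Set.Ioc (0 : ℝ) (2 * π), ∫⁻ y in Set.Ioc (0 : ℝ) (2 * π), H (toTorus x y) =
      ENNReal.ofReal (2 * π) ^ 2 * ∫⁻ t, H t := by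
  have h (x : ℝ) : ∫⁻ y in Set.Ioc (0 : ℝ) (2 * π), H (toTorus x y) =
      ENNReal.ofReal (2 * π) * ∫⁻ b, H (pt 0 (toCircle x) b) := lintegral_toCircle fun b => H (pt 0 (toCircle x) b)
  simp only [h]
  rw [lintegral_toCircle fun a => ENNReal.ofReal (2 * π) * ∫⁻ b, H (pt 0 a b),
    lintegral_const_mul' _ _ ENNReal.ofReal_ne_top, pow_two, mul_assoc]
  have hp := measurePreserving_pt 0
  rw [← hp.map_eq] at hH
  rw [← hp.map_eq, lintegral_map' hH hp.measurable.aemeasurable]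
  erw [lintegral_prod _ (hH.comp_measurable hp.measurable)]
  rfl

end Torus

/-! ### Differences and moduli of periodic functions -/

section Torus

open UnitAddTorus (mFourier)

/-- The representative in `(0, 2π]` of a point of the circle. -/
def circleRep (a : UnitAddCircle) : ℝ := 2 * π * (AddCircle.equivIoc 1 0 a : ℝ)

lemma measurable_circleRep : Measurable circleRep :=
  (measurable_subtype_coe.comp (AddCircle.measurableEquivIoc 1 0).measurable).const_mul _

lemma circleRep_toCircle (x : ℝ) : ∃ n : ℤ, circleRep (toCircle x) = x + n * (2 * π) := by
  have h : ((AddCircle.equivIoc 1 0 (toCircle x) - x / (2 * π) : ℝ) : UnitAddCircle) = 0 := by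
    rw [AddCircle.coe_sub, AddCircle.coe_equivIoc, toCircle, sub_self]
  obtain ⟨n, hn⟩ := (AddCircle.coe_eq_zero_iff _).1 h
  refine ⟨n, ?_⟩
  rw [circleRep, ← sub_add_cancel (AddCircle.equivIoc 1 0 (toCircle x) : ℝ) (x / (2 * π)), ← hn]
  have := two_pi_ne_zero'
  simp only [zsmul_eq_mul, mul_one]
  field_simp
  ring

/-- The function on the torus which corresponds to a periodic function of two variables. -/
def onTorus (f : ℝ → ℝ → ℝ) (t : Torus) : ℝ := f (circleRep (t 0)) (circleRep (t 1))

variable {p : ℝ} {f : ℝ → ℝ → ℝ}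

lemma measurable_onTorus (hf : MemLp0 p f) : Measurable (onTorus f) := by
  have h (j : Fin 2) : Measurable fun t : Torus => circleRep (t j) :=
    measurable_circleRep.comp (measurable_pi_apply j)
  exact hf.meas.comp ((h 0).prodMk (h 1))

lemma onTorus_toTorus (hf : MemLp0 p f) : (fun x y => onTorus f (toTorus x y)) = f := by
  ext x y
  obtain ⟨m, hm⟩ := circleRep_toCircle x
  obtain ⟨n, hn⟩ := circleRep_toCircle y
  have h0 : toTorus x y 0 = toCircle x := rfl
  have h1 : toTorus x y 1 = toCircle y := rfl
  rw [onTorus, h0, h1, hm, hn]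
  exact ((hf.periodic_x _).int_mul m x).trans ((hf.periodic_y _).int_mul n y)

/-- The ratio of the norms on the square and on the torus. -/
def normConst (p : ℝ) : ℝ≥0∞ := (ENNReal.ofReal (2 * π) ^ 2) ^ (1 / p)

lemma normConst_ne_zero (p : ℝ) : normConst p ≠ 0 := by
  have h : ENNReal.ofReal (2 * π) ≠ 0 := by simpa using Real.pi_pos
  exact (ENNReal.rpow_pos (pos_iff_ne_zero.2 (pow_ne_zero 2 h)) (ENNReal.pow_ne_top ENNReal.ofReal_ne_top)).ne'

lemma normConst_ne_top (p : ℝ) (hp : 0 < p) : normConst p ≠ ⊤ :=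
  ENNReal.rpow_ne_top_of_nonneg (by positivity) (ENNReal.pow_ne_top ENNReal.ofReal_ne_top)

lemma Lp2Norm_toTorus_eq_eLpNorm (hp : 1 < p) {w : Torus → ℝ} (hw : AEMeasurable w) :
    Lp2Norm p (fun x y => w (toTorus x y)) =
      normConst p * eLpNorm (fun t => (w t : ℂ)) (ENNReal.ofReal p) volume := by
  have hp0 : 0 < p := zero_lt_one.trans hp
  rw [Lp2Norm, lintegral_toTorus (H := fun t => ENNReal.ofReal (|w t| ^ p))
    (by fun_prop), ENNReal.mul_rpow_of_nonneg _ _ (by positivity),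
    eLpNorm_eq_lintegral_rpow_enorm_toReal (by simpa using hp0) ENNReal.ofReal_ne_top,
    ENNReal.toReal_ofReal hp0.le, normConst]
  congr 2
  refine lintegral_congr fun t => ?_
  rw [← ENNReal.ofReal_rpow_of_nonneg (abs_nonneg _) hp0.le, ← ofReal_norm, Complex.norm_real,
    Real.norm_eq_abs]

variable [Fact (1 ≤ ENNReal.ofReal p)]

lemma aemeasurable_of_ae_eq {q : ℝ≥0∞} {w : Torus → ℝ} {W : LpT q}
    (h : (fun t => (w t : ℂ)) =ᵐ[volume] W) : AEMeasurable w := by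
  have := (Complex.measurable_re.comp_aemeasurable (Lp.aestronglyMeasurable W).aemeasurable).congr
    (g := w) (h.symm.mono fun t ht => by simp [ht])
  exact this

lemma Lp2Norm_toTorus (hp : 1 < p) {w : Torus → ℝ} {W : LpT (ENNReal.ofReal p)}
    (h : (fun t => (w t : ℂ)) =ᵐ[volume] W) :
    Lp2Norm p (fun x y => w (toTorus x y)) = normConst p * ‖W‖ₑ := by
  rw [Lp2Norm_toTorus_eq_eLpNorm hp (aemeasurable_of_ae_eq h), eLpNorm_congr_ae h, Lp.enorm_def]

omit [Fact (1 ≤ ENNReal.ofReal p)]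

/-- The pointwise fractional difference of order `γ` and step `h` in the coordinate `i`. -/
def pdiff (i : Fin 2) (γ h : ℝ) (w : Torus → ℝ) (t : Torus) : ℝ :=
  ∑' ν : ℕ, dcoef γ ν * w (t + stepPt i ((γ - ν) * h))

lemma diffX_toTorus (γ h : ℝ) (w : Torus → ℝ) :
    diffX γ h (fun x y => w (toTorus x y)) = fun x y => pdiff 0 γ h w (toTorus x y) := by
  ext x y
  exact tsum_congr fun ν => congrArg (fun t => dcoef γ ν * w t) (toTorus_add_left _ _ _)

lemma diffY_toTorus (γ h : ℝ) (w : Torus → ℝ) :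
    diffY γ h (fun x y => w (toTorus x y)) = fun x y => pdiff 1 γ h w (toTorus x y) := by
  ext x y
  exact tsum_congr fun ν => congrArg (fun t => dcoef γ ν * w t) (toTorus_add_right _ _ _)

lemma pdiff_ae_eq {q : ℝ≥0∞} [Fact (1 ≤ q)] (i : Fin 2) {γ : ℝ} (hγ : 0 < γ) (h : ℝ)
    {w : Torus → ℝ} {W : LpT q} (hw : (fun t => (w t : ℂ)) =ᵐ[volume] W) :
    (fun t => (pdiff i γ h w t : ℂ)) =ᵐ[volume] fdiff q i γ h W := by
  have hs : ∑' ν : ℕ, ‖(dcoef γ ν : ℂ) • shift q i ((γ - ν) * h) W‖ₑ ≠ ⊤ := by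
    rw [tsum_enorm_ne_top_iff_summable_norm]
    refine ((summable_abs_dcoef hγ).mul_right ‖W‖).congr fun ν => ?_
    rw [norm_smul, LinearIsometry.norm_map, Complex.norm_real, Real.norm_eq_abs]
  have h1 := Lp.hasSum_coeFn_tsum hs
  rw [(hasSum_fdiff i hγ h W).tsum_eq] at h1
  have h2 : ∀ᵐ t : Torus, ∀ ν : ℕ, ((dcoef γ ν : ℂ) • shift q i ((γ - ν) * h) W : LpT q) t =
      ((dcoef γ ν * w (t + stepPt i ((γ - ν) * h)) : ℝ) : ℂ) := by
    rw [ae_all_iff]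
    intro ν
    filter_upwards [Lp.coeFn_smul (dcoef γ ν : ℂ) (shift q i ((γ - ν) * h) W),
      coeFn_shift i ((γ - ν) * h) W, (measurePreserving_add_stepPt i
      ((γ - ν) * h)).quasiMeasurePreserving.ae hw] with t e1 e2 e3
    rw [e1, Pi.smul_apply, e2, ← e3, smul_eq_mul, Complex.ofReal_mul]
  filter_upwards [h1, h2] with t e1 e2
  simp only [e2] at e1
  rw [pdiff, Complex.ofReal_tsum, e1.tsum_eq]

lemma mixedMod_toTorus [Fact (1 ≤ ENNReal.ofReal p)] (hp : 1 < p) {γ₁ γ₂ : ℝ} (hγ₁ : 0 < γ₁)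
    (hγ₂ : 0 < γ₂) {w : Torus → ℝ} {W : LpT (ENNReal.ofReal p)}
    (hw : (fun t => (w t : ℂ)) =ᵐ[volume] W) (t₁ t₂ : ℝ) :
    mixedMod p γ₁ γ₂ t₁ t₂ (fun x y => w (toTorus x y)) = normConst p * lpMod γ₁ γ₂ W t₁ t₂ := by
  simp only [mixedMod, lpMod, ENNReal.mul_iSup, diffY_toTorus, diffX_toTorus,
    Lp2Norm_toTorus hp (pdiff_ae_eq 0 hγ₁ _ (pdiff_ae_eq 1 hγ₂ _ hw))]

lemma exists_lift [Fact (1 ≤ ENNReal.ofReal p)] (hp : 1 < p) (hf : MemLp0 p f) :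
    ∃ (w : Torus → ℝ) (W : LpT (ENNReal.ofReal p)), (fun t => (w t : ℂ)) =ᵐ[volume] W ∧
      f = fun x y => w (toTorus x y) := by
  have hw := measurable_onTorus hf
  have h := hf.norm_ne_top
  rw [← onTorus_toTorus hf, Lp2Norm_toTorus_eq_eLpNorm hp hw.aemeasurable] at h
  have hm : MemLp (fun t => (onTorus f t : ℂ)) (ENNReal.ofReal p) volume :=
    ⟨(Complex.measurable_ofReal.comp hw).aestronglyMeasurable,
      (ENNReal.lt_top_of_mul_ne_top_right h (normConst_ne_zero p))⟩
  exact ⟨onTorus f, hm.toLp _, hm.coeFn_toLp.symm, (onTorus_toTorus hf).symm⟩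

end Torus

/-! ### Fourier coefficients and means of periodic functions -/

section Torus

open UnitAddTorus (mFourier)

variable {q : ℝ≥0∞} [Fact (1 ≤ q)] {w : Torus → ℝ} {W : LpT q}

lemma integrable_comp_pt (i : Fin 2) {φ : Torus → ℂ} (hφ : Integrable φ) :
    Integrable (fun z : UnitAddCircle × UnitAddCircle => φ (pt i z.1 z.2)) (volume.prod volume) :=
  (measurePreserving_pt i).integrable_comp_of_integrable hφ

lemma integral_eq_integral_pt (i : Fin 2) {φ : Torus → ℂ} (hφ : Integrable φ) :
    ∫ t, φ t = ∫ b, ∫ a, φ (pt i a b) := by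
  have hp := measurePreserving_pt i
  have h : ∫ t, φ t = ∫ z : UnitAddCircle × UnitAddCircle, φ (pt i z.1 z.2) ∂volume.prod volume := by
    rw [← hp.map_eq, integral_map hp.measurable.aemeasurable (by rw [hp.map_eq]; exact hφ.1)]
    rfl
  rw [h, integral_prod_symm _ (integrable_comp_pt i hφ)]

lemma integral_toTorus {φ : Torus → ℂ} (hφ : Integrable φ) :
    ∫ x in (0 : ℝ)..(2 * π), ∫ y in (0 : ℝ)..(2 * π), φ (toTorus x y) =
      ((2 * π) ^ 2 : ℝ) * ∫ t, φ t := by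
  have h (x : ℝ) : ∫ y in (0 : ℝ)..(2 * π), φ (toTorus x y) =
      (2 * π) • ∫ a, φ (pt 1 a (toCircle x)) := by
    simp only [toTorus_eq]
    exact integral_toCircle fun a => φ (pt 1 a (toCircle x))
  simp only [h]
  rw [integral_toCircle fun b => (2 * π) • ∫ a, φ (pt 1 a b), integral_smul, smul_smul, ← pow_two,
    integral_eq_integral_pt 1 hφ, Complex.real_smul]

omit [Fact (1 ≤ q)] in
lemma integral_mul_congr (hw : (fun t => (w t : ℂ)) =ᵐ[volume] W) (ψ : Torus → ℂ) :
    ∫ t, ψ t * w t = ∫ t, ψ t * W t :=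
  integral_congr_ae (hw.mono fun t ht => congrArg (ψ t * ·) ht)

lemma integrable_mul_of_ae_eq (hw : (fun t => (w t : ℂ)) =ᵐ[volume] W) {ψ : Torus → ℂ}
    (hψ : Measurable ψ) (h1 : ∀ t, ‖ψ t‖ ≤ 1) : Integrable fun t => ψ t * w t :=
  (integrable_mul_LpT hψ h1 W).congr (hw.mono fun t ht => congrArg (ψ t * ·) ht.symm)

lemma coef_eq_integral (hw : (fun t => (w t : ℂ)) =ᵐ[volume] W) (m : Fin 2 → ℤ) :
    coef q m W = ∫ t, mFourier (-m) t * w t := (integral_mul_congr hw _).symm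

lemma fourierCoefZ_toTorus (hw : (fun t => (w t : ℂ)) =ᵐ[volume] W) (m₁ m₂ : ℤ) :
    fourierCoefZ (fun x y => w (toTorus x y)) m₁ m₂ = coef q ![m₁, m₂] W := by
  have h (x y : ℝ) : (w (toTorus x y) : ℂ) *
      Complex.exp (-Complex.I * ((m₁ : ℂ) * (x : ℂ) + (m₂ : ℂ) * (y : ℂ))) =
      (fun t => mFourier (-![m₁, m₂]) t * w t) (toTorus x y) := by
    simp only
    rw [mul_comm, toTorus_eq_stepPt, mFourier_add_apply, mFourier_stepPt, mFourier_stepPt,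
      ← Complex.exp_add]
    congr 2
    simp
    ring
  simp only [fourierCoefZ, h]
  rw [integral_toTorus (integrable_mul_of_ae_eq hw (mFourier _).continuous.measurable
    fun t => (norm_mFourier_apply _ t).le), coef_eq_integral hw, ← mul_assoc, ← Complex.ofReal_mul,
    inv_mul_cancel₀ (pow_ne_zero 2 two_pi_ne_zero'), Complex.ofReal_one, one_mul]

lemma mFourier_pt {m : Fin 2 → ℤ} {i : Fin 2} (hm : m i = 0) (a b : UnitAddCircle) :
    mFourier m (pt i a b) = mFourier m (pt i 0 b) := by
  simp only [mFourier, ContinuousMap.coe_mk]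
  refine Finset.prod_congr rfl fun j _ => ?_
  by_cases hj : j = i
  · subst hj
    simp only [hm, fourier_zero]
  · rw [pt, pt, Function.update_of_ne hj, Function.update_of_ne hj]

lemma coef_eq_zero_of_mean (hw : (fun t => (w t : ℂ)) =ᵐ[volume] W) {i : Fin 2}
    (h : ∀ᵐ y : ℝ, ∫ x in (0 : ℝ)..(2 * π), w (pt i (toCircle x) (toCircle y)) = 0)
    {m : Fin 2 → ℤ} (hm : m i = 0) : coef q m W = 0 := by
  rw [coef_eq_integral hw, integral_eq_integral_pt i (integrable_mul_of_ae_eq hw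
    (mFourier _).continuous.measurable fun t => (norm_mFourier_apply _ t).le)]
  have hm' : (-m) i = 0 := by rw [Pi.neg_apply, hm, neg_zero]
  simp only [mFourier_pt hm', integral_const_mul]
  have e := integral_toCircle fun b => mFourier (-m) (pt i 0 b) * ∫ a, (w (pt i a b) : ℂ)
  rw [intervalIntegral.integral_zero_ae] at e
  · exact (smul_eq_zero.1 e.symm).resolve_left two_pi_ne_zero'
  · filter_upwards [h] with y hy _
    rw [integral_toCircle fun a => w (pt i a (toCircle y))] at hy
    rw [integral_complex_ofReal, (smul_eq_zero.1 hy).resolve_left two_pi_ne_zero',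
      Complex.ofReal_zero, mul_zero]

lemma isMeanZero_of_memLp0 {p : ℝ} (hw : (fun t => (w t : ℂ)) =ᵐ[volume] W)
    (hf : MemLp0 p fun x y => w (toTorus x y)) : IsMeanZero W := fun m hm => by
  rw [not_and_or, not_not, not_not] at hm
  rcases hm with hm | hm
  · exact coef_eq_zero_of_mean hw (i := 0) hf.mean_x hm
  · refine coef_eq_zero_of_mean hw (i := 1) ?_ hm
    simpa only [toTorus_eq] using hf.mean_y

lemma pairing_eq_zero (hq : q ≠ ⊤) (hW : IsMeanZero W) {ψ : Torus → ℂ} (hψ : Measurable ψ)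
    (h1 : ∀ t, ‖ψ t‖ ≤ 1) {i : Fin 2} (h : ∀ t s, ψ (t + stepPt i s) = ψ t) :
    pairing q ψ hψ h1 W = 0 := by
  have e (c : Freq →₀ ℂ) : pairing q ψ hψ h1 (polyFreq q c) = 0 := by
    rw [polyFreq, Finsupp.linearCombination_apply, Finsupp.sum, map_sum]
    refine Finset.sum_eq_zero fun j _ => ?_
    have hj : j.1 i ≠ 0 := by
      have := j.2
      fin_cases i
      exacts [this.1, this.2]
    rw [map_smul, pairing_expLp, integral_mul_mFourier_eq_zero h hj, smul_zero]
  refine tendsto_nhds_unique (((pairing q ψ hψ h1).continuous.tendsto W).comp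
    (tendsto_poly_cut hq W)) ?_
  simp only [Function.comp_def, ← polyFreq_cutFreq _ hW, e]
  exact tendsto_const_nhds

lemma mean_eq_zero (hq : q ≠ ⊤) (hw : (fun t => (w t : ℂ)) =ᵐ[volume] W) (hW : IsMeanZero W)
    {i j : Fin 2} (hj : j ≠ i) :
    ∀ᵐ y : ℝ, ∫ x in (0 : ℝ)..(2 * π), w (pt i (toCircle x) (toCircle y)) = 0 := by
  have hi : Integrable fun t => (w t : ℂ) := by
    simpa only [one_mul] using integrable_mul_of_ae_eq hw (ψ := fun _ => 1) measurable_const (by simp)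
  have hFint : Integrable fun b => ∫ a, (w (pt i a b) : ℂ) := (integrable_comp_pt i hi).integral_prod_right
  have h0 : (fun b => ∫ a, (w (pt i a b) : ℂ)) =ᵐ[volume] 0 := by
    refine hFint.ae_eq_zero_of_forall_setIntegral_eq_zero fun S hS _ => ?_
    let ψ : Torus → ℂ := fun t => S.indicator 1 (t j)
    have hψ : Measurable ψ := (measurable_one.indicator hS).comp (measurable_pi_apply j)
    have h1 (t) : ‖ψ t‖ ≤ 1 := by
      by_cases ht : t j ∈ S <;> simp [ψ, ht]
    have e := pairing_eq_zero (i := i) hq hW hψ h1 fun t s => by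
      simp only [ψ, Pi.add_apply, stepPt, Pi.single_eq_of_ne hj, add_zero]
    rw [pairing_apply, ← integral_mul_congr hw, integral_eq_integral_pt i
      (integrable_mul_of_ae_eq hw hψ h1)] at e
    have hpt (a b) : ψ (pt i a b) = S.indicator 1 b := by
      simp only [ψ, pt, Function.update_of_ne hj]
    simp only [hpt, integral_const_mul] at e
    rw [← integral_indicator hS, ← e]
    refine integral_congr_ae (.of_forall fun b => ?_)
    by_cases hb : b ∈ S <;> simp [hb]
  filter_upwards [quasiMeasurePreserving_toCircle.ae h0] with y hy
  rw [integral_toCircle fun a => w (pt i a (toCircle y))]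
  rw [integral_complex_ofReal] at hy
  rw [Complex.ofReal_eq_zero.1 hy, smul_zero]

lemma stepPt_two_pi (i : Fin 2) : stepPt i (2 * π) = 0 := by
  rw [stepPt, div_self two_pi_ne_zero', AddCircle.coe_period, Pi.single_zero]

lemma memLp0_toTorus {p : ℝ} [Fact (1 ≤ ENNReal.ofReal p)] (hp : 1 < p)
    {W : LpT (ENNReal.ofReal p)} (hm : Measurable w) (hw : (fun t => (w t : ℂ)) =ᵐ[volume] W)
    (hW : IsMeanZero W) : MemLp0 p fun x y => w (toTorus x y) where
  meas := hm.comp measurable_toTorus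
  periodic_x y x := by simp only [toTorus_add_left, stepPt_two_pi, add_zero]
  periodic_y x y := by simp only [toTorus_add_right, stepPt_two_pi, add_zero]
  norm_ne_top := by
    rw [Lp2Norm_toTorus hp hw]
    exact ENNReal.mul_ne_top (normConst_ne_top p (zero_lt_one.trans hp)) enorm_ne_top
  mean_x := mean_eq_zero ENNReal.ofReal_ne_top hw hW (i := 0) one_ne_zero
  mean_y := by
    simpa only [toTorus_eq] using mean_eq_zero ENNReal.ofReal_ne_top hw hW (i := 1) zero_ne_one

lemma coef_star (m : Fin 2 → ℤ) (F : LpT q) :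
    coef q m (star F) = starRingEnd ℂ (coef q (-m) F) := by
  rw [coef, coef, pairing_apply, pairing_apply, ← integral_conj]
  refine integral_congr_ae ?_
  filter_upwards [Lp.coeFn_star F] with t ht
  rw [ht, neg_neg, map_mul, UnitAddTorus.mFourier_neg]
  rfl

lemma coef_neg_of_real (hw : (fun t => (w t : ℂ)) =ᵐ[volume] W) (m : Fin 2 → ℤ) :
    starRingEnd ℂ (coef q (-m) W) = coef q m W := by
  rw [coef_eq_integral hw, coef_eq_integral hw, ← integral_conj]
  refine integral_congr_ae (.of_forall fun t => ?_)
  simp only [neg_neg, map_mul, Complex.conj_ofReal, UnitAddTorus.mFourier_neg]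

lemma exists_real_of_coef (hq : q ≠ ⊤) (h : ∀ m : Fin 2 → ℤ, starRingEnd ℂ (coef q (-m) W) = coef q m W) :
    ∃ w : Torus → ℝ, Measurable w ∧ (fun t => (w t : ℂ)) =ᵐ[volume] W := by
  have e : star W = W := eq_of_coef_eq hq fun m => by rw [coef_star, h]
  refine ⟨fun t => (W t).re, Complex.measurable_re.comp (Lp.stronglyMeasurable W).measurable, ?_⟩
  have h := Lp.coeFn_star W
  rw [e] at h
  filter_upwards [h] with t ht
  exact Complex.conj_eq_iff_re.1 ht.symm

lemma conj_ipow_neg (s x : ℝ) : starRingEnd ℂ (ipow s (-x)) = ipow s x := by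
  have h : (Complex.I * x).arg ≠ π := by
    rw [Ne, Complex.arg_eq_pi_iff]
    simp
  have := Complex.cpow_conj (Complex.I * x) (s : ℂ) h
  rw [Complex.conj_ofReal] at this
  rw [ipow, ipow, this]
  simp

end Torus

/-! ### Transference to periodic functions -/

section Transfer

lemma lintegral_lintegral_const_mul_rpow {K : ℝ≥0∞} (hK : K ≠ ⊤) {τ : ℝ} (hτ : 0 < τ) (S T : Set ℝ)
    (v N : ℝ → ℝ → ℝ≥0∞) : (∫⁻ x in S, ∫⁻ y in T, v x y * (K * N x y) ^ τ) ^ (1 / τ) =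
      K * (∫⁻ x in S, ∫⁻ y in T, v x y * N x y ^ τ) ^ (1 / τ) := by
  have h : K ^ τ ≠ ⊤ := ENNReal.rpow_ne_top_of_nonneg hτ.le hK
  simp only [ENNReal.mul_rpow_of_nonneg _ _ hτ.le, mul_left_comm _ (K ^ τ), lintegral_const_mul' _ _ h]
  rw [ENNReal.mul_rpow_of_nonneg _ _ (by positivity), ← ENNReal.rpow_mul, mul_one_div_cancel hτ.ne',
    ENNReal.rpow_one]

variable {p τ γ₁ γ₂ β₁ β₂ r₁ r₂ α₁ α₂ : ℝ} [Fact (1 ≤ ENNReal.ofReal p)]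
  {w : Torus → ℝ} {W : LpT (ENNReal.ofReal p)}

lemma Efun_toTorus (hp : 1 < p) (hτ : 0 < τ) (hγ₁ : 0 < r₁ + β₁) (hγ₂ : 0 < r₂ + β₂)
    (hw : (fun t => (w t : ℂ)) =ᵐ[volume] W) (δ₁ δ₂ : ℝ) :
    Efun p β₁ β₂ r₁ r₂ α₁ α₂ δ₁ δ₂ τ (fun x y => w (toTorus x y)) = normConst p *
      normInt (lpMod (r₁ + β₁) (r₂ + β₂) W) (r₁ + α₁) (r₂ + α₂) τ δ₁ δ₂ := by
  simp only [Efun, normInt, mixedMod_toTorus hp hγ₁ hγ₂ hw]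
  exact lintegral_lintegral_const_mul_rpow (normConst_ne_top p (zero_lt_one.trans hp)) hτ _ _
    (fun x y => ENNReal.ofReal _) _

lemma Dfun_toTorus (hp : 1 < p) (hτ : 0 < τ) (hβ₁ : 0 < β₁) (hβ₂ : 0 < β₂)
    (hw : (fun t => (w t : ℂ)) =ᵐ[volume] W) (δ₁ δ₂ : ℝ) :
    Dfun p β₁ β₂ α₁ α₂ δ₁ δ₂ τ (fun x y => w (toTorus x y)) = normConst p *
      diffInt (lpMod β₁ β₂ W) (β₁ - α₁) (β₂ - α₂) τ δ₁ δ₂ := by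
  simp only [Dfun, diffInt, mixedMod_toTorus hp hβ₁ hβ₂ hw]
  exact lintegral_lintegral_const_mul_rpow (normConst_ne_top p (zero_lt_one.trans hp)) hτ _ _
    (fun x y => ENNReal.ofReal _) _

lemma fourierCoefZ_eq_iff {w' : Torus → ℝ} {W' : LpT (ENNReal.ofReal p)}
    (hw : (fun t => (w t : ℂ)) =ᵐ[volume] W) (hw' : (fun t => (w' t : ℂ)) =ᵐ[volume] W')
    (s₁ s₂ : ℝ) :
    (∀ m₁ m₂ : ℤ, fourierCoefZ (fun x y => w' (toTorus x y)) m₁ m₂ =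
      (Complex.I * (m₁ : ℂ)) ^ (s₁ : ℂ) * (Complex.I * (m₂ : ℂ)) ^ (s₂ : ℂ) *
        fourierCoefZ (fun x y => w (toTorus x y)) m₁ m₂) ↔
    ∀ m : Fin 2 → ℤ, coef _ m W' = ipow s₁ (m 0) * ipow s₂ (m 1) * coef _ m W := by
  simp only [fourierCoefZ_toTorus hw, fourierCoefZ_toTorus hw', ipow, Complex.ofReal_intCast]
  refine ⟨fun h m => ?_, fun h m₁ m₂ => h ![m₁, m₂]⟩
  have e : ![m 0, m 1] = m := by
    ext j
    fin_cases j <;> rfl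
  simpa only [e] using h (m 0) (m 1)

lemma exists_real_of_ipow (hw : (fun t => (w t : ℂ)) =ᵐ[volume] W) {G : LpT (ENNReal.ofReal p)}
    {s₁ s₂ : ℝ} (hG : ∀ m : Fin 2 → ℤ, coef _ m G = ipow s₁ (m 0) * ipow s₂ (m 1) * coef _ m W) :
    ∃ v : Torus → ℝ, Measurable v ∧ (fun t => (v t : ℂ)) =ᵐ[volume] G := by
  refine exists_real_of_coef ENNReal.ofReal_ne_top fun m => ?_
  rw [hG, hG, map_mul, map_mul, coef_neg_of_real hw]
  simp only [Pi.neg_apply, Int.cast_neg, conj_ipow_neg]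

end Transfer

end MixedModulus

open MixedModulus

/-- Theorem 8.4 (ii): relations between `D` and `E` for the derivative of order
`(r₁+α₁, r₂+α₂)`. -/
theorem modulus_of_higher_order_derivative (p β₁ β₂ r₁ r₂ α₁ α₂ : ℝ) (hp : 1 < p)
    (hr₁ : 0 < r₁) (hr₂ : 0 < r₂) (hα₁ : 0 < α₁) (hα₂ : 0 < α₂)
    (hαβ₁ : α₁ < β₁) (hαβ₂ : α₂ < β₂) :
    ∃ C : ℝ, 0 < C ∧ ∀ (f : ℝ → ℝ → ℝ) (δ₁ δ₂ : ℝ), MemLp0 p f →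
      δ₁ ∈ Set.Ioo (0:ℝ) (1/2) → δ₂ ∈ Set.Ioo (0:ℝ) (1/2) →
      ((∫⁻ t₁ in Set.Ioo (0:ℝ) 1, ∫⁻ t₂ in Set.Ioo (0:ℝ) 1,
          ENNReal.ofReal (t₁ ^ (-(r₁+α₁)*(min 2 p)-1) * t₂ ^ (-(r₂+α₂)*(min 2 p)-1)) *
            mixedMod p (r₁+β₁) (r₂+β₂) t₁ t₂ f ^ (min 2 p)) ≠ ⊤ →
        ∃ g : ℝ → ℝ → ℝ, HasWeylDeriv p (r₁+α₁) (r₂+α₂) f g ∧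
          Dfun p β₁ β₂ α₁ α₂ δ₁ δ₂ (max 2 p) g ≤
            ENNReal.ofReal C * Efun p β₁ β₂ r₁ r₂ α₁ α₂ δ₁ δ₂ (min 2 p) f) ∧
      (∀ g : ℝ → ℝ → ℝ, HasWeylDeriv p (r₁+α₁) (r₂+α₂) f g →
        Efun p β₁ β₂ r₁ r₂ α₁ α₂ δ₁ δ₂ (max 2 p) f ≤
          ENNReal.ofReal C * Dfun p β₁ β₂ α₁ α₂ δ₁ δ₂ (min 2 p) g) := by
  have hp0 : 0 < p := by linarith
  have : Fact (1 ≤ ENNReal.ofReal p) := ⟨by rw [← ENNReal.ofReal_one]; exact ENNReal.ofReal_le_ofReal hp.le⟩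
  have hθ : 1 ≤ min 2 p := le_min one_le_two hp.le
  have hτ : 1 ≤ max 2 p := le_max_of_le_right hp.le
  have hθ0 : 0 < min 2 p := by linarith
  have hτ0 : 0 < max 2 p := by linarith
  have hβ₁ := hα₁.trans hαβ₁
  have hβ₂ := hα₂.trans hαβ₂
  have hγ₁ : 0 < r₁ + β₁ := by positivity
  have hγ₂ : 0 < r₂ + β₂ := by positivity
  have hs₁ : 0 < r₁ + α₁ := by positivity
  have hs₂ : 0 < r₂ + α₂ := by positivity
  have e₁ : r₁ + β₁ - (r₁ + α₁) = β₁ - α₁ := by ring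
  have e₂ : r₂ + β₂ - (r₂ + α₂) = β₂ - α₂ := by ring
  have hsmooth := twoPointSmooth_Lp (μ := (volume : Measure Torus)) hp
  have hconvex := twoPointConvex_Lp (μ := (volume : Measure Torus)) hp
  obtain ⟨C₁, hC₁, h₁⟩ := exists_diffInt_le_normInt ENNReal.ofReal_ne_top hθ hτ hsmooth hconvex hs₁ hs₂
    (γ₁ := r₁ + β₁) (γ₂ := r₂ + β₂) (by linarith) (by linarith) (β₁ := β₁) (β₂ := β₂)
    (by linarith) (by linarith)
  obtain ⟨C₂, hC₂, h₂⟩ := exists_normInt_le_diffInt ENNReal.ofReal_ne_top hθ hτ hsmooth hconvex hs₁ hs₂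
    (γ₁ := r₁ + β₁) (γ₂ := r₂ + β₂) (by linarith) (by linarith) hβ₁ hβ₂
  rw [e₁, e₂] at h₁ h₂
  have hle {C : ℝ≥0∞} (hB : C ≤ max C₁ C₂) :
      C ≤ ENNReal.ofReal ((max C₁ C₂).toReal + 1) := by
    have hm : max C₁ C₂ ≠ ⊤ := (max_lt hC₁.lt_top hC₂.lt_top).ne
    exact hB.trans ((ENNReal.ofReal_toReal hm).symm.le.trans
      (ENNReal.ofReal_le_ofReal (le_add_of_nonneg_right zero_le_one)))
  refine ⟨(max C₁ C₂).toReal + 1, by positivity, fun f δ₁ δ₂ hf hδ₁ hδ₂ => ?_⟩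
  obtain ⟨w, W, hw, rfl⟩ := exists_lift hp hf
  have hW := isMeanZero_of_memLp0 hw hf
  refine ⟨fun hfin => ?_, fun g hg => ?_⟩
  · have hfin' : Efun p β₁ β₂ r₁ r₂ α₁ α₂ 1 1 (min 2 p) (fun x y => w (toTorus x y)) ≠ ⊤ :=
      ENNReal.rpow_ne_top_of_nonneg (by positivity) hfin
    rw [Efun_toTorus hp hθ0 hγ₁ hγ₂ hw] at hfin'
    obtain ⟨G, hG, hGW, hb⟩ := h₁ W hW
      (ENNReal.lt_top_of_mul_ne_top_right hfin' (normConst_ne_zero p)).ne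
    obtain ⟨v, hv, hvG⟩ := exists_real_of_ipow hw hGW
    refine ⟨fun x y => v (toTorus x y), ⟨memLp0_toTorus hp hv hvG hG,
      (fourierCoefZ_eq_iff hw hvG _ _).2 hGW⟩, ?_⟩
    rw [Dfun_toTorus hp hτ0 hβ₁ hβ₂ hvG, Efun_toTorus hp hθ0 hγ₁ hγ₂ hw, mul_left_comm]
    exact mul_le_mul_right ((hb δ₁ δ₂ hδ₁.1 hδ₂.1).trans
      (mul_le_mul_left (hle (le_max_left _ _)) _)) _
  · obtain ⟨hg, hc⟩ := hg
    obtain ⟨v, G, hv, rfl⟩ := exists_lift hp hg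
    rw [Efun_toTorus hp hτ0 hγ₁ hγ₂ hw, Dfun_toTorus hp hθ0 hβ₁ hβ₂ hv, mul_left_comm]
    exact mul_le_mul_right ((h₂ δ₁ δ₂ W G hδ₁ hδ₂ hW (isMeanZero_of_memLp0 hv hg)
      ((fourierCoefZ_eq_iff hw hv _ _).1 hc)).trans (mul_le_mul_left (hle (le_max_right _ _)) _)) _

end
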